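/- There exist constants C > 0 and K ≥ 2 such that for all κ > 0, t > 0, x ∈ ℝ³, k ∈ ℤ and p, q ∈ ℤ with p ≤ 0 and q ≤ 0, the oscillatory integral I = ∫_{ℝ³} e^{i(t·Ω_κ(ξ) + x·ξ)}·φ(2⁻ᵏ|ξ|)·φ(2^{−k−p}|ξ_h|)·φ(2^{−k−q}ξ₃) dξ satisfies: |I| ≤ C·t^{−3/2}·κ^{3/2}·2^{3k − p − q/2} whenever κ2ᵏ ≥ K; |I| ≤ C·t^{−3/2}·2^{(3/2)k − p − q/2} whenever K⁻¹ ≤ κ2ᵏ ≤ K; and |I| ≤ C·t^{−3/2}·κ^{−3}·2^{−(3/2)k − p − q/2} whenever κ2ᵏ ≤ K⁻¹. (This is the convolution-kernel form of the t^{−3/2} dispersive decay estimate for the Ω half-wave e^{itΩ_κ}P_{k,p,q}.) -/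

import Mathlib

noncomputable section

open MeasureTheory

/-- `ℝ³` with the Euclidean norm. -/
abbrev E3 : Type := EuclideanSpace ℝ (Fin 3)

/-- `d₁(ξ)`, the distance from `ξ` to `(0,0,κ⁻¹)`. -/
def d1 (κ : ℝ) (ξ : E3) : ℝ := Real.sqrt ((ξ 0) ^ 2 + (ξ 1) ^ 2 + (ξ 2 - κ⁻¹) ^ 2)

/-- `d₂(ξ)`, the distance from `ξ` to `(0,0,−κ⁻¹)`. -/
def d2 (κ : ℝ) (ξ : E3) : ℝ := Real.sqrt ((ξ 0) ^ 2 + (ξ 1) ^ 2 + (ξ 2 + κ⁻¹) ^ 2)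

/-- `Σ_κ(ξ) = (d₂(ξ) + d₁(ξ))/2`, the sound wave dispersion relation. -/
def Sig (κ : ℝ) (ξ : E3) : ℝ := (d2 κ ξ + d1 κ ξ) / 2

/-- `Ω_κ(ξ) = (d₂(ξ) − d₁(ξ))/2`, the inertial wave dispersion relation. -/
def Om (κ : ℝ) (ξ : E3) : ℝ := (d2 κ ξ - d1 κ ξ) / 2

/-- The horizontal norm `|ξ_h| = √(ξ₁² + ξ₂²)`. -/
def nrmh (ξ : E3) : ℝ := Real.sqrt ((ξ 0) ^ 2 + (ξ 1) ^ 2)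

/-- `x·ξ`, the Euclidean dot product on `ℝ³`. -/
def dot3 (x ξ : E3) : ℝ := x 0 * ξ 0 + x 1 * ξ 1 + x 2 * ξ 2

/-- The Littlewood–Paley bump `φ(x) = ψ(x/2) − ψ(x)` built from the cutoff `ψ`. -/
def lpBump (ψ : ℝ → ℝ) (y : ℝ) : ℝ := ψ (y / 2) - ψ y

/-- The hypotheses on the cutoff function `ψ`: smooth, `0 ≤ ψ ≤ 1`, supported in `[−2,2]`
and equal to `1` on `[−1,1]`. -/
def IsCutoff (ψ : ℝ → ℝ) : Prop :=
  ContDiff ℝ (⊤ : ℕ∞) ψ ∧ (∀ y, 0 ≤ ψ y ∧ ψ y ≤ 1) ∧ (∀ y, 2 < |y| → ψ y = 0) ∧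
    (∀ y, |y| ≤ 1 → ψ y = 1)

section DerivBounds

variable {V : Type*} [NormedAddCommGroup V] [NormedSpace ℝ V]

/-- `f` is `C^k` at `x`, with all derivatives of order at most `k` bounded by `M` there. -/
structure DerivBound (k : ℕ) (M : ℝ) (f : V → ℝ) (x : V) : Prop where
  contDiffAt : ContDiffAt ℝ k f x
  bound : ∀ j ≤ k, ‖iteratedFDeriv ℝ j f x‖ ≤ M

namespace DerivBound

variable {k l : ℕ} {M N : ℝ} {f g : V → ℝ} {x v : V}

theorem nonneg (h : DerivBound k M f x) : 0 ≤ M :=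
  (norm_nonneg _).trans (h.bound 0 (Nat.zero_le _))

theorem mono (h : DerivBound k M f x) (hl : l ≤ k) (hM : M ≤ N) : DerivBound l N f x :=
  ⟨h.contDiffAt.of_le (by exact_mod_cast hl), fun j hj => (h.bound j (hj.trans hl)).trans hM⟩

theorem abs_le (h : DerivBound k M f x) : |f x| ≤ M := by
  simpa using h.bound 0 (Nat.zero_le _)

theorem mul (hf : DerivBound k M f x) (hg : DerivBound k N g x) :
    DerivBound k (2 ^ k * M * N) (fun y => f y * g y) x := by
  refine ⟨hf.contDiffAt.mul hg.contDiffAt, fun j hj => ?_⟩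
  have hjk : (j : WithTop ℕ∞) ≤ k := by exact_mod_cast hj
  obtain ⟨u, hu, hxu, hfu⟩ := (hf.contDiffAt.of_le hjk).contDiffOn' le_rfl (by simp)
  obtain ⟨w, hw, hxw, hgw⟩ := (hg.contDiffAt.of_le hjk).contDiffOn' le_rfl (by simp)
  simp only [Set.insert_eq_of_mem (Set.mem_univ _), Set.univ_inter] at hfu hgw
  have hop : IsOpen (u ∩ w) := hu.inter hw
  have hx : x ∈ u ∩ w := ⟨hxu, hxw⟩
  have key := norm_iteratedFDerivWithin_mul_le (hfu.mono Set.inter_subset_left)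
    (hgw.mono Set.inter_subset_right) hop.uniqueDiffOn hx (n := j) le_rfl
  simp only [iteratedFDerivWithin_of_isOpen _ hop hx] at key
  refine key.trans ?_
  calc ∑ i ∈ Finset.range (j + 1), (j.choose i : ℝ) * ‖iteratedFDeriv ℝ i f x‖ *
        ‖iteratedFDeriv ℝ (j - i) g x‖
      ≤ ∑ i ∈ Finset.range (j + 1), (j.choose i : ℝ) * M * N := by
        refine Finset.sum_le_sum fun i hi => ?_
        have hij : i ≤ j := Nat.lt_succ_iff.mp (Finset.mem_range.mp hi)
        have := hf.nonneg
        gcongr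
        · exact hf.bound i (hij.trans hj)
        · exact hg.bound _ ((Nat.sub_le _ _).trans hj)
    _ = 2 ^ j * M * N := by
        rw [← Finset.sum_mul, ← Finset.sum_mul, ← Nat.cast_sum, Nat.sum_range_choose]
        push_cast; ring
    _ ≤ 2 ^ k * M * N := by
        have := hf.nonneg
        have := hg.nonneg
        gcongr
        norm_num

theorem fderiv_apply (hf : DerivBound (k + 1) M f x) (hv : ‖v‖ ≤ 1) :
    DerivBound k M (fun y => fderiv ℝ f y v) x := by
  have hd : ContDiffAt ℝ k (fderiv ℝ f) x :=
    hf.contDiffAt.fderiv_right (m := k) (by norm_cast)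
  refine ⟨hd.clm_apply contDiffAt_const, fun j hj => ?_⟩
  have hjk : (j : WithTop ℕ∞) ≤ k := by exact_mod_cast hj
  have := (ContinuousLinearMap.apply ℝ ℝ v).norm_iteratedFDeriv_comp_left (hd.of_le hjk)
    (n := j) le_rfl
  refine (this : ‖iteratedFDeriv ℝ j (fun y => fderiv ℝ f y v) x‖ ≤ _).trans ?_
  rw [norm_iteratedFDeriv_fderiv]
  have h1 : ‖ContinuousLinearMap.apply ℝ ℝ v‖ ≤ 1 :=
    ContinuousLinearMap.opNorm_le_bound _ zero_le_one fun L => by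
      simpa [mul_comm] using (L.le_opNorm v).trans (mul_le_of_le_one_right (norm_nonneg _) hv)
  calc _ ≤ 1 * M := mul_le_mul h1 (hf.bound _ (by omega)) (norm_nonneg _) zero_le_one
    _ = M := one_mul _

/-- The bound for the derivatives of `1 / f` when `|f| ≥ d`. -/
theorem inv {d : ℝ} (hd : 0 < d) (hf : DerivBound k M f x) (hfd : d ≤ |f x|) :
    DerivBound k (k.factorial * (k.factorial * (1 + d⁻¹) ^ (k + 1)) * (1 + M) ^ k)
      (fun y => (f y)⁻¹) x := by
  have hfx : f x ≠ 0 := abs_pos.mp (hd.trans_le hfd)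
  have hM := hf.nonneg
  have hdi : 0 < d⁻¹ := inv_pos.mpr hd
  refine ⟨hf.contDiffAt.inv hfx, fun j hj => ?_⟩
  have hjk : (j : WithTop ℕ∞) ≤ k := by exact_mod_cast hj
  obtain ⟨u, hu, hxu, hfu⟩ := (hf.contDiffAt.of_le hjk).contDiffOn' le_rfl (by simp)
  simp only [Set.insert_eq_of_mem (Set.mem_univ _), Set.univ_inter] at hfu
  have hop : IsOpen (u ∩ f ⁻¹' {0}ᶜ) := by
    exact hfu.continuousOn.isOpen_inter_preimage hu isOpen_compl_singleton
  have hx : x ∈ u ∩ f ⁻¹' {0}ᶜ := ⟨hxu, hfx⟩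
  have hop' : IsOpen ({0}ᶜ : Set ℝ) := isOpen_compl_singleton
  have key := norm_iteratedFDerivWithin_comp_le (n := j) (N := j) (g := fun y : ℝ => y⁻¹)
    (t := {0}ᶜ) (C := k.factorial * (1 + d⁻¹) ^ (k + 1)) (D := 1 + M)
    (fun y hy => (contDiffAt_inv ℝ hy).contDiffWithinAt)
    (hfu.mono Set.inter_subset_left) le_rfl hop'.uniqueDiffOn hop.uniqueDiffOn
    (fun y hy => hy.2) hx ?_ ?_
  · rw [iteratedFDerivWithin_of_isOpen _ hop hx] at key
    refine key.trans ?_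
    gcongr
    linarith
  · intro i hi
    rw [iteratedFDerivWithin_of_isOpen _ hop' hfx, norm_iteratedFDeriv_eq_norm_iteratedDeriv,
      iteratedDeriv_eq_iterate, show (fun y : ℝ => y⁻¹) = Inv.inv from rfl, iter_deriv_inv]
    rw [norm_mul, norm_mul, norm_pow, norm_neg, norm_one, one_pow, one_mul, norm_zpow,
      Real.norm_natCast, Real.norm_eq_abs, show (-1 - (i : ℤ)) = -((i + 1 : ℕ) : ℤ) by push_cast; ring,
      zpow_neg, zpow_natCast, ← inv_pow]
    have h1 : |f x|⁻¹ ≤ 1 + d⁻¹ := (inv_anti₀ hd hfd).trans (by linarith)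
    have h2 : (1 : ℝ) ≤ 1 + d⁻¹ := by linarith
    have h3 : i ≤ k := hi.trans hj
    calc (i.factorial : ℝ) * |f x|⁻¹ ^ (i + 1) ≤ k.factorial * (1 + d⁻¹) ^ (i + 1) := by gcongr
      _ ≤ k.factorial * (1 + d⁻¹) ^ (k + 1) := by gcongr
  · intro i hi hij
    rw [iteratedFDerivWithin_of_isOpen _ hop hx]
    calc _ ≤ M := hf.bound i (hij.trans hj)
      _ ≤ (1 + M) ^ 1 := by linarith
      _ ≤ (1 + M) ^ i := pow_le_pow_right₀ (by linarith) hi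

end DerivBound

end DerivBounds

section NonStationary

/-- The oscillating factor `e^{iθ}`. -/
def osc (θ : ℝ) : ℂ := Complex.exp (Complex.I * (θ : ℂ))

theorem norm_osc (θ : ℝ) : ‖osc θ‖ = 1 := by
  rw [osc, mul_comm, Complex.norm_exp_ofReal_mul_I]

theorem osc_add (a b : ℝ) : osc (a + b) = osc a * osc b := by
  simp [osc, mul_add, Complex.exp_add]

theorem continuous_osc : Continuous osc := by
  unfold osc; fun_prop

theorem continuous_osc_mul_of_tsupport {u b : E3 → ℝ}
    (h : ∀ x ∈ tsupport b, ContinuousAt u x ∧ ContinuousAt b x) :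
    Continuous fun x => osc (u x) * (b x : ℂ) := by
  refine continuous_of_tsupport fun x hx => ?_
  have hx' : x ∈ tsupport b := by
    refine closure_mono ?_ hx
    intro y hy
    simp only [Function.mem_support, ne_eq, mul_eq_zero, not_or, Complex.ofReal_eq_zero] at hy
    exact hy.2
  exact (continuous_osc.continuousAt.comp (h x hx').1).mul
    (Complex.continuous_ofReal.continuousAt.comp (h x hx').2)

theorem integrable_osc_mul_of_tsupport {u b : E3 → ℝ} (hb : HasCompactSupport b)
    (h : ∀ x ∈ tsupport b, ContinuousAt u x ∧ ContinuousAt b x) :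
    Integrable fun x => osc (u x) * (b x : ℂ) :=
  (continuous_osc_mul_of_tsupport h).integrable_of_hasCompactSupport
    ((hb.comp_left (g := fun y : ℝ => (y : ℂ)) (by simp)).mul_left)

theorem integral_osc_eq_of_ne_zero {u b : E3 → ℝ} {v : E3} {τ : ℝ}
    (hb : HasCompactSupport b)
    (h : ∀ x ∈ tsupport b, ContDiffAt ℝ 2 u x ∧ fderiv ℝ u x v ≠ 0 ∧ ContDiffAt ℝ 1 b x) :
    (τ : ℂ) * ∫ x, osc (τ * u x) * (b x : ℂ) =
      Complex.I * ∫ x, osc (τ * u x) *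
        (fderiv ℝ (fun y => b y * (fderiv ℝ u y v)⁻¹) x v : ℂ) := by
  set g : E3 → ℝ := fun y => b y * (fderiv ℝ u y v)⁻¹ with hg
  have hgt : tsupport g ⊆ tsupport b := by
    refine closure_mono fun y hy => ?_
    simp only [hg, Function.mem_support, ne_eq, mul_eq_zero, not_or] at hy ⊢
    exact hy.1
  have hg't : tsupport (fun x => fderiv ℝ g x v) ⊆ tsupport b :=
    (tsupport_fderiv_apply_subset ℝ v).trans hgt
  have hgd : ∀ x ∈ tsupport b, ContDiffAt ℝ 1 g x := by
    intro x hx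
    obtain ⟨h1, h2, h3⟩ := h x hx
    refine h3.mul (ContDiffAt.inv ?_ h2)
    exact (h1.fderiv_right (m := 1) (by norm_num)).clm_apply contDiffAt_const
  have hgc : HasCompactSupport g := hb.mono' (subset_tsupport g |>.trans hgt)
  have hg'c : HasCompactSupport (fun x => fderiv ℝ g x v) :=
    hb.mono' ((subset_tsupport _).trans hg't)
  have hcu : ∀ x ∈ tsupport b, ContinuousAt (fun y => τ * u y) x := fun x hx =>
    continuousAt_const.mul (h x hx).1.continuousAt
  have hcg' : ∀ x ∈ tsupport b, ContinuousAt (fun y => fderiv ℝ g y v) x := fun x hx =>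
    (((hgd x hx).fderiv_right (m := 0) (by norm_num)).clm_apply contDiffAt_const).continuousAt
  set f' : E3 → ℂ := fun x => osc (τ * u x) * (Complex.I * (τ * fderiv ℝ u x v : ℝ)) with hf'
  have hfder : ∀ x ∈ tsupport b,
      HasLineDerivAt ℝ (fun y => osc (τ * u y)) (f' x) x v := by
    intro x hx
    have h1 : HasLineDerivAt ℝ u (fderiv ℝ u x v) x v :=
      (((h x hx).1.differentiableAt (by norm_num)).hasFDerivAt).hasLineDerivAt v
    unfold HasLineDerivAt at h1 ⊢
    have h2 := (((h1.const_mul τ).ofReal_comp).const_mul Complex.I).cexp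
    simpa [hf', osc] using h2
  have key := integral_bilinear_hasLineDerivAt_right_eq_neg_left_of_integrable
    (μ := (volume : Measure E3)) (B := ContinuousLinearMap.mul ℝ ℂ)
    (f := fun y => osc (τ * u y)) (f' := f') (g := fun x => (g x : ℂ))
    (g' := fun x => (fderiv ℝ g x v : ℂ)) (v := v) ?_ ?_ ?_ ?_ ?_
  · simp only [ContinuousLinearMap.mul_apply'] at key
    rw [key]
    rw [mul_neg, ← integral_const_mul, ← integral_const_mul, ← integral_neg]
    refine integral_congr_ae (Filter.Eventually.of_forall fun x => ?_)
    simp only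
    by_cases hbx : b x = 0
    · simp [hg, hbx]
    · have hx : x ∈ tsupport b := subset_tsupport _ hbx
      have h2 : (fderiv ℝ u x v : ℂ) ≠ 0 := by exact_mod_cast (h x hx).2.1
      simp only [hf', hg]
      push_cast
      field_simp
      rw [Complex.I_sq]
      ring
  · have : (fun x => (ContinuousLinearMap.mul ℝ ℂ (f' x)) (g x : ℂ)) =
        fun x => Complex.I * τ * (osc (τ * u x) * (b x : ℂ)) := by
      funext x
      simp only [ContinuousLinearMap.mul_apply']
      by_cases hbx : b x = 0
      · simp [hg, hbx]
      · have hx : x ∈ tsupport b := subset_tsupport _ hbx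
        have h2 : (fderiv ℝ u x v : ℂ) ≠ 0 := by exact_mod_cast (h x hx).2.1
        simp only [hf', hg]
        push_cast
        field_simp
    rw [this]
    exact (integrable_osc_mul_of_tsupport hb fun x hx =>
      ⟨hcu x hx, (h x hx).2.2.continuousAt⟩).const_mul _
  · exact integrable_osc_mul_of_tsupport hg'c fun x hx => ⟨hcu x (hg't hx), hcg' x (hg't hx)⟩
  · exact integrable_osc_mul_of_tsupport hgc fun x hx =>
      ⟨hcu x (hgt hx), (hgd x (hgt hx)).continuousAt⟩
  · intro x hx
    refine hfder x (hgt ?_)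
    refine closure_mono (fun y hy => ?_) hx
    simpa using hy
  · intro x _
    by_cases hx : x ∈ tsupport b
    · have h1 : HasLineDerivAt ℝ g (fderiv ℝ g x v) x v :=
        (((hgd x hx).differentiableAt (by norm_num)).hasFDerivAt).hasLineDerivAt v
      unfold HasLineDerivAt at h1 ⊢
      exact h1.ofReal_comp
    · have h0 : g =ᶠ[nhds x] 0 := notMem_tsupport_iff_eventuallyEq.mp fun hx' => hx (hgt hx')
      have h1 : HasFDerivAt g (0 : E3 →L[ℝ] ℝ) x :=
        (hasFDerivAt_const (0 : ℝ) x).congr_of_eventuallyEq h0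
      have h2 := h1.hasLineDerivAt v
      rw [h1.fderiv]
      unfold HasLineDerivAt at h2 ⊢
      exact h2.ofReal_comp

theorem exists_bound_integral_osc (k : ℕ) (M : ℝ) {d : ℝ} (hd : 0 < d) :
    ∃ C : ℝ, 0 ≤ C ∧ ∀ (u b : E3 → ℝ) (v : E3) (S : Set E3), ‖v‖ ≤ 1 → IsCompact S →
      tsupport b ⊆ S →
      (∀ x ∈ tsupport b, DerivBound (k + 1) M u x ∧ d ≤ |fderiv ℝ u x v| ∧ DerivBound k M b x) →
      ∀ τ : ℝ, 0 < τ →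
        τ ^ k * ‖∫ x, osc (τ * u x) * (b x : ℂ)‖ ≤ C * volume.real S := by
  induction k generalizing M with
  | zero =>
    refine ⟨|M|, abs_nonneg _, fun u b v S _ hS hbS h τ _ => ?_⟩
    rw [pow_zero, one_mul]
    have h0 : ∀ x, x ∉ S → osc (τ * u x) * (b x : ℂ) = 0 := fun x hx => by
      rw [image_eq_zero_of_notMem_tsupport fun hx' => hx (hbS hx')]
      simp
    rw [← setIntegral_eq_integral_of_forall_compl_eq_zero h0]
    refine norm_setIntegral_le_of_norm_le_const hS.measure_lt_top fun x _ => ?_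
    rw [norm_mul, norm_osc, one_mul, Complex.norm_real, Real.norm_eq_abs]
    by_cases hx : x ∈ tsupport b
    · exact (h x hx).2.2.abs_le.trans (le_abs_self _)
    · rw [image_eq_zero_of_notMem_tsupport hx]; simp
  | succ k ih =>
    set M1 : ℝ := (k + 1).factorial * ((k + 1).factorial * (1 + d⁻¹) ^ (k + 1 + 1)) *
      (1 + M) ^ (k + 1) with hM1
    set M2 : ℝ := max M (2 ^ (k + 1) * M * M1)
    obtain ⟨C, hC0, hC⟩ := ih M2
    refine ⟨C, hC0, fun u b v S hv hS hbS h τ hτ => ?_⟩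
    have hbc : HasCompactSupport b := hS.of_isClosed_subset (isClosed_tsupport b) hbS
    have hsub : tsupport (fun x => fderiv ℝ (fun y => b y * (fderiv ℝ u y v)⁻¹) x v) ⊆
        tsupport b := by
      refine (tsupport_fderiv_apply_subset ℝ v).trans (closure_mono fun y hy => ?_)
      simp only [Function.mem_support, ne_eq, mul_eq_zero, not_or] at hy ⊢
      exact hy.1
    have hstep := integral_osc_eq_of_ne_zero (u := u) (v := v) (τ := τ) hbc fun x hx => by
      obtain ⟨h1, h2, h3⟩ := h x hx
      exact ⟨h1.contDiffAt.of_le (by norm_cast; omega), abs_pos.mp (hd.trans_le h2),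
        h3.contDiffAt.of_le (by norm_cast; omega)⟩
    have hnorm := congrArg norm hstep
    rw [norm_mul, norm_mul, Complex.norm_I, one_mul, Complex.norm_real, Real.norm_of_nonneg hτ.le]
      at hnorm
    rw [pow_succ, mul_assoc, hnorm]
    refine hC u _ v S hv hS (hsub.trans hbS) (fun x hx => ?_) τ hτ
    obtain ⟨h1, h2, h3⟩ := h x (hsub hx)
    refine ⟨h1.mono (by omega) (le_max_left _ _), h2, ?_⟩
    have h4 := (h1.fderiv_apply hv).inv hd h2
    exact ((h3.mul h4).fderiv_apply hv).mono le_rfl (le_max_right _ _)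

end NonStationary

section Differences

variable {V : Type*} [NormedAddCommGroup V] [NormedSpace ℝ V] {k : ℕ} {M : ℝ} {F : V → ℝ}

theorem DerivBound.comp_sub {x : V} (h : V) (hF : DerivBound k M F (x - h)) :
    DerivBound k M (fun y => F (y - h)) x := by
  refine ⟨ContDiffAt.comp x hF.contDiffAt (contDiffAt_id.sub contDiffAt_const), fun j hj => ?_⟩
  rw [iteratedFDeriv_comp_sub]
  exact hF.bound j hj

theorem DerivBound.difference_quotient {s : Set V} (hs : Convex ℝ s)
    (hF : ∀ x ∈ s, DerivBound (k + 1) M F x) {x h : V} (hh : h ≠ 0) (hx : x ∈ s)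
    (hxh : x - h ∈ s) : DerivBound k M (fun y => ‖h‖⁻¹ • (F y - F (y - h))) x := by
  have hc1 := (hF x hx).contDiffAt
  have hc2 := ((hF _ hxh).comp_sub h).contDiffAt
  refine ⟨(((hc1.sub hc2).const_smul (‖h‖⁻¹)).of_le (by norm_cast; omega)), fun j hj => ?_⟩
  have hj1 : (j : WithTop ℕ∞) ≤ (k + 1 : ℕ) := by norm_cast; omega
  have e : (fun y => ‖h‖⁻¹ • (F y - F (y - h))) = ‖h‖⁻¹ • (fun y => F y - F (y - h)) := rfl
  have hdiff : iteratedFDeriv ℝ j (fun y => F y - F (y - h)) x =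
      iteratedFDeriv ℝ j F x - iteratedFDeriv ℝ j (fun y => F (y - h)) x :=
    iteratedFDeriv_sub_apply (hc1.of_le hj1) (hc2.of_le hj1)
  rw [e, iteratedFDeriv_const_smul_apply ((hc1.sub hc2).of_le hj1), norm_smul, norm_inv, norm_norm,
    hdiff, iteratedFDeriv_comp_sub]
  have := hs.norm_image_sub_le_of_norm_fderiv_le (𝕜 := ℝ) (f := iteratedFDeriv ℝ j F) (C := M)
    (fun y hy => (hF y hy).contDiffAt.differentiableAt_iteratedFDeriv
      (by norm_cast; omega))
    (fun y hy => by
      rw [norm_fderiv_iteratedFDeriv]; exact (hF y hy).bound _ (by omega)) hxh hx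
  rw [sub_sub_cancel] at this
  have hpos : 0 < ‖h‖ := norm_pos_iff.mpr hh
  rw [inv_mul_le_iff₀ hpos]
  linarith

theorem norm_fderiv_fderiv_apply_sub_le {s : Set V} (hs : Convex ℝ s)
    (hF : ∀ x ∈ s, DerivBound 3 M F x) {v x y : V} (hv : ‖v‖ ≤ 1) (hx : x ∈ s) (hy : y ∈ s) :
    ‖fderiv ℝ (fun y => fderiv ℝ F y v) y - fderiv ℝ (fun y => fderiv ℝ F y v) x‖ ≤
      M * ‖y - x‖ := by
  have hF' : ∀ x ∈ s, DerivBound 2 M (fun y => fderiv ℝ F y v) x :=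
    fun x hx => (hF x hx).fderiv_apply hv
  refine hs.norm_image_sub_le_of_norm_fderiv_le (𝕜 := ℝ) (fun z hz => ?_) (fun z hz => ?_) hx hy
  · exact ((hF' z hz).contDiffAt.fderiv_right (m := 1) (by norm_num)).differentiableAt
      (by norm_num)
  · have := (hF' z hz).bound 2 le_rfl
    rwa [← norm_iteratedFDeriv_fderiv, ← norm_iteratedFDeriv_fderiv, norm_iteratedFDeriv_zero]
      at this

theorem le_abs_fderiv_difference_quotient {s : Set V} (hs : Convex ℝ s)
    (hF : ∀ x ∈ s, DerivBound 3 M F x) {d r : ℝ} {v x h ξ : V} (hv : ‖v‖ ≤ 1) (hξ : ξ ∈ s)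
    (hsr : ∀ y ∈ s, ‖y - ξ‖ ≤ r) (hr : M * r ≤ d / 2) (hh : h ≠ 0)
    (hx : x ∈ s) (hxh : x - h ∈ s)
    (hd : d * ‖h‖ ≤ |fderiv ℝ (fun y => fderiv ℝ F y v) ξ h|) :
    d / 2 ≤ |fderiv ℝ (fun y => ‖h‖⁻¹ • (F y - F (y - h))) x v| := by
  have hpos : 0 < ‖h‖ := norm_pos_iff.mpr hh
  have hM := (hF x hx).nonneg
  have key := hs.norm_image_sub_le_of_norm_fderiv_le' (𝕜 := ℝ)
    (f := fun y => fderiv ℝ F y v) (φ := fderiv ℝ (fun y => fderiv ℝ F y v) ξ) (C := d / 2)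
    (fun z hz => (((hF z hz).contDiffAt.fderiv_right (m := 1) (by norm_num)).clm_apply
      contDiffAt_const).differentiableAt (by norm_num))
    (fun z hz => (norm_fderiv_fderiv_apply_sub_le hs hF hv hξ hz).trans
      ((mul_le_mul_of_nonneg_left (hsr z hz) hM).trans hr)) hxh hx
  rw [sub_sub_cancel, Real.norm_eq_abs] at key
  have hdx : DifferentiableAt ℝ F x := (hF x hx).contDiffAt.differentiableAt (by norm_num)
  have hdxh : HasFDerivAt (fun y => F (y - h)) (fderiv ℝ F (x - h)) x := by
    have h1 := ((hF _ hxh).contDiffAt.differentiableAt (by norm_num)).hasFDerivAt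
    exact h1.comp x ((hasFDerivAt_id x).sub_const h)
  have e : HasFDerivAt (fun y => ‖h‖⁻¹ • (F y - F (y - h)))
      (‖h‖⁻¹ • (fderiv ℝ F x - fderiv ℝ F (x - h))) x :=
    (hdx.hasFDerivAt.fun_sub hdxh).const_smul (‖h‖⁻¹)
  rw [e.fderiv]
  simp only [smul_apply, sub_apply, smul_eq_mul, abs_mul,
    abs_inv, abs_norm]
  rw [le_inv_mul_iff₀ hpos]
  have := abs_sub_abs_le_abs_sub (fderiv ℝ (fun y => fderiv ℝ F y v) ξ h)
    (fderiv ℝ F x v - fderiv ℝ F (x - h) v)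
  rw [abs_sub_comm (fderiv ℝ (fun y => fderiv ℝ F y v) ξ h)] at this
  linarith

end Differences

section LocalDecay

theorem conj_osc (θ : ℝ) : (starRingEnd ℂ) (osc θ) = osc (-θ) := by
  simp [osc, ← Complex.exp_conj]

theorem norm_integral_sq_le {G : E3 → ℂ} (hG : Integrable G) {B : E3 → ℝ} (hB : Integrable B)
    (h : ∀ y, ‖∫ x, G x * (starRingEnd ℂ) (G (x - y))‖ ≤ B y) :
    ‖∫ x, G x‖ ^ 2 ≤ ∫ y, B y := by
  set G' : E3 → ℂ := fun y => (starRingEnd ℂ) (G (-y)) with hG'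
  have hG'i : Integrable G' := by
    have h1 : Integrable fun y => G (-y) := hG.comp_neg
    exact (Complex.conjLIE.toContinuousLinearEquiv.toContinuousLinearMap).integrable_comp h1
  have h1 := integral_convolution (ContinuousLinearMap.mul ℝ ℂ) hG hG'i
  have h2 : ∫ y, G' y = (starRingEnd ℂ) (∫ x, G x) := by
    rw [← integral_conj, ← integral_neg_eq_self (fun x => (starRingEnd ℂ) (G x))]
  rw [h2] at h1
  have h3 := congrArg norm h1
  rw [ContinuousLinearMap.mul_apply', norm_mul, Complex.norm_conj, ← sq] at h3
  rw [← h3]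
  refine norm_integral_le_of_norm_le hB (Filter.Eventually.of_forall fun y => ?_)
  have : convolution G G' (ContinuousLinearMap.mul ℝ ℂ) volume y =
      ∫ x, G x * (starRingEnd ℂ) (G (x - y)) := by
    simp [convolution, hG']
  rw [this]
  exact h y

theorem integral_one_add_mul_norm {T : ℝ} (hT : 0 < T) :
    Integrable (fun h : E3 => (1 + T * ‖h‖) ^ (-4 : ℝ)) ∧
      ∫ h : E3, (1 + T * ‖h‖) ^ (-4 : ℝ) = (T ^ 3)⁻¹ * ∫ h : E3, (1 + ‖h‖) ^ (-4 : ℝ) := by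
  have h1 : Integrable fun h : E3 => (1 + ‖h‖) ^ (-4 : ℝ) :=
    integrable_one_add_norm (by simp; norm_num)
  have e : (fun h : E3 => (1 + T * ‖h‖) ^ (-4 : ℝ)) =
      fun h => (fun h : E3 => (1 + ‖h‖) ^ (-4 : ℝ)) (T • h) := by
    funext h
    simp [norm_smul, abs_of_pos hT]
  rw [e]
  refine ⟨h1.comp_smul hT.ne', ?_⟩
  rw [Measure.integral_comp_smul volume (fun h : E3 => (1 + ‖h‖) ^ (-4 : ℝ)) T]
  simp [abs_of_pos hT]

theorem exists_local_decay (M N : ℝ) {d : ℝ} (hd : 0 < d) :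
    ∃ C : ℝ, 0 ≤ C ∧ ∀ (F a : E3 → ℝ) (ξ : E3) (r : ℝ), 0 < r → r ≤ 1 → M * r ≤ d / 2 →
      (∀ x ∈ Metric.ball ξ r, DerivBound 6 M F x) → (∀ x, DerivBound 4 N a x) →
      tsupport a ⊆ Metric.ball ξ r →
      (∀ h : E3, ∃ v : E3, ‖v‖ ≤ 1 ∧ d * ‖h‖ ≤ |fderiv ℝ (fun y => fderiv ℝ F y v) ξ h|) →
      ∀ (T : ℝ) (ℓ : E3 →L[ℝ] ℝ), 0 < T →
        T ^ 3 * ‖∫ x, osc (T * F x + ℓ x) * (a x : ℂ)‖ ^ 2 ≤ C := by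
  obtain ⟨C0, hC0, h0⟩ := exists_bound_integral_osc 0 (max M (2 ^ 4 * N * N)) (half_pos hd)
  obtain ⟨C4, hC4, h4⟩ := exists_bound_integral_osc 4 (max M (2 ^ 4 * N * N)) (half_pos hd)
  set V : ℝ := volume.real (Metric.closedBall (0 : E3) 1)
  set I4 : ℝ := ∫ h : E3, (1 + ‖h‖) ^ (-4 : ℝ)
  set C : ℝ := 8 * ((C0 + N * N) * V + C4 * V) with hCdef
  have hI4 : 0 ≤ I4 := integral_nonneg fun h => by positivity
  have hNN : 0 ≤ N * N := mul_self_nonneg N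
  have hC : 0 ≤ C := by positivity
  refine ⟨C * I4, by positivity, fun F a ξ r hr hr1 hMr hF ha hsupp hnd T ℓ hT => ?_⟩
  have hac : HasCompactSupport a :=
    HasCompactSupport.of_support_subset_isCompact (isCompact_closedBall ξ r)
      (((subset_tsupport a).trans hsupp).trans Metric.ball_subset_closedBall)
  set G : E3 → ℂ := fun x => osc (T * F x + ℓ x) * (a x : ℂ) with hG
  have hGi : Integrable G := integrable_osc_mul_of_tsupport hac fun x hx =>
    ⟨(continuousAt_const.mul (hF x (hsupp hx)).contDiffAt.continuousAt).add
      ℓ.continuous.continuousAt, (ha x).contDiffAt.continuousAt⟩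
  obtain ⟨hi, hie⟩ := integral_one_add_mul_norm hT
  have hV : volume.real (Metric.closedBall ξ r) ≤ V := by
    calc volume.real (Metric.closedBall ξ r) ≤ volume.real (Metric.closedBall ξ 1) :=
          measureReal_mono (Metric.closedBall_subset_closedBall hr1)
            (isCompact_closedBall ξ 1).measure_lt_top.ne
      _ = V := by
          simp only [V, measureReal_def, Measure.addHaar_closedBall_center]
  have hmain : ∀ h, ‖∫ x, G x * (starRingEnd ℂ) (G (x - h))‖ ≤
      C * (1 + T * ‖h‖) ^ (-4 : ℝ) := by
    intro h
    set b : E3 → ℝ := fun x => a x * a (x - h) with hb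
    have hbS1 : tsupport b ⊆ tsupport a := by
      refine closure_mono fun y hy => ?_
      simp only [hb, Function.mem_support, ne_eq, mul_eq_zero, not_or] at hy ⊢
      exact hy.1
    have hbS2 : ∀ x ∈ tsupport b, x - h ∈ tsupport a := by
      have hcl : IsClosed {x : E3 | x - h ∈ tsupport a} :=
        (isClosed_tsupport a).preimage (continuous_id.sub continuous_const)
      refine closure_minimal (fun y hy => subset_tsupport _ ?_) hcl
      simp only [hb, Function.mem_support, ne_eq, mul_eq_zero, not_or] at hy ⊢
      exact hy.2
    have hbS : tsupport b ⊆ Metric.closedBall ξ r :=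
      (hbS1.trans hsupp).trans Metric.ball_subset_closedBall
    have hbD : ∀ x, DerivBound 4 (2 ^ 4 * N * N) b x := fun x =>
      (ha x).mul ((ha (x - h)).comp_sub h)
    have hT' : 0 ≤ T * ‖h‖ := by positivity
    -- the trivial bound
    have htriv : ‖∫ x, G x * (starRingEnd ℂ) (G (x - h))‖ ≤ (C0 + N * N) * V := by
      have hz : ∀ x, x ∉ Metric.closedBall ξ r → G x * (starRingEnd ℂ) (G (x - h)) = 0 := by
        intro x hx
        have : a x = 0 := image_eq_zero_of_notMem_tsupport fun hx' =>
          hx (Metric.ball_subset_closedBall (hsupp hx'))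
        simp [hG, this]
      rw [← setIntegral_eq_integral_of_forall_compl_eq_zero hz]
      refine (norm_setIntegral_le_of_norm_le_const (C := N * N)
        (isCompact_closedBall ξ r).measure_lt_top fun x _ => ?_).trans ?_
      · simp only [hG, norm_mul, Complex.norm_conj, norm_osc, one_mul, Complex.norm_real,
          Real.norm_eq_abs]
        exact mul_le_mul (ha x).abs_le (ha _).abs_le (abs_nonneg _) (ha x).nonneg
      · calc N * N * volume.real (Metric.closedBall ξ r) ≤ N * N * V := by gcongr
          _ ≤ _ := by gcongr; linarith
    have hosc : (T * ‖h‖) ^ 4 * ‖∫ x, G x * (starRingEnd ℂ) (G (x - h))‖ ≤ C4 * V := by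
      rcases eq_or_ne h 0 with rfl | hh
      · simp only [norm_zero, mul_zero]
        rw [zero_pow (by norm_num), zero_mul]
        positivity
      have hpos : 0 < ‖h‖ := norm_pos_iff.mpr hh
      set u : E3 → ℝ := fun y => ‖h‖⁻¹ • (F y - F (y - h)) with hu
      have he : ∀ x, G x * (starRingEnd ℂ) (G (x - h)) =
          osc (ℓ h) * (osc (T * ‖h‖ * u x) * (b x : ℂ)) := by
        intro x
        simp only [hG, map_mul, conj_osc, Complex.conj_ofReal, hb]
        have h1 : osc (T * F x + ℓ x) * osc (-(T * F (x - h) + ℓ (x - h))) =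
            osc (ℓ h) * osc (T * ‖h‖ * u x) := by
          rw [← osc_add, ← osc_add]
          congr 1
          simp only [hu, map_sub, smul_eq_mul]
          field_simp
          ring
        push_cast
        linear_combination (a x : ℂ) * (a (x - h) : ℂ) * h1
      simp_rw [he]
      rw [integral_const_mul, norm_mul, norm_osc, one_mul]
      obtain ⟨v, hv, hvd⟩ := hnd h
      have hconv := convex_ball ξ r
      refine (h4 u b v (Metric.closedBall ξ r) hv (isCompact_closedBall ξ r) hbS
        (fun x hx => ?_) (T * ‖h‖) (by positivity)).trans (by gcongr)
      have hx1 := hsupp (hbS1 hx)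
      have hx2 := hsupp (hbS2 x hx)
      refine ⟨?_, ?_, (hbD x).mono le_rfl (le_max_right _ _)⟩
      · exact (DerivBound.difference_quotient hconv hF hh hx1 hx2).mono le_rfl (le_max_left _ _)
      · exact le_abs_fderiv_difference_quotient hconv
          (fun x hx => (hF x hx).mono (by norm_num) le_rfl) hv (Metric.mem_ball_self hr)
          (fun y hy => (mem_ball_iff_norm.mp hy).le) hMr hh hx1 hx2 hvd
    rw [Real.rpow_neg (by positivity), ← div_eq_mul_inv, le_div_iff₀ (by positivity)]
    have hpow : (1 + T * ‖h‖) ^ (4 : ℝ) ≤ 8 * (1 + (T * ‖h‖) ^ 4) := by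
      rw [show (4 : ℝ) = ((4 : ℕ) : ℝ) by norm_num, Real.rpow_natCast]
      nlinarith [sq_nonneg (T * ‖h‖ - 1), sq_nonneg ((T * ‖h‖) ^ 2 - 1),
        sq_nonneg ((T * ‖h‖) ^ 2 - T * ‖h‖)]
    calc _ ≤ ‖∫ x, G x * (starRingEnd ℂ) (G (x - h))‖ * (8 * (1 + (T * ‖h‖) ^ 4)) := by gcongr
      _ = 8 * (‖∫ x, G x * (starRingEnd ℂ) (G (x - h))‖ +
          (T * ‖h‖) ^ 4 * ‖∫ x, G x * (starRingEnd ℂ) (G (x - h))‖) := by ring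
      _ ≤ C := by rw [hCdef]; gcongr
  have hfin := norm_integral_sq_le hGi (hi.const_mul C) hmain
  rw [integral_const_mul, hie] at hfin
  calc T ^ 3 * ‖∫ x, G x‖ ^ 2 ≤ T ^ 3 * (C * ((T ^ 3)⁻¹ * I4)) := by gcongr
    _ = C * I4 := by field_simp

end LocalDecay

section HessianMatrix

/-- The matrix of second derivatives of `f` at `x`. -/
def hessMat (f : E3 → ℝ) (x : E3) : Matrix (Fin 3) (Fin 3) ℝ :=
  Matrix.of fun i j => fderiv ℝ (fun y => fderiv ℝ f y (EuclideanSpace.single i 1)) x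
    (EuclideanSpace.single j 1)

theorem sum_single_eq (h : E3) : ∑ j, h j • (EuclideanSpace.single j 1 : E3) = h := by
  ext i
  fin_cases i <;> simp [Fin.sum_univ_three]

theorem hessMat_mulVec (f : E3 → ℝ) (x h : E3) (i : Fin 3) :
    (hessMat f x).mulVec h i =
      fderiv ℝ (fun y => fderiv ℝ f y (EuclideanSpace.single i 1)) x h := by
  conv_rhs => rw [← sum_single_eq h]
  simp [hessMat, Matrix.mulVec, dotProduct, mul_comm]

theorem norm_le_three_mul_abs (h : E3) : ∃ k, ‖h‖ ≤ 3 * |h k| := by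
  obtain ⟨k, -, hk⟩ := Finset.exists_max_image (Finset.univ : Finset (Fin 3)) (fun k => |h k|)
    ⟨0, Finset.mem_univ _⟩
  refine ⟨k, ?_⟩
  refine abs_le_of_sq_le_sq' ?_ (by positivity) |>.2
  rw [EuclideanSpace.norm_sq_eq, Fin.sum_univ_three]
  have h0 := sq_le_sq' (by linarith [abs_nonneg (h 0), abs_nonneg (h k)]) (hk 0 (Finset.mem_univ _))
  have h1 := sq_le_sq' (by linarith [abs_nonneg (h 1), abs_nonneg (h k)]) (hk 1 (Finset.mem_univ _))
  have h2 := sq_le_sq' (by linarith [abs_nonneg (h 2), abs_nonneg (h k)]) (hk 2 (Finset.mem_univ _))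
  simp only [Real.norm_eq_abs]
  nlinarith [sq_nonneg (|h k|)]

theorem abs_adjugate_le {G : Matrix (Fin 3) (Fin 3) ℝ} {M : ℝ} (hG : ∀ i j, |G i j| ≤ M)
    (i j : Fin 3) : |G.adjugate i j| ≤ 2 * M ^ 2 := by
  have hM : 0 ≤ M := (abs_nonneg _).trans (hG 0 0)
  have key : ∀ a b c d a' b' c' d', |G a b * G c d - G a' b' * G c' d'| ≤ 2 * M ^ 2 := by
    intro a b c d a' b' c' d'
    refine (abs_sub _ _).trans ?_
    rw [abs_mul, abs_mul]
    have h1 := mul_le_mul (hG a b) (hG c d) (abs_nonneg _) hM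
    have h2 := mul_le_mul (hG a' b') (hG c' d') (abs_nonneg _) hM
    linarith
  have key' : ∀ a b c d a' b' c' d', |-(G a b * G c d) + G a' b' * G c' d'| ≤ 2 * M ^ 2 := by
    intro a b c d a' b' c' d'
    rw [neg_add_eq_sub]
    exact key _ _ _ _ _ _ _ _
  rw [Matrix.adjugate_fin_three]
  fin_cases i <;> fin_cases j <;> simp [-neg_add_rev, key, key']

theorem exists_le_abs_mulVec {G : Matrix (Fin 3) (Fin 3) ℝ} {M d : ℝ}
    (hG : ∀ i j, |G i j| ≤ M) (hd : d ≤ |G.det|) (h : Fin 3 → ℝ) (k : Fin 3) :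
    ∃ i, d * |h k| ≤ 6 * M ^ 2 * |G.mulVec h i| := by
  obtain ⟨i, -, hi⟩ := Finset.exists_max_image (Finset.univ : Finset (Fin 3))
    (fun i => |G.mulVec h i|) ⟨0, Finset.mem_univ _⟩
  refine ⟨i, ?_⟩
  have h1 : G.adjugate.mulVec (G.mulVec h) = G.det • h := by
    rw [Matrix.mulVec_mulVec, Matrix.adjugate_mul, Matrix.smul_mulVec, Matrix.one_mulVec]
  have h2 := congrFun h1 k
  calc d * |h k| ≤ |G.det| * |h k| := by gcongr
    _ = |G.adjugate.mulVec (G.mulVec h) k| := by rw [h2]; simp [abs_mul]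
    _ ≤ ∑ j, |G.adjugate k j * G.mulVec h j| := by
        rw [Matrix.mulVec, dotProduct]; exact Finset.abs_sum_le_sum_abs _ _
    _ ≤ ∑ _j : Fin 3, 2 * M ^ 2 * |G.mulVec h i| := by
        refine Finset.sum_le_sum fun j hj => ?_
        rw [abs_mul]
        exact mul_le_mul (abs_adjugate_le hG k j) (hi j hj) (abs_nonneg _) (by positivity)
    _ = 6 * M ^ 2 * |G.mulVec h i| := by simp; ring

theorem nondegenerate_of_det {F : E3 → ℝ} {x : E3} {M d : ℝ} (hd : 0 < d)
    (hF : DerivBound 2 M F x) (hdet : d ≤ |(hessMat F x).det|) (h : E3) :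
    ∃ v : E3, ‖v‖ ≤ 1 ∧
      d / (18 * M ^ 2 + 1) * ‖h‖ ≤ |fderiv ℝ (fun y => fderiv ℝ F y v) x h| := by
  have hG : ∀ i j, |hessMat F x i j| ≤ M := by
    intro i j
    have h1 := (hF.fderiv_apply (v := EuclideanSpace.single i 1) (by simp)).fderiv_apply
      (v := EuclideanSpace.single j 1) (by simp)
    simpa [hessMat] using h1.abs_le
  obtain ⟨k, hk⟩ := norm_le_three_mul_abs h
  obtain ⟨i, hi⟩ := exists_le_abs_mulVec hG hdet h k
  refine ⟨EuclideanSpace.single i 1, by simp, ?_⟩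
  rw [← hessMat_mulVec, div_mul_eq_mul_div, div_le_iff₀ (by positivity)]
  nlinarith [abs_nonneg ((hessMat F x).mulVec h i), mul_le_mul_of_nonneg_left hk hd.le]

end HessianMatrix

section Slices

variable {V W : Type*} [NormedAddCommGroup V] [NormedSpace ℝ V]
  [NormedAddCommGroup W] [NormedSpace ℝ W]

theorem DerivBound.comp_clm {k : ℕ} {M : ℝ} {F : W → ℝ} {x : V} (L : V →L[ℝ] W) (hL : ‖L‖ ≤ 1)
    (hF : DerivBound k M F (L x)) : DerivBound k M (fun y => F (L y)) x := by
  refine ⟨hF.contDiffAt.comp x L.contDiff.contDiffAt, fun j hj => ?_⟩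
  obtain ⟨u, hu, hxu, hfu⟩ := hF.contDiffAt.contDiffOn' le_rfl (by simp)
  simp only [Set.insert_eq_of_mem (Set.mem_univ _), Set.univ_inter] at hfu
  have hop : IsOpen (L ⁻¹' u) := hu.preimage L.continuous
  have key := L.iteratedFDerivWithin_comp_right hfu hu.uniqueDiffOn hop.uniqueDiffOn hxu
    (i := j) (by exact_mod_cast hj)
  rw [iteratedFDerivWithin_of_isOpen _ hop hxu, iteratedFDerivWithin_of_isOpen _ hu hxu] at key
  change ‖iteratedFDeriv ℝ j (F ∘ L) x‖ ≤ M
  rw [key]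
  refine (ContinuousMultilinearMap.norm_compContinuousLinearMap_le _ _).trans ?_
  have h1 := hF.bound j hj
  calc _ ≤ M * 1 := by
        refine mul_le_mul h1 ?_ (Finset.prod_nonneg fun _ _ => norm_nonneg _) hF.nonneg
        exact Finset.prod_le_one (fun _ _ => norm_nonneg _) fun _ _ => hL
    _ = M := mul_one _

theorem DerivBound.slice {k : ℕ} {M : ℝ} {F : W × V → ℝ} {μ : W} {x : V}
    (hF : DerivBound k M F (μ, x)) : DerivBound k M (fun y => F (μ, y)) x := by
  have h1 : DerivBound k M (fun z => F (z - (-μ, 0))) (0, x) :=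
    DerivBound.comp_sub _ (by simpa using hF)
  have h2 := DerivBound.comp_clm (x := x) (ContinuousLinearMap.inr ℝ W V)
    (ContinuousLinearMap.norm_inr_le_one _ _ _) (by simpa using h1)
  simpa using h2

theorem isOpen_setOf_contDiffAt {k : ℕ} {F : W → ℝ} : IsOpen {z | ContDiffAt ℝ k F z} :=
  isOpen_iff_mem_nhds.mpr fun z (hz : ContDiffAt ℝ k F z) => hz.eventually (by simp)

theorem exists_derivBound_of_isCompact {k : ℕ} {F : W → ℝ} {K : Set W} (hK : IsCompact K)
    (hF : ∀ z ∈ K, ContDiffAt ℝ k F z) : ∃ M, ∀ z ∈ K, DerivBound k M F z := by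
  have h1 : ∀ j ∈ Finset.range (k + 1), ∃ M : ℝ, ∀ z ∈ K, ‖iteratedFDeriv ℝ j F z‖ ≤ M := by
    intro j hj
    have hj' : j ≤ k := Nat.lt_succ_iff.mp (Finset.mem_range.mp hj)
    refine hK.exists_bound_of_continuousOn fun z hz => ?_
    exact ((hF z hz).iteratedFDeriv_right (m := 0) (i := j)
      (by rw [zero_add]; exact_mod_cast hj')).continuousAt.continuousWithinAt
  choose! M hM using h1
  refine ⟨∑ j ∈ Finset.range (k + 1), |M j|, fun z hz => ⟨hF z hz, fun j hj => ?_⟩⟩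
  have hj' : j ∈ Finset.range (k + 1) := Finset.mem_range.mpr (by omega)
  exact ((hM j hj' z hz).trans (le_abs_self _)).trans
    (Finset.single_le_sum (f := fun j => |M j|) (fun _ _ => abs_nonneg _) hj')

end Slices

section Family

theorem exists_derivBound_of_contDiff_of_hasCompactSupport (k : ℕ) {ϑ : E3 → ℝ}
    (h : ContDiff ℝ k ϑ) (hc : HasCompactSupport ϑ) : ∃ M, ∀ z, DerivBound k M ϑ z := by
  obtain ⟨M, hM⟩ := exists_derivBound_of_isCompact (k := k) (F := ϑ) hc.isCompact
    fun z _ => h.contDiffAt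
  refine ⟨max M 0, fun z => ?_⟩
  by_cases hz : z ∈ tsupport ϑ
  · exact (hM z hz).mono le_rfl (le_max_left _ _)
  · refine ⟨h.contDiffAt, fun j _ => ?_⟩
    have h1 : z ∉ Function.support (iteratedFDeriv ℝ j ϑ) := fun hz' =>
      hz (support_iteratedFDeriv_subset j hz')
    rw [Function.notMem_support.mp h1]
    simp

theorem norm_integral_le_of_forall_translate {f : E3 → ℂ} (hf : Integrable f) {ϑ : E3 → ℝ}
    (hϑ : Continuous ϑ) (hϑc : HasCompactSupport ϑ) (hϑ1 : ∫ x, ϑ x = 1) {S : Set E3}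
    (hS : IsCompact S) {B : ℝ}
    (hB : ∀ x, ‖∫ t, f t * (ϑ (x - t) : ℂ)‖ ≤ B)
    (h0 : ∀ x, x ∉ S → ∀ t, f t * (ϑ (x - t) : ℂ) = 0) :
    ‖∫ x, f x‖ ≤ B * volume.real S := by
  have hϑi : Integrable fun x => (ϑ x : ℂ) := (hϑ.integrable_of_hasCompactSupport hϑc).ofReal
  have h1 := integral_convolution (ContinuousLinearMap.mul ℝ ℂ) hf hϑi
  have h2 : ∫ x, (ϑ x : ℂ) = 1 := by rw [integral_complex_ofReal, hϑ1]; simp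
  rw [h2, ContinuousLinearMap.mul_apply', mul_one] at h1
  rw [← h1]
  have e : ∀ x, convolution f (fun x => (ϑ x : ℂ)) (ContinuousLinearMap.mul ℝ ℂ) volume x =
      ∫ t, f t * (ϑ (x - t) : ℂ) := fun x => by simp [convolution]
  simp_rw [e]
  rw [← setIntegral_eq_integral_of_forall_compl_eq_zero (s := S)]
  · exact norm_setIntegral_le_of_norm_le_const hS.measure_lt_top fun x _ => hB x
  · intro x hx
    simp [h0 x hx]

theorem exists_family_decay {P : Type*} [NormedAddCommGroup P] [NormedSpace ℝ P] [ProperSpace P]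
    {F A : P × E3 → ℝ} {K : Set (P × E3)} (hK : IsCompact K)
    (hF : ∀ z ∈ K, ContDiffAt ℝ 6 F z) (hA : ∀ z ∈ K, ContDiffAt ℝ 4 A z) {S : Set P}
    (hAK : ∀ μ ∈ S, ∀ x, A (μ, x) ≠ 0 → (μ, x) ∈ K) {d : ℝ} (hd : 0 < d)
    (hdet : ∀ μ ∈ S, ∀ x, (μ, x) ∈ K → d ≤ |(hessMat (fun y => F (μ, y)) x).det|) :
    ∃ C : ℝ, 0 ≤ C ∧ ∀ μ ∈ S, ∀ (T : ℝ) (ℓ : E3 →L[ℝ] ℝ), 0 < T →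
      ‖∫ x, osc (T * F (μ, x) + ℓ x) * (A (μ, x) : ℂ)‖ ≤ C * T ^ (-(3 / 2) : ℝ) := by
  obtain ⟨δ, hδ, hδK⟩ := hK.exists_cthickening_subset_open
    ((isOpen_setOf_contDiffAt (k := 6) (F := F)).inter (isOpen_setOf_contDiffAt (k := 4) (F := A)))
    (fun z hz => ⟨hF z hz, hA z hz⟩)
  have hK' : IsCompact (Metric.cthickening δ K) := hK.cthickening
  obtain ⟨M1, hM1⟩ := exists_derivBound_of_isCompact hK' fun z hz => (hδK hz).1
  obtain ⟨M2, hM2⟩ := exists_derivBound_of_isCompact hK' fun z hz => (hδK hz).2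
  set d' : ℝ := d / (18 * M1 ^ 2 + 1) with hd'
  have hd'0 : 0 < d' := by positivity
  set r : ℝ := min (1 / 3) (min (δ / 3) (d' / (6 * (|M1| + 1)))) with hr
  have hr0 : 0 < r := by positivity
  have hr1 : 3 * r ≤ 1 := by linarith [min_le_left (1 / 3) (min (δ / 3) (d' / (6 * (|M1| + 1))))]
  have hr2 : 3 * r ≤ δ := by
    have h1 := min_le_right (1 / 3) (min (δ / 3) (d' / (6 * (|M1| + 1))))
    have h2 := min_le_left (δ / 3) (d' / (6 * (|M1| + 1)))
    linarith
  have hr3 : |M1| * (3 * r) ≤ d' / 2 := by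
    have h1 := min_le_right (1 / 3) (min (δ / 3) (d' / (6 * (|M1| + 1))))
    have h2 := min_le_right (δ / 3) (d' / (6 * (|M1| + 1)))
    have h3 : r ≤ d' / (6 * (|M1| + 1)) := h1.trans h2
    rw [le_div_iff₀ (by positivity)] at h3
    nlinarith [abs_nonneg M1]
  let bump : ContDiffBump (0 : E3) := ⟨r / 2, r, by positivity, by linarith⟩
  set ϑ : E3 → ℝ := bump.normed volume with hϑ
  have hϑc : HasCompactSupport ϑ := bump.hasCompactSupport_normed
  have hϑsmooth : ContDiff ℝ 4 ϑ := bump.contDiff_normed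
  have hϑts : tsupport ϑ = Metric.closedBall 0 r := bump.tsupport_normed_eq
  have hϑs : Function.support ϑ = Metric.ball 0 r := bump.support_normed_eq
  obtain ⟨Mϑ, hMϑ⟩ := exists_derivBound_of_contDiff_of_hasCompactSupport 4 hϑsmooth hϑc
  set N : ℝ := 2 ^ 4 * max M2 0 * Mϑ with hN
  obtain ⟨R, hR⟩ := (hK.image continuous_snd).isBounded.subset_closedBall (0 : E3)
  obtain ⟨C, hC, hCb⟩ := exists_local_decay |M1| N hd'0
  set S' : Set E3 := Metric.closedBall 0 (R + r) with hS'
  refine ⟨√C * volume.real S', by positivity, fun μ hμ T ℓ hT => ?_⟩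
  set f : E3 → ℂ := fun x => osc (T * F (μ, x) + ℓ x) * (A (μ, x) : ℂ) with hf
  have hKc : IsClosed {x : E3 | (μ, x) ∈ K} :=
    hK.isClosed.preimage (by fun_prop : Continuous fun x : E3 => (μ, x))
  have hts : ∀ x ∈ tsupport (fun y => A (μ, y)), (μ, x) ∈ K := fun x hx =>
    closure_minimal (fun y hy => hAK μ hμ y hy) hKc hx
  have hKR : ∀ x, (μ, x) ∈ K → x ∈ Metric.closedBall (0 : E3) R := fun x hx =>
    hR ⟨(μ, x), hx, rfl⟩
  have hAc : HasCompactSupport fun y => A (μ, y) :=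
    HasCompactSupport.of_support_subset_isCompact (isCompact_closedBall (0 : E3) R)
      fun x hx => hKR x (hAK μ hμ x hx)
  have hAD : ∀ x, DerivBound 4 (max M2 0) (fun y => A (μ, y)) x := by
    intro x
    by_cases hx : x ∈ tsupport (fun y => A (μ, y))
    · exact (hM2 _ (Metric.self_subset_cthickening K (hts x hx))).slice.mono le_rfl
        (le_max_left _ _)
    · have h1 := notMem_tsupport_iff_eventuallyEq.mp hx
      refine ⟨contDiffAt_const.congr_of_eventuallyEq h1, fun j _ => ?_⟩
      rw [(h1.iteratedFDeriv ℝ j).eq_of_nhds]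
      simp
  have hfi : Integrable f := integrable_osc_mul_of_tsupport hAc fun x hx =>
    ⟨(continuousAt_const.mul
      (hM1 _ (Metric.self_subset_cthickening K (hts x hx))).slice.contDiffAt.continuousAt).add
      ℓ.continuous.continuousAt, (hAD x).contDiffAt.continuousAt⟩
  have hTpow : (T ^ (-(3 / 2) : ℝ)) ^ 2 = (T ^ 3)⁻¹ := by
    rw [← Real.rpow_natCast, ← Real.rpow_mul hT.le, show (-(3 / 2) : ℝ) * (2 : ℕ) = -(3 : ℕ) by
      norm_num, Real.rpow_neg hT.le, Real.rpow_natCast]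
  have hmain : ∀ x, ‖∫ t, f t * (ϑ (x - t) : ℂ)‖ ≤ √C * T ^ (-(3 / 2) : ℝ) := by
    intro x
    by_cases hex : ∃ ξ, (μ, ξ) ∈ K ∧ x - ξ ∈ Metric.ball (0 : E3) r
    · obtain ⟨ξ, hξK, hξr⟩ := hex
      rw [mem_ball_zero_iff] at hξr
      set a : E3 → ℝ := fun t => A (μ, t) * ϑ (t - x) with ha
      have e : ∀ t, f t * (ϑ (x - t) : ℂ) = osc (T * F (μ, t) + ℓ t) * (a t : ℂ) := by
        intro t
        have : ϑ (x - t) = ϑ (t - x) := by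
          rw [← neg_sub t x]; exact bump.normed_neg _
        simp only [hf, ha, this]
        push_cast
        ring
      simp_rw [e]
      have hats : tsupport a ⊆ Metric.ball ξ (3 * r) := by
        have h1 : tsupport a ⊆ Metric.closedBall x r := by
          refine closure_minimal (fun y hy => ?_) Metric.isClosed_closedBall
          have hy2 : y - x ∈ Function.support ϑ := fun h => hy (by simp [ha, h])
          rw [hϑs, mem_ball_zero_iff] at hy2
          exact mem_closedBall_iff_norm.mpr hy2.le
        intro y hy
        have hy1 := mem_closedBall_iff_norm.mp (h1 hy)
        rw [mem_ball_iff_norm]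
        calc ‖y - ξ‖ = ‖(y - x) + (x - ξ)‖ := by congr 1; abel
          _ ≤ ‖y - x‖ + ‖x - ξ‖ := norm_add_le _ _
          _ < 3 * r := by linarith
      have hFD : ∀ y ∈ Metric.ball ξ (3 * r), DerivBound 6 |M1| (fun y => F (μ, y)) y := by
        intro y hy
        have hmem : (μ, y) ∈ Metric.cthickening δ K := by
          refine Metric.mem_cthickening_of_dist_le _ (μ, ξ) _ _ hξK ?_
          rw [Prod.dist_eq, dist_self]
          exact max_le hδ.le ((Metric.mem_ball.mp hy).le.trans hr2)
        exact (hM1 _ hmem).slice.mono le_rfl (le_abs_self _)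
      have hnd := nondegenerate_of_det hd ((hFD ξ (Metric.mem_ball_self (by positivity))).mono
        (by norm_num) le_rfl) (hdet μ hμ ξ hξK)
      rw [sq_abs] at hnd
      have := hCb (fun y => F (μ, y)) a ξ (3 * r) (by positivity) hr1 hr3 hFD
        (fun y => (hAD y).mul ((hMϑ (y - x)).comp_sub x)) hats hnd T ℓ hT
      refine abs_le_of_sq_le_sq' ?_ (by positivity) |>.2
      rw [mul_pow, Real.sq_sqrt hC, hTpow, ← div_eq_mul_inv, le_div_iff₀ (by positivity)]
      linarith
    · push Not at hex
      have h0 : ∀ t, f t * (ϑ (x - t) : ℂ) = 0 := by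
        intro t
        by_cases ht : A (μ, t) = 0
        · simp [hf, ht]
        · have h1 := hex t (hAK μ hμ t ht)
          rw [← hϑs, Function.notMem_support] at h1
          simp [h1]
      simp only [h0, integral_zero, norm_zero]
      positivity
  have hfin := norm_integral_le_of_forall_translate hfi hϑsmooth.continuous hϑc
    bump.integral_normed (isCompact_closedBall (0 : E3) (R + r)) hmain fun x hx t => by
      by_cases ht : A (μ, t) = 0
      · simp [hf, ht]
      · have h1 := mem_closedBall_zero_iff.mp (hKR t (hAK μ hμ t ht))
        have h2 : x - t ∉ Function.support ϑ := by
          intro h3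
          rw [hϑs, mem_ball_zero_iff] at h3
          refine hx (mem_closedBall_zero_iff.mpr ?_)
          calc ‖x‖ = ‖t + (x - t)‖ := by congr 1; abel
            _ ≤ ‖t‖ + ‖x - t‖ := norm_add_le _ _
            _ ≤ R + r := by linarith
        rw [Function.notMem_support.mp h2]
        simp
  calc _ ≤ _ := hfin
    _ = _ := by ring

end Family

section HessianOfOmega

theorem hasFDerivAt_norm_sub {V : Type*} [NormedAddCommGroup V] [InnerProductSpace ℝ V] {p x : V}
    (h : x ≠ p) :
    HasFDerivAt (fun y => ‖y - p‖) (‖x - p‖⁻¹ • innerSL ℝ (x - p)) x := by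
  have h0 : ‖x - p‖ ^ 2 ≠ 0 := pow_ne_zero _ (norm_ne_zero_iff.mpr (sub_ne_zero.mpr h))
  have h1 : HasFDerivAt (fun y => ‖y - p‖ ^ 2) (2 • innerSL ℝ (x - p)) x := by
    have := ((hasStrictFDerivAt_norm_sq (x - p)).hasFDerivAt).comp x
      ((hasFDerivAt_id x).sub_const p)
    exact this
  have h2 := h1.sqrt h0
  have e : (fun y => √(‖y - p‖ ^ 2)) = fun y => ‖y - p‖ := by
    funext y; exact Real.sqrt_sq (norm_nonneg _)
  rw [e, Real.sqrt_sq (norm_nonneg _)] at h2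
  convert h2 using 1
  ext v
  simp
  ring

theorem contDiffAt_norm_sub {V : Type*} [NormedAddCommGroup V] [InnerProductSpace ℝ V] {p x : V}
    {n : WithTop ℕ∞} (h : x ≠ p) : ContDiffAt ℝ n (fun y => ‖y - p‖) x :=
  (contDiffAt_norm ℝ (sub_ne_zero.mpr h)).comp x (contDiffAt_id.sub contDiffAt_const)

theorem fderiv_fderiv_norm_sub {V : Type*} [NormedAddCommGroup V] [InnerProductSpace ℝ V]
    {p x : V} (h : x ≠ p) (v w : V) :
    fderiv ℝ (fun y => fderiv ℝ (fun z => ‖z - p‖) y v) x w =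
      inner ℝ v w / ‖x - p‖ - inner ℝ (x - p) v * inner ℝ (x - p) w / ‖x - p‖ ^ 3 := by
  have hne : ‖x - p‖ ≠ 0 := norm_ne_zero_iff.mpr (sub_ne_zero.mpr h)
  have e : (fun y => fderiv ℝ (fun z => ‖z - p‖) y v) =ᶠ[nhds x]
      fun y => ‖y - p‖⁻¹ * inner ℝ (y - p) v := by
    filter_upwards [isOpen_ne.mem_nhds h] with y hy
    rw [(hasFDerivAt_norm_sub hy).fderiv, smul_apply, innerSL_apply_apply, smul_eq_mul]
  rw [e.fderiv_eq]
  have h1 : HasFDerivAt (fun y => inner ℝ (y - p) v) (innerSL ℝ v) x := by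
    have := (innerSL ℝ v).hasFDerivAt.comp x ((hasFDerivAt_id x).sub_const p)
    refine (this.congr_of_eventuallyEq (Filter.Eventually.of_forall fun y => ?_))
    simp [real_inner_comm]
  have hinv : HasFDerivAt (fun y => ‖y - p‖⁻¹)
      (-(‖x - p‖ ^ 2)⁻¹ • (‖x - p‖⁻¹ • innerSL ℝ (x - p))) x :=
    (hasDerivAt_inv hne).comp_hasFDerivAt x (hasFDerivAt_norm_sub h)
  have h2 := (hinv.mul h1).fderiv
  have h3 : fderiv ℝ (fun y => ‖y - p‖⁻¹ * inner ℝ (y - p) v) x = _ := h2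
  rw [h3]
  simp only [add_apply, smul_apply, innerSL_apply_apply, smul_eq_mul]
  field_simp
  ring

/-- The focus `(0, 0, c)`. -/
def focus (c : ℝ) : E3 := !₂[0, 0, c]

theorem d1_eq_norm (κ : ℝ) (ξ : E3) : d1 κ ξ = ‖ξ - focus κ⁻¹‖ := by
  rw [d1, EuclideanSpace.norm_eq]
  simp [Fin.sum_univ_three, focus]

theorem d2_eq_norm (κ : ℝ) (ξ : E3) : d2 κ ξ = ‖ξ - focus (-κ⁻¹)‖ := by
  rw [d2, EuclideanSpace.norm_eq]
  simp [Fin.sum_univ_three, focus]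

theorem nrmh_sq (ξ : E3) : nrmh ξ ^ 2 = ξ 0 ^ 2 + ξ 1 ^ 2 := Real.sq_sqrt (by positivity)

theorem d1_sq (κ : ℝ) (ξ : E3) : d1 κ ξ ^ 2 = ξ 0 ^ 2 + ξ 1 ^ 2 + (ξ 2 - κ⁻¹) ^ 2 :=
  Real.sq_sqrt (by positivity)

theorem d2_sq (κ : ℝ) (ξ : E3) : d2 κ ξ ^ 2 = ξ 0 ^ 2 + ξ 1 ^ 2 + (ξ 2 + κ⁻¹) ^ 2 :=
  Real.sq_sqrt (by positivity)

theorem d2_nonneg (κ : ℝ) (ξ : E3) : 0 ≤ d2 κ ξ := Real.sqrt_nonneg _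

theorem nrmh_nonneg (ξ : E3) : 0 ≤ nrmh ξ := Real.sqrt_nonneg _

theorem ne_focus {ξ : E3} (h : 0 < nrmh ξ) (c : ℝ) : ξ ≠ focus c := by
  rintro rfl
  simp [nrmh, focus] at h

theorem d1_pos {ξ : E3} (h : 0 < nrmh ξ) (κ : ℝ) : 0 < d1 κ ξ := by
  rw [d1_eq_norm]; exact norm_pos_iff.mpr (sub_ne_zero.mpr (ne_focus h _))

theorem d2_pos {ξ : E3} (h : 0 < nrmh ξ) (κ : ℝ) : 0 < d2 κ ξ := by
  rw [d2_eq_norm]; exact norm_pos_iff.mpr (sub_ne_zero.mpr (ne_focus h _))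

theorem Om_eq_norm (κ : ℝ) : Om κ = fun ξ => (‖ξ - focus (-κ⁻¹)‖ - ‖ξ - focus κ⁻¹‖) / 2 := by
  funext ξ
  rw [Om, d1_eq_norm, d2_eq_norm]

theorem contDiffAt_Om {ξ : E3} (h : 0 < nrmh ξ) (κ : ℝ) {n : WithTop ℕ∞} :
    ContDiffAt ℝ n (Om κ) ξ := by
  rw [Om_eq_norm]
  exact ((contDiffAt_norm_sub (ne_focus h _)).sub (contDiffAt_norm_sub (ne_focus h _))).div_const _

theorem isOpen_nrmh_pos : IsOpen {ξ : E3 | 0 < nrmh ξ} :=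
  isOpen_lt continuous_const (by unfold nrmh; fun_prop)

theorem fderiv_fderiv_Om {ξ : E3} (h : 0 < nrmh ξ) (κ : ℝ) (v w : E3) :
    fderiv ℝ (fun y => fderiv ℝ (Om κ) y v) ξ w =
      (fderiv ℝ (fun y => fderiv ℝ (fun z => ‖z - focus (-κ⁻¹)‖) y v) ξ w -
        fderiv ℝ (fun y => fderiv ℝ (fun z => ‖z - focus κ⁻¹‖) y v) ξ w) / 2 := by
  have hd : ∀ c y, 0 < nrmh y → DifferentiableAt ℝ (fun z => ‖z - focus c‖) y := fun c y hy =>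
    (contDiffAt_norm_sub (n := 1) (ne_focus hy c)).differentiableAt (by norm_num)
  have hd2 : ∀ c, DifferentiableAt ℝ (fun y => fderiv ℝ (fun z => ‖z - focus c‖) y v) ξ := fun c =>
    (((contDiffAt_norm_sub (n := 2) (ne_focus h c)).fderiv_right (m := 1) (by norm_num)).clm_apply
      contDiffAt_const).differentiableAt (by norm_num)
  have e : (fun y => fderiv ℝ (Om κ) y v) =ᶠ[nhds ξ] fun y =>
      (fderiv ℝ (fun z => ‖z - focus (-κ⁻¹)‖) y v -
        fderiv ℝ (fun z => ‖z - focus κ⁻¹‖) y v) * 2⁻¹ := by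
    filter_upwards [isOpen_nrmh_pos.mem_nhds h] with y hy
    have := (((hd (-κ⁻¹) y hy).hasFDerivAt.fun_sub (hd κ⁻¹ y hy).hasFDerivAt).mul_const
      (2⁻¹ : ℝ)).fderiv
    rw [Om_eq_norm]
    simp only [div_eq_mul_inv]
    rw [this]
    simp [mul_comm]
  rw [e.fderiv_eq]
  have := (((hd2 (-κ⁻¹)).hasFDerivAt.fun_sub (hd2 κ⁻¹).hasFDerivAt).mul_const (2⁻¹ : ℝ)).fderiv
  rw [this]
  simp
  ring

theorem det_hessMat_Om {ξ : E3} (h : 0 < nrmh ξ) (κ : ℝ) :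
    (hessMat (Om κ) ξ).det =
      κ⁻¹ ^ 2 * nrmh ξ ^ 2 * Om κ ξ / (d1 κ ξ * d2 κ ξ) ^ 4 := by
  have h1 := d1_pos h κ
  have h2 := d2_pos h κ
  have hs1 := d1_sq κ ξ
  have hs2 := d2_sq κ ξ
  set a := d1 κ ξ with ha
  set b := d2 κ ξ with hb
  set α : ℝ := (b⁻¹ - a⁻¹) / 2 with hα
  set β : ℝ := (a ^ 3)⁻¹ / 2 with hβ
  set γ : ℝ := -(b ^ 3)⁻¹ / 2 with hγ
  set p : Fin 3 → ℝ := ![ξ 0, ξ 1, ξ 2 - κ⁻¹] with hp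
  set q : Fin 3 → ℝ := ![ξ 0, ξ 1, ξ 2 + κ⁻¹] with hq
  have hent : hessMat (Om κ) ξ = Matrix.of fun i j =>
      α * (if i = j then 1 else 0) + β * (p i * p j) + γ * (q i * q j) := by
    ext i j
    rw [hessMat, Matrix.of_apply, Matrix.of_apply, fderiv_fderiv_Om h,
      fderiv_fderiv_norm_sub (ne_focus h _), fderiv_fderiv_norm_sub (ne_focus h _),
      ← d1_eq_norm, ← d2_eq_norm, ← ha, ← hb]
    have hI : inner ℝ (EuclideanSpace.single i (1 : ℝ)) (EuclideanSpace.single j (1 : ℝ)) =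
        if i = j then (1 : ℝ) else 0 := by
      rw [EuclideanSpace.inner_single_left]
      simp
    have hP : ∀ i, inner ℝ (ξ - focus κ⁻¹) (EuclideanSpace.single i (1 : ℝ)) = p i := by
      intro i
      rw [EuclideanSpace.inner_single_right]
      fin_cases i <;> simp [hp, focus]
    have hQ : ∀ i, inner ℝ (ξ - focus (-κ⁻¹)) (EuclideanSpace.single i (1 : ℝ)) = q i := by
      intro i
      rw [EuclideanSpace.inner_single_right]
      fin_cases i <;> simp [hq, focus]
    rw [hI, hP, hP, hQ, hQ, hα, hβ, hγ]
    ring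
  have hdet : (hessMat (Om κ) ξ).det = α ^ 3 + α ^ 2 *
      (β * (ξ 0 ^ 2 + ξ 1 ^ 2 + (ξ 2 - κ⁻¹) ^ 2) + γ * (ξ 0 ^ 2 + ξ 1 ^ 2 + (ξ 2 + κ⁻¹) ^ 2)) +
      α * β * γ * (4 * κ⁻¹ ^ 2 * (ξ 0 ^ 2 + ξ 1 ^ 2)) := by
    rw [hent, Matrix.det_fin_three]
    simp [hp, hq]
    ring
  rw [hdet, ← hs1, ← hs2, nrmh_sq, Om, ← ha, ← hb, hα, hβ, hγ]
  field_simp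
  ring

theorem Om_mul_add (κ : ℝ) (ξ : E3) : Om κ ξ * (d1 κ ξ + d2 κ ξ) = 2 * κ⁻¹ * ξ 2 := by
  have h1 := d1_sq κ ξ
  have h2 := d2_sq κ ξ
  rw [Om]
  linear_combination (h2 - h1) / 2

end HessianOfOmega

section AffinePullback

theorem det_hessMat_of_affine {f G : E3 → ℝ} {x w : E3} {L : E3 →L[ℝ] E3} {c : ℝ}
    {ℓ : E3 →L[ℝ] ℝ} {b : ℝ} (hG : ContDiffAt ℝ 2 G (w + L x))
    (hf : f =ᶠ[nhds x] fun y => c * G (w + L y) + ℓ y + b) :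
    (hessMat f x).det = c ^ 3 *
      (Matrix.of fun k i => (L (EuclideanSpace.single i 1)) k).det ^ 2 *
        (hessMat G (w + L x)).det := by
  have hev : ∀ᶠ y in nhds x, ContDiffAt ℝ 2 G (w + L y) := by
    have : Filter.Tendsto (fun y => w + L y) (nhds x) (nhds (w + L x)) :=
      (continuous_const.add L.continuous).continuousAt
    exact this.eventually (hG.eventually (by simp))
  have haff : ∀ y, HasFDerivAt (fun y => w + L y) L y := fun y => L.hasFDerivAt.const_add w
  have hent : ∀ i j, hessMat f x i j =
      c * fderiv ℝ (fderiv ℝ G) (w + L x) (L (EuclideanSpace.single j 1))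
        (L (EuclideanSpace.single i 1)) := by
    intro i j
    have e : (fun y => fderiv ℝ f y (EuclideanSpace.single i 1)) =ᶠ[nhds x]
        fun y => c * fderiv ℝ G (w + L y) (L (EuclideanSpace.single i 1)) +
          ℓ (EuclideanSpace.single i 1) := by
      filter_upwards [hf.eventuallyEq_nhds, hev] with y hy hGy
      rw [hy.fderiv_eq]
      have h1 := (((((hGy.differentiableAt (by norm_num)).hasFDerivAt).comp y (haff y)).const_mul
        c).add ℓ.hasFDerivAt).add_const b
      have h2 := h1.fderiv
      have h3 : fderiv ℝ (fun y => c * G (w + L y) + ℓ y + b) y = _ := h2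
      rw [h3]
      simp
    rw [hessMat, Matrix.of_apply, e.fderiv_eq]
    have h1 := ((hG.fderiv_right (m := 1) (by norm_num)).differentiableAt
      (by norm_num)).hasFDerivAt
    have h2 := (((h1.comp x (haff x)).clm_apply
      (hasFDerivAt_const (L (EuclideanSpace.single i 1)) x)).const_mul c).add_const
      (ℓ (EuclideanSpace.single i 1))
    have h3 := h2.fderiv
    simp only [Function.comp_apply] at h3
    rw [h3]
    simp
  have hH : ∀ k l, hessMat G (w + L x) k l =
      fderiv ℝ (fderiv ℝ G) (w + L x) (EuclideanSpace.single l 1) (EuclideanSpace.single k 1) := by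
    intro k l
    have h1 := ((hG.fderiv_right (m := 1) (by norm_num)).differentiableAt
      (by norm_num)).hasFDerivAt
    have h2 := (h1.clm_apply
      (hasFDerivAt_const (EuclideanSpace.single k (1 : ℝ) : E3) (w + L x))).fderiv
    rw [hessMat, Matrix.of_apply, h2]
    simp
  set A : Matrix (Fin 3) (Fin 3) ℝ := Matrix.of fun k i => (L (EuclideanSpace.single i 1)) k
    with hA
  have hmat : hessMat f x = c • (A.transpose * hessMat G (w + L x) * A) := by
    ext i j
    rw [hent, Matrix.smul_apply, smul_eq_mul]
    congr 1
    conv_lhs => rw [← sum_single_eq (L (EuclideanSpace.single j 1)),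
      ← sum_single_eq (L (EuclideanSpace.single i 1))]
    simp only [Matrix.mul_apply, Fin.sum_univ_three, Matrix.transpose_apply, hA, Matrix.of_apply,
      hH, map_add, map_smul, add_apply, smul_apply, smul_eq_mul]
    ring
  rw [hmat, Matrix.det_smul, Matrix.det_mul, Matrix.det_mul, Matrix.det_transpose]
  simp
  ring

end AffinePullback

section ColumnMaps

/-- The linear map with columns `u 0`, `u 1`, `u 2`. -/
def colMap (u : Fin 3 → E3) : E3 →L[ℝ] E3 :=
  ∑ j, (EuclideanSpace.proj j : E3 →L[ℝ] ℝ).smulRight (u j)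

theorem colMap_apply (u : Fin 3 → E3) (x : E3) (k : Fin 3) :
    colMap u x k = x 0 * u 0 k + x 1 * u 1 k + x 2 * u 2 k := by
  simp [colMap, Fin.sum_univ_three]

theorem colMap_matrix (u : Fin 3 → E3) :
    (Matrix.of fun k i => (colMap u (EuclideanSpace.single i 1)) k) =
      Matrix.of fun k i => u i k := by
  ext k i
  rw [Matrix.of_apply, Matrix.of_apply, colMap_apply]
  fin_cases i <;> simp

theorem integral_eq_abs_det_mul_integral_colMap (u : Fin 3 → E3)
    (hu : (Matrix.of fun k i => u i k).det ≠ 0) (w : E3) (g : E3 → ℂ) :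
    ∫ x, g x = |(Matrix.of fun k i => u i k).det| * ∫ x, g (w + colMap u x) := by
  have hdet : LinearMap.det (colMap u : E3 →ₗ[ℝ] E3) = (Matrix.of fun k i => u i k).det := by
    rw [← LinearMap.det_toMatrix (EuclideanSpace.basisFun (Fin 3) ℝ).toBasis]
    congr 1
    ext i j
    rw [LinearMap.toMatrix_apply, ← colMap_matrix]
    simp
  have hne : LinearMap.det (colMap u : E3 →ₗ[ℝ] E3) ≠ 0 := by rwa [hdet]
  have hmap := Measure.map_linearMap_addHaar_eq_smul_addHaar (volume : Measure E3) hne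
  have hemb : MeasurableEmbedding (colMap u : E3 →ₗ[ℝ] E3) :=
    ((LinearEquiv.ofIsUnitDet (f := (colMap u : E3 →ₗ[ℝ] E3))
      (v := (EuclideanSpace.basisFun (Fin 3) ℝ).toBasis)
      (v' := (EuclideanSpace.basisFun (Fin 3) ℝ).toBasis)
      (by rw [LinearMap.det_toMatrix]; exact isUnit_iff_ne_zero.mpr hne)
      ).toContinuousLinearEquiv.toHomeomorph.measurableEmbedding)
  have h1 := hemb.integral_map (μ := volume) (fun x => g (w + x))
  rw [hmap, integral_smul_measure, integral_add_left_eq_self, hdet] at h1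
  rw [ContinuousLinearMap.coe_coe] at h1
  rw [← h1, abs_inv, ENNReal.toReal_ofReal (by positivity), Complex.real_smul]
  have : ((|(Matrix.of fun k i => u i k).det| : ℝ) : ℂ) ≠ 0 := by
    exact_mod_cast abs_ne_zero.mpr hu
  push_cast
  rw [mul_inv_cancel_left₀ this]

end ColumnMaps

section BoxDecay

theorem exists_box_decay {P : Type*} [NormedAddCommGroup P] [NormedSpace ℝ P] [ProperSpace P]
    {F A : P × E3 → ℝ} {K : Set (P × E3)} (hK : IsCompact K)
    (hF : ∀ z ∈ K, ContDiffAt ℝ 6 F z) (hA : ∀ z ∈ K, ContDiffAt ℝ 4 A z)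
    (Rel : P → ℝ → ℝ → E3 → (Fin 3 → E3) → Prop) {d : ℝ} (hd : 0 < d)
    (hrel : ∀ μ κ τ w u, Rel μ κ τ w u → 0 < τ ∧ (Matrix.of fun k i => u i k).det ≠ 0 ∧ (∀ x, A (μ, x) ≠ 0 → (μ, x) ∈ K) ∧
      ∀ x, (μ, x) ∈ K → 0 < nrmh (w + colMap u x) ∧
        d ≤ τ⁻¹ ^ 3 * (Matrix.of fun k i => u i k).det ^ 2 *
          (κ⁻¹ ^ 2 * nrmh (w + colMap u x) ^ 2 * Om κ (w + colMap u x) /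
            (d1 κ (w + colMap u x) * d2 κ (w + colMap u x)) ^ 4))
    (haff : ∀ μ κ τ w u, Rel μ κ τ w u → ∃ (ℓ : E3 →L[ℝ] ℝ) (b : ℝ), ∀ x, (μ, x) ∈ K →
      ∀ᶠ y in nhds x, Om κ (w + colMap u y) = τ * F (μ, y) + ℓ y + b) :
    ∃ C : ℝ, 0 ≤ C ∧ ∀ μ κ τ w u, Rel μ κ τ w u → ∀ (s : ℝ) (ℓ : E3 →L[ℝ] ℝ) (a : E3 → ℝ), 0 < s →
      (∀ x, a (w + colMap u x) = A (μ, x)) →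
      ‖∫ x, osc (s * Om κ x + ℓ x) * (a x : ℂ)‖ ≤
        C * (|(Matrix.of fun k i => u i k).det| * (s * τ) ^ (-(3 / 2) : ℝ)) := by
  obtain ⟨C, hC, hCb⟩ := exists_family_decay hK hF hA (S := {μ | ∃ κ τ w u, Rel μ κ τ w u})
    (fun μ ⟨κ, τ, w, u, h⟩ => (hrel μ κ τ w u h).2.2.1) hd (by
      rintro μ ⟨κ, τ, w, u, h⟩ x hx
      obtain ⟨hτ, -, -, h2⟩ := hrel μ κ τ w u h
      obtain ⟨ℓ, b, hℓ⟩ := haff μ κ τ w u h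
      obtain ⟨hpos, hdx⟩ := h2 x hx
      have hf : (fun y => F (μ, y)) =ᶠ[nhds x] fun y =>
          τ⁻¹ * Om κ (w + colMap u y) + (-τ⁻¹ • ℓ) y + -τ⁻¹ * b := by
        filter_upwards [hℓ x hx] with y hy
        rw [hy]
        simp only [smul_apply, smul_eq_mul]
        field_simp
        ring
      rw [det_hessMat_of_affine (contDiffAt_Om hpos κ) hf, colMap_matrix, det_hessMat_Om hpos]
      exact hdx.trans (le_abs_self _))
  refine ⟨C, hC, fun μ κ τ w u h s ℓ a hs ha => ?_⟩
  obtain ⟨hτ, hdet, hAK, -⟩ := hrel μ κ τ w u h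
  obtain ⟨ℓ', b, hℓ'⟩ := haff μ κ τ w u h
  rw [integral_eq_abs_det_mul_integral_colMap u hdet w, norm_mul, Complex.norm_real, norm_abs_eq_norm,
    Real.norm_eq_abs]
  have he : ∀ x, osc (s * Om κ (w + colMap u x) + ℓ (w + colMap u x)) *
      (a (w + colMap u x) : ℂ) = osc (s * b + ℓ w) *
        (osc (s * τ * F (μ, x) + (s • ℓ' + ℓ.comp (colMap u)) x) * (A (μ, x) : ℂ)) := by
    intro x
    rw [ha]
    by_cases hx : A (μ, x) = 0
    · simp [hx]
    rw [← mul_assoc, ← osc_add, (hℓ' x (hAK x hx)).self_of_nhds]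
    congr 2
    simp
    ring
  simp_rw [he]
  rw [integral_const_mul, norm_mul, norm_osc, one_mul]
  have := hCb μ ⟨κ, τ, w, u, h⟩ (s * τ) (s • ℓ' + ℓ.comp (colMap u)) (by positivity)
  calc _ ≤ |(Matrix.of fun k i => u i k).det| * (C * (s * τ) ^ (-(3 / 2) : ℝ)) := by gcongr
    _ = _ := by ring

end BoxDecay

section DiagonalBoxes

/-- A `C⁴` bump function supported in the annulus `1 ≤ |y| ≤ 4`. -/
structure IsBump (φ : ℝ → ℝ) : Prop where
  contDiff : ContDiff ℝ 4 φ
  supp : ∀ y, φ y ≠ 0 → 1 ≤ |y| ∧ |y| ≤ 4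

/-- The oscillatory integral at frequency scale one. -/
def kernelInt (φ χ : ℝ → ℝ) (κ s : ℝ) (ℓ : E3 →L[ℝ] ℝ) (ε δ : ℝ) : ℂ :=
  ∫ x, osc (s * Om κ x + ℓ x) *
    ((φ ‖x‖ * φ (ε⁻¹ * nrmh x) * χ (δ⁻¹ * x 2) : ℝ) : ℂ)

/-- The cutoff of `kernelInt` in rescaled coordinates, with parameters `(c, ε, δ)`. -/
def diagAmp (φ χ : ℝ → ℝ) (z : (ℝ × ℝ × ℝ) × E3) : ℝ :=
  φ (√((z.1.2.1 * z.2 0) ^ 2 + (z.1.2.1 * z.2 1) ^ 2 + (z.1.2.2 * z.2 2) ^ 2)) *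
    φ (√(z.2 0 ^ 2 + z.2 1 ^ 2)) * χ (z.2 2)

/-- A set containing the support of `diagAmp`. -/
def diagSet (B : Set (ℝ × ℝ × ℝ)) : Set ((ℝ × ℝ × ℝ) × E3) :=
  {z | z.1 ∈ B ∧ (1 ≤ z.2 0 ^ 2 + z.2 1 ^ 2 ∧ z.2 0 ^ 2 + z.2 1 ^ 2 ≤ 16) ∧
    (1 ≤ z.2 2 ∧ z.2 2 ≤ 4) ∧
    (1 ≤ (z.1.2.1 * z.2 0) ^ 2 + (z.1.2.1 * z.2 1) ^ 2 + (z.1.2.2 * z.2 2) ^ 2 ∧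
      (z.1.2.1 * z.2 0) ^ 2 + (z.1.2.1 * z.2 1) ^ 2 + (z.1.2.2 * z.2 2) ^ 2 ≤ 16)}

theorem isCompact_diagSet {B : Set (ℝ × ℝ × ℝ)} (hB : IsCompact B) : IsCompact (diagSet B) := by
  have hK : IsCompact (B ×ˢ Metric.closedBall (0 : E3) 6) := hB.prod (isCompact_closedBall _ _)
  refine hK.of_isClosed_subset ?_ fun z hz => ⟨hz.1, ?_⟩
  · have hBc : IsClosed {z : (ℝ × ℝ × ℝ) × E3 | z.1 ∈ B} := hB.isClosed.preimage continuous_fst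
    simp only [diagSet, Set.ofPred_and]
    refine hBc.inter (IsClosed.inter ?_ (IsClosed.inter ?_ ?_))
    all_goals
      refine IsClosed.inter ?_ ?_ <;> refine isClosed_le ?_ ?_ <;> fun_prop
  · obtain ⟨-, ⟨-, h2⟩, ⟨h3, h4⟩, -⟩ := hz
    rw [mem_closedBall_zero_iff]
    refine abs_le_of_sq_le_sq' ?_ (by norm_num) |>.2
    rw [EuclideanSpace.norm_sq_eq, Fin.sum_univ_three]
    simp only [Real.norm_eq_abs, sq_abs]
    nlinarith

theorem one_le_sqrt_and_le_four (x : ℝ) :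
    (1 ≤ |√x| ∧ |√x| ≤ 4) ↔ (1 ≤ x ∧ x ≤ 16) := by
  rw [abs_of_nonneg (Real.sqrt_nonneg x), Real.one_le_sqrt, Real.sqrt_le_left (by norm_num)]
  norm_num

theorem mem_diagSet_of_diagAmp_ne_zero {φ χ : ℝ → ℝ} (hφ : IsBump φ)
    (hχ : ∀ y, χ y ≠ 0 → 1 ≤ y ∧ y ≤ 4) {B : Set (ℝ × ℝ × ℝ)} {μ : ℝ × ℝ × ℝ} (hμ : μ ∈ B) {x : E3}
    (h : diagAmp φ χ (μ, x) ≠ 0) : (μ, x) ∈ diagSet B := by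
  simp only [diagAmp, ne_eq, mul_eq_zero, not_or] at h
  exact ⟨hμ, (one_le_sqrt_and_le_four _).mp (hφ.supp _ h.1.2), hχ _ h.2,
    (one_le_sqrt_and_le_four _).mp (hφ.supp _ h.1.1)⟩

theorem contDiffAt_diagAmp {φ χ : ℝ → ℝ} (hφ : IsBump φ) (hχ : ContDiff ℝ 4 χ)
    {B : Set (ℝ × ℝ × ℝ)} {z : (ℝ × ℝ × ℝ) × E3} (hz : z ∈ diagSet B) :
    ContDiffAt ℝ 4 (diagAmp φ χ) z := by
  obtain ⟨-, ⟨h1, -⟩, -, ⟨h2, -⟩⟩ := hz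
  refine ContDiffAt.mul (ContDiffAt.mul ?_ ?_) ?_
  · refine hφ.contDiff.contDiffAt.comp z (ContDiffAt.sqrt ?_ (by linarith))
    fun_prop
  · refine hφ.contDiff.contDiffAt.comp z (ContDiffAt.sqrt ?_ (by linarith))
    fun_prop
  · exact hχ.contDiffAt.comp z (by fun_prop)

/-- The columns of the diagonal scaling `diag(ε, ε, δ)`. -/
def diagCols (ε δ : ℝ) : Fin 3 → E3 :=
  ![EuclideanSpace.single 0 ε, EuclideanSpace.single 1 ε, EuclideanSpace.single 2 δ]

theorem colMap_diagCols (ε δ : ℝ) (x : E3) :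
    colMap (diagCols ε δ) x = !₂[ε * x 0, ε * x 1, δ * x 2] := by
  ext k
  rw [colMap_apply]
  fin_cases k <;> simp [diagCols, mul_comm]

theorem det_diagCols (ε δ : ℝ) : (Matrix.of fun k i => diagCols ε δ i k).det = ε ^ 2 * δ := by
  rw [Matrix.det_fin_three]
  simp [diagCols, sq]

theorem d1_le (κ : ℝ) (ξ : E3) : d1 κ ξ ≤ ‖ξ‖ + |κ⁻¹| := by
  rw [d1_eq_norm]
  refine (norm_sub_le _ _).trans (le_of_eq ?_)
  congr 1
  rw [EuclideanSpace.norm_eq]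
  simp [focus, Fin.sum_univ_three, Real.sqrt_sq_eq_abs, abs_inv]

theorem d2_le (κ : ℝ) (ξ : E3) : d2 κ ξ ≤ ‖ξ‖ + |κ⁻¹| := by
  rw [d2_eq_norm]
  refine (norm_sub_le _ _).trans (le_of_eq ?_)
  congr 1
  rw [EuclideanSpace.norm_eq]
  simp [focus, Fin.sum_univ_three, Real.sqrt_sq_eq_abs, abs_inv]

theorem le_det_factor {κ D e m : ℝ} {ξ : E3} (hκ : 0 < κ) (hr : 0 < nrmh ξ) (hm : 0 ≤ m)
    (he : 0 ≤ e) (h1 : d1 κ ξ ≤ D) (h2 : d2 κ ξ ≤ D) (hz : e * m ≤ nrmh ξ ^ 2 * ξ 2) :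
    e * m * κ⁻¹ ^ 3 / D ^ 9 ≤ κ⁻¹ ^ 2 * nrmh ξ ^ 2 * Om κ ξ / (d1 κ ξ * d2 κ ξ) ^ 4 := by
  have hd1 := d1_pos hr κ
  have hd2 := d2_pos hr κ
  have hD : 0 < D := hd1.trans_le h1
  have hOm : Om κ ξ = 2 * κ⁻¹ * ξ 2 / (d1 κ ξ + d2 κ ξ) := by
    rw [eq_div_iff (by positivity), Om_mul_add]
  rw [hOm]
  have hle : (d1 κ ξ + d2 κ ξ) * (d1 κ ξ * d2 κ ξ) ^ 4 ≤ 2 * D ^ 9 := by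
    calc (d1 κ ξ + d2 κ ξ) * (d1 κ ξ * d2 κ ξ) ^ 4 ≤ (D + D) * (D * D) ^ 4 := by gcongr
      _ = 2 * D ^ 9 := by ring
  have hκi : 0 < κ⁻¹ := inv_pos.mpr hκ
  calc e * m * κ⁻¹ ^ 3 / D ^ 9 = 2 * κ⁻¹ ^ 3 * (e * m) / (2 * D ^ 9) := by field_simp
    _ ≤ 2 * κ⁻¹ ^ 3 * (nrmh ξ ^ 2 * ξ 2) / ((d1 κ ξ + d2 κ ξ) * (d1 κ ξ * d2 κ ξ) ^ 4) := by
        have : 0 ≤ nrmh ξ ^ 2 * ξ 2 := (mul_nonneg he hm).trans hz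
        gcongr
    _ = _ := by field_simp

theorem exists_diag_decay {φ χ : ℝ → ℝ} (hφ : IsBump φ) (hχd : ContDiff ℝ 4 χ)
    (hχ : ∀ y, χ y ≠ 0 → 1 ≤ y ∧ y ≤ 4) {B : Set (ℝ × ℝ × ℝ)} (hB : IsCompact B)
    {F : (ℝ × ℝ × ℝ) × E3 → ℝ} (hF : ∀ z ∈ diagSet B, ContDiffAt ℝ 6 F z)
    (κ τ D : ℝ × ℝ × ℝ → ℝ) {S : Set (ℝ × ℝ × ℝ)} (hS : S ⊆ B)
    (hpos : ∀ μ ∈ S, 0 < μ.2.1 ∧ 0 < μ.2.2 ∧ 0 < κ μ ∧ 0 < τ μ)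
    (haff : ∀ μ ∈ S, ∃ (ℓ : E3 →L[ℝ] ℝ) (b : ℝ), ∀ y : E3,
      0 < nrmh (!₂[μ.2.1 * y 0, μ.2.1 * y 1, μ.2.2 * y 2] : E3) →
      Om (κ μ) !₂[μ.2.1 * y 0, μ.2.1 * y 1, μ.2.2 * y 2] = τ μ * F (μ, y) + ℓ y + b)
    {d : ℝ} (hd : 0 < d)
    (hdet : ∀ μ ∈ S, ∀ y, (μ, y) ∈ diagSet B → 4 + (κ μ)⁻¹ ≤ D μ ∧
      d ≤ (τ μ)⁻¹ ^ 3 * (μ.2.1 ^ 2 * μ.2.2) ^ 2 * (μ.2.1 ^ 2 * μ.2.2 * (κ μ)⁻¹ ^ 3 / D μ ^ 9)) :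
    ∃ C : ℝ, 0 ≤ C ∧ ∀ μ ∈ S, ∀ (s : ℝ) (ℓ : E3 →L[ℝ] ℝ), 0 < s →
      ‖kernelInt φ χ (κ μ) s ℓ μ.2.1 μ.2.2‖ ≤
        C * (μ.2.1 ^ 2 * μ.2.2 * (s * τ μ) ^ (-(3 / 2) : ℝ)) := by
  obtain ⟨C, hC, hCb⟩ := exists_box_decay (isCompact_diagSet hB) hF
    (fun z hz => contDiffAt_diagAmp hφ hχd hz)
    (fun μ k t w u => μ ∈ S ∧ k = κ μ ∧ t = τ μ ∧ w = 0 ∧ u = diagCols μ.2.1 μ.2.2) hd (by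
      rintro μ k t w u ⟨hμ, rfl, rfl, rfl, rfl⟩
      obtain ⟨hε, hδ, hκ, hτ⟩ := hpos μ hμ
      rw [det_diagCols]
      refine ⟨hτ, by positivity, fun x hx => mem_diagSet_of_diagAmp_ne_zero hφ hχ (hS hμ) hx,
        fun x hx => ?_⟩
      obtain ⟨hD, hd'⟩ := hdet μ hμ x hx
      obtain ⟨-, ⟨h1, -⟩, ⟨h2, -⟩, ⟨-, h3⟩⟩ := hx
      rw [zero_add, colMap_diagCols]
      set ξ : E3 := !₂[μ.2.1 * x 0, μ.2.1 * x 1, μ.2.2 * x 2] with hξ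
      have hnr : nrmh ξ ^ 2 = μ.2.1 ^ 2 * (x 0 ^ 2 + x 1 ^ 2) := by
        rw [nrmh_sq]; simp [hξ]; ring
      have hnr0 : 0 < nrmh ξ := by
        have : 0 < nrmh ξ ^ 2 := by rw [hnr]; positivity
        exact (nrmh_nonneg ξ).lt_of_ne' fun h => by simp [h] at this
      have hn : ‖ξ‖ ≤ 4 := by
        refine abs_le_of_sq_le_sq' ?_ (by norm_num) |>.2
        rw [EuclideanSpace.norm_sq_eq, Fin.sum_univ_three]
        simp only [Real.norm_eq_abs, sq_abs, hξ]
        simp only [Matrix.cons_val_zero, Matrix.cons_val_one, Matrix.cons_val]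
        norm_num at h3 ⊢
        linarith
      have hκi : |(κ μ)⁻¹| = (κ μ)⁻¹ := abs_of_pos (inv_pos.mpr hκ)
      refine ⟨hnr0, hd'.trans ?_⟩
      have hD1 := (d1_le (κ μ) ξ).trans (by rw [hκi]; linarith : _ ≤ D μ)
      have hD2 := (d2_le (κ μ) ξ).trans (by rw [hκi]; linarith : _ ≤ D μ)
      have hkey := le_det_factor (e := 1) (m := μ.2.1 ^ 2 * μ.2.2) hκ hnr0 (by positivity)
        zero_le_one hD1 hD2 (by
          rw [hnr, one_mul]
          have e : ξ 2 = μ.2.2 * x 2 := by simp [hξ]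
          rw [e]
          have : 1 ≤ (x 0 ^ 2 + x 1 ^ 2) * x 2 := by nlinarith
          calc μ.2.1 ^ 2 * μ.2.2 = μ.2.1 ^ 2 * μ.2.2 * 1 := by ring
            _ ≤ μ.2.1 ^ 2 * μ.2.2 * ((x 0 ^ 2 + x 1 ^ 2) * x 2) := by gcongr
            _ = _ := by ring)
      rw [one_mul] at hkey
      gcongr)
    (by
      rintro μ k t w u ⟨hμ, rfl, rfl, rfl, rfl⟩
      obtain ⟨hε, hδ, hκ, hτ⟩ := hpos μ hμ
      obtain ⟨ℓ, b, h⟩ := haff μ hμ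
      refine ⟨ℓ, b, fun x hx => ?_⟩
      obtain ⟨-, ⟨h1, -⟩, -⟩ := hx
      have hev : ∀ᶠ y : E3 in nhds x, 0 < y 0 ^ 2 + y 1 ^ 2 :=
        (isOpen_lt continuous_const (by fun_prop)).mem_nhds
          (show (0 : ℝ) < x 0 ^ 2 + x 1 ^ 2 by simp only at h1; linarith)
      filter_upwards [hev] with y hy
      rw [zero_add, colMap_diagCols]
      refine h y (Real.sqrt_pos.mpr ?_)
      have : 0 < μ.2.1 ^ 2 * (y 0 ^ 2 + y 1 ^ 2) := by positivity
      simp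
      linarith)
  refine ⟨C, hC, fun μ hμ s ℓ hs => ?_⟩
  obtain ⟨hε, hδ, hκ, hτ⟩ := hpos μ hμ
  have := hCb μ (κ μ) (τ μ) 0 (diagCols μ.2.1 μ.2.2) ⟨hμ, rfl, rfl, rfl, rfl⟩ s ℓ
    (fun x => φ ‖x‖ * φ (μ.2.1⁻¹ * nrmh x) * χ (μ.2.2⁻¹ * x 2)) hs (fun x => by
      rw [zero_add, colMap_diagCols, diagAmp]
      have e1 : ‖(!₂[μ.2.1 * x 0, μ.2.1 * x 1, μ.2.2 * x 2] : E3)‖ =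
          √((μ.2.1 * x 0) ^ 2 + (μ.2.1 * x 1) ^ 2 + (μ.2.2 * x 2) ^ 2) := by
        rw [EuclideanSpace.norm_eq]; simp [Fin.sum_univ_three]
      have e2 : μ.2.1⁻¹ * nrmh (!₂[μ.2.1 * x 0, μ.2.1 * x 1, μ.2.2 * x 2] : E3) =
          √(x 0 ^ 2 + x 1 ^ 2) := by
        rw [nrmh]
        simp only [Matrix.cons_val_zero, Matrix.cons_val_one, mul_pow]
        rw [← mul_add, Real.sqrt_mul (by positivity), Real.sqrt_sq hε.le,
          inv_mul_cancel_left₀ hε.ne']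
      have e3 : μ.2.2⁻¹ * (!₂[μ.2.1 * x 0, μ.2.1 * x 1, μ.2.2 * x 2] : E3) 2 = x 2 := by
        simp [inv_mul_cancel_left₀ hδ.ne']
      rw [e1, e2, e3])
  rw [det_diagCols, abs_of_pos (by positivity)] at this
  exact this

end DiagonalBoxes

section DiagonalFamilies

/-- The compact box `[0, a] × [b, e] × [0, 1]` of parameters `(c, ε, δ)`. -/
def paramBox (a b e : ℝ) : Set (ℝ × ℝ × ℝ) :=
  Set.Icc 0 a ×ˢ Set.Icc b e ×ˢ Set.Icc 0 1

theorem isCompact_paramBox (a b e : ℝ) : IsCompact (paramBox a b e) :=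
  isCompact_Icc.prod (isCompact_Icc.prod isCompact_Icc)

variable {φ χ : ℝ → ℝ}

theorem exists_decay_of_le_width (hφ : IsBump φ) (hχd : ContDiff ℝ 4 χ)
    (hχ : ∀ y, χ y ≠ 0 → 1 ≤ y ∧ y ≤ 4) :
    ∃ C : ℝ, 0 ≤ C ∧ ∀ c ε δ s : ℝ, ∀ ℓ : E3 →L[ℝ] ℝ, 0 < c → c ≤ 8 → 1 / 8 ≤ ε → ε ≤ 1 → 0 < δ →
      δ ≤ 1 → 0 < s →
      ‖kernelInt φ χ c⁻¹ s ℓ ε δ‖ ≤ C * (ε ^ 2 * δ * (s * (c * δ)) ^ (-(3 / 2) : ℝ)) := by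
  obtain ⟨C, hC, h⟩ := exists_diag_decay hφ hχd hχ (isCompact_paramBox 8 (1 / 8) 1)
    (F := fun z => 2 * z.2 2 /
      (√((z.1.2.1 * z.2 0) ^ 2 + (z.1.2.1 * z.2 1) ^ 2 + (z.1.2.2 * z.2 2 - z.1.1) ^ 2) +
       √((z.1.2.1 * z.2 0) ^ 2 + (z.1.2.1 * z.2 1) ^ 2 + (z.1.2.2 * z.2 2 + z.1.1) ^ 2)))
    (by
      rintro ⟨⟨c, ε, δ⟩, y⟩ ⟨⟨-, ⟨hε, -⟩, -⟩, ⟨h1, -⟩, -⟩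
      simp only at h1 hε
      have hp : 0 < (ε * y 0) ^ 2 + (ε * y 1) ^ 2 := by
        have : 0 < ε ^ 2 * (y 0 ^ 2 + y 1 ^ 2) := by positivity
        linarith
      have hp1 := add_pos_of_pos_of_nonneg hp (sq_nonneg (δ * y 2 - c))
      have hp2 := add_pos_of_pos_of_nonneg hp (sq_nonneg (δ * y 2 + c))
      have hs1 : ContDiffAt ℝ 6 (fun z : (ℝ × ℝ × ℝ) × E3 =>
          √((z.1.2.1 * z.2 0) ^ 2 + (z.1.2.1 * z.2 1) ^ 2 + (z.1.2.2 * z.2 2 - z.1.1) ^ 2))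
          ((c, ε, δ), y) := ContDiffAt.sqrt (by fun_prop) hp1.ne'
      have hs2 : ContDiffAt ℝ 6 (fun z : (ℝ × ℝ × ℝ) × E3 =>
          √((z.1.2.1 * z.2 0) ^ 2 + (z.1.2.1 * z.2 1) ^ 2 + (z.1.2.2 * z.2 2 + z.1.1) ^ 2))
          ((c, ε, δ), y) := ContDiffAt.sqrt (by fun_prop) hp2.ne'
      refine ContDiffAt.div (by fun_prop) (hs1.add hs2) ?_
      exact (add_pos (Real.sqrt_pos.mpr hp1) (Real.sqrt_pos.mpr hp2)).ne')
    (fun μ => μ.1⁻¹) (fun μ => μ.1 * μ.2.2) (fun _ => 12)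
    (S := {μ | μ ∈ paramBox 8 (1 / 8) 1 ∧ 0 < μ.1 ∧ 0 < μ.2.2}) (fun μ h => h.1)
    (by
      rintro ⟨c, ε, δ⟩ ⟨⟨-, ⟨hε, -⟩, -⟩, hc, hδ⟩
      simp only at hε hc hδ ⊢
      exact ⟨by linarith, hδ, by positivity, by positivity⟩)
    (by
      rintro ⟨c, ε, δ⟩ ⟨⟨-, ⟨hε, -⟩, -⟩, hc, hδ⟩
      refine ⟨0, 0, fun y hy => ?_⟩
      simp only at hy ⊢
      have hd := add_pos (d1_pos hy c⁻¹) (d2_pos hy c⁻¹)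
      rw [eq_div_of_mul_eq hd.ne' (Om_mul_add c⁻¹ _)]
      simp [d1, d2]
      ring)
    (d := (1 / 8) ^ 6 / 12 ^ 9) (by positivity)
    (by
      rintro ⟨c, ε, δ⟩ ⟨⟨⟨-, hc8⟩, ⟨hε, -⟩, -⟩, hc, hδ⟩ y -
      simp only [inv_inv] at hε hc hc8 hδ ⊢
      refine ⟨by linarith, ?_⟩
      calc (1 / 8 : ℝ) ^ 6 / 12 ^ 9 ≤ ε ^ 6 / 12 ^ 9 := by gcongr
        _ = _ := by field_simp)
  exact ⟨C, hC, fun c ε δ s ℓ hc hc8 hε hε1 hδ hδ1 hs => h (c, ε, δ)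
    ⟨⟨⟨hc.le, hc8⟩, ⟨hε, hε1⟩, hδ.le, hδ1⟩, hc, hδ⟩ s ℓ hs⟩

theorem half_sub_eq_of_sq {X z c D₁ D₂ : ℝ} (hX : 0 < X) (h1 : 0 < D₁) (h2 : 0 < D₂)
    (e1 : D₁ ^ 2 = X + (z - c) ^ 2) (e2 : D₂ ^ 2 = X + (z + c) ^ 2) :
    (D₂ - D₁) / 2 =
      c - c * (X * (1 + 2 * z / (D₁ + D₂)) / ((z - c + D₁) * (z + c + D₂))) := by
  have hZ1 : 0 < z - c + D₁ := by
    have := abs_lt_of_sq_lt_sq (by linarith : (z - c) ^ 2 < D₁ ^ 2) h1.le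
    linarith [(abs_lt.mp this).1]
  have hZ2 : 0 < z + c + D₂ := by
    have := abs_lt_of_sq_lt_sq (by linarith : (z + c) ^ 2 < D₂ ^ 2) h2.le
    linarith [(abs_lt.mp this).1]
  have h3 : c * (1 + 2 * z / (D₁ + D₂)) = ((z + c + D₂) - (z - c + D₁)) / 2 := by
    field_simp
    nlinarith
  have x1 : X / (z - c + D₁) = D₁ - (z - c) := by
    rw [div_eq_iff hZ1.ne']; linarith
  have x2 : X / (z + c + D₂) = D₂ - (z + c) := by
    rw [div_eq_iff hZ2.ne']; linarith
  calc (D₂ - D₁) / 2 = c - (X / (z - c + D₁) - X / (z + c + D₂)) / 2 := by rw [x1, x2]; ring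
    _ = c - X * (((z + c + D₂) - (z - c + D₁)) / 2) / ((z - c + D₁) * (z + c + D₂)) := by
        field_simp
    _ = _ := by rw [← h3]; ring

theorem exists_decay_of_width_le_of_focus_le (hφ : IsBump φ) (hχd : ContDiff ℝ 4 χ)
    (hχ : ∀ y, χ y ≠ 0 → 1 ≤ y ∧ y ≤ 4) :
    ∃ C : ℝ, 0 ≤ C ∧ ∀ c ε δ s : ℝ, ∀ ℓ : E3 →L[ℝ] ℝ, 0 < c → c ≤ 1 / 8 → 0 < ε → ε ≤ 1 / 8 →
      0 < δ → δ ≤ 1 → 0 < s →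
      ‖kernelInt φ χ c⁻¹ s ℓ ε δ‖ ≤ C * (ε ^ 2 * δ * (s * (c * ε ^ 2)) ^ (-(3 / 2) : ℝ)) := by
  obtain ⟨C, hC, h⟩ := exists_diag_decay hφ hχd hχ (isCompact_paramBox (1 / 8) 0 (1 / 8))
    (F := fun z => -((z.2 0 ^ 2 + z.2 1 ^ 2) * (1 + 2 * (z.1.2.2 * z.2 2) /
      (√((z.1.2.1 * z.2 0) ^ 2 + (z.1.2.1 * z.2 1) ^ 2 + (z.1.2.2 * z.2 2 - z.1.1) ^ 2) +
       √((z.1.2.1 * z.2 0) ^ 2 + (z.1.2.1 * z.2 1) ^ 2 + (z.1.2.2 * z.2 2 + z.1.1) ^ 2))) /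
      ((z.1.2.2 * z.2 2 - z.1.1 +
        √((z.1.2.1 * z.2 0) ^ 2 + (z.1.2.1 * z.2 1) ^ 2 + (z.1.2.2 * z.2 2 - z.1.1) ^ 2)) *
       (z.1.2.2 * z.2 2 + z.1.1 +
        √((z.1.2.1 * z.2 0) ^ 2 + (z.1.2.1 * z.2 1) ^ 2 + (z.1.2.2 * z.2 2 + z.1.1) ^ 2)))))
    (by
      rintro ⟨⟨c, ε, δ⟩, y⟩ ⟨⟨⟨hc0, hc⟩, ⟨hε0, hε⟩, hδ0, -⟩, ⟨h1, h2⟩, ⟨h3, -⟩, h4, -⟩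
      simp only at h1 h2 h3 h4 hε hε0 hc hc0 hδ0
      have hz : 1 / 2 ≤ δ * y 2 := by
        have h0 : 0 ≤ δ * y 2 := by positivity
        have : ε ^ 2 * (y 0 ^ 2 + y 1 ^ 2) ≤ (1 / 8) ^ 2 * 16 := by gcongr
        nlinarith
      have hp1 : 0 < (ε * y 0) ^ 2 + (ε * y 1) ^ 2 + (δ * y 2 - c) ^ 2 := by
        have : 0 < δ * y 2 - c := by linarith
        positivity
      have hp2 : 0 < (ε * y 0) ^ 2 + (ε * y 1) ^ 2 + (δ * y 2 + c) ^ 2 := by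
        have : 0 < δ * y 2 + c := by linarith
        positivity
      have hs1 : ContDiffAt ℝ 6 (fun z : (ℝ × ℝ × ℝ) × E3 =>
          √((z.1.2.1 * z.2 0) ^ 2 + (z.1.2.1 * z.2 1) ^ 2 + (z.1.2.2 * z.2 2 - z.1.1) ^ 2))
          ((c, ε, δ), y) := ContDiffAt.sqrt (by fun_prop) hp1.ne'
      have hs2 : ContDiffAt ℝ 6 (fun z : (ℝ × ℝ × ℝ) × E3 =>
          √((z.1.2.1 * z.2 0) ^ 2 + (z.1.2.1 * z.2 1) ^ 2 + (z.1.2.2 * z.2 2 + z.1.1) ^ 2))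
          ((c, ε, δ), y) := ContDiffAt.sqrt (by fun_prop) hp2.ne'
      have hq1 := Real.sqrt_pos.mpr hp1
      have hq2 := Real.sqrt_pos.mpr hp2
      refine (ContDiffAt.div (ContDiffAt.mul (by fun_prop) (contDiffAt_const.add
        (ContDiffAt.div (by fun_prop) (hs1.add hs2) ?_))) (ContDiffAt.mul
        (ContDiffAt.add (by fun_prop) hs1) (ContDiffAt.add (by fun_prop) hs2)) ?_).neg
      · exact (add_pos hq1 hq2).ne'
      · exact (mul_pos (add_pos (by simp only; linarith) hq1)
          (add_pos (by simp only; linarith) hq2)).ne')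
    (fun μ => μ.1⁻¹) (fun μ => μ.1 * μ.2.1 ^ 2) (fun _ => 5)
    (S := {μ | μ ∈ paramBox (1 / 8) 0 (1 / 8) ∧ 0 < μ.1 ∧ 0 < μ.2.1 ∧ 0 < μ.2.2}) (fun μ h => h.1)
    (by
      rintro ⟨c, ε, δ⟩ ⟨-, hc, hε, hδ⟩
      simp only at hε hc hδ ⊢
      exact ⟨hε, hδ, by positivity, by positivity⟩)
    (by
      rintro ⟨c, ε, δ⟩ ⟨-, hc, hε, hδ⟩
      refine ⟨0, c, fun y hy => ?_⟩
      simp only at hy hc hε hδ ⊢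
      have h1 := d1_pos hy c⁻¹
      have h2 := d2_pos hy c⁻¹
      have e1 := d1_sq c⁻¹ !₂[ε * y 0, ε * y 1, δ * y 2]
      have e2 := d2_sq c⁻¹ !₂[ε * y 0, ε * y 1, δ * y 2]
      have hn : 0 < nrmh !₂[ε * y 0, ε * y 1, δ * y 2] ^ 2 := by positivity
      rw [nrmh_sq] at hn
      have k1 : d1 c⁻¹ !₂[ε * y 0, ε * y 1, δ * y 2] =
        √((ε * y 0) ^ 2 + (ε * y 1) ^ 2 + (δ * y 2 - c) ^ 2) := by simp [d1]
      have k2 : d2 c⁻¹ !₂[ε * y 0, ε * y 1, δ * y 2] =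
        √((ε * y 0) ^ 2 + (ε * y 1) ^ 2 + (δ * y 2 + c) ^ 2) := by simp [d2]
      rw [Om, ← k1, ← k2]
      simp only [Matrix.cons_val_zero, Matrix.cons_val_one, Matrix.cons_val, inv_inv] at e1 e2 hn
      rw [half_sub_eq_of_sq hn h1 h2 e1 e2]
      simp
      ring)
    (d := (1 / 8) ^ 3 / 5 ^ 9) (by positivity)
    (by
      rintro ⟨c, ε, δ⟩ ⟨⟨⟨-, hc8⟩, -⟩, hc, hε, hδ⟩ y ⟨⟨⟨hc0, hc⟩, ⟨hε0, hε⟩, hδ0, -⟩, ⟨h1, h2⟩, ⟨h3, h5⟩, h4, -⟩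
      simp only [inv_inv] at *
      refine ⟨by linarith, ?_⟩
      have : 1 / 8 ≤ δ := by
        have : ε ^ 2 * (y 0 ^ 2 + y 1 ^ 2) ≤ (1 / 8) ^ 2 * 16 := by gcongr
        have : 1 / 2 ≤ δ * y 2 := by
          have h0 : 0 ≤ δ * y 2 := by positivity
          nlinarith
        nlinarith
      calc (1 / 8 : ℝ) ^ 3 / 5 ^ 9 ≤ δ ^ 3 / 5 ^ 9 := by gcongr
        _ = _ := by field_simp)
  exact ⟨C, hC, fun c ε δ s ℓ hc hc8 hε hε1 hδ hδ1 hs => h (c, ε, δ)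
    ⟨⟨⟨hc.le, hc8⟩, ⟨hε.le, hε1⟩, hδ.le, hδ1⟩, hc, hε, hδ⟩ s ℓ hs⟩

theorem exists_decay_of_focus_ge (hφ : IsBump φ) (hχd : ContDiff ℝ 4 χ)
    (hχ : ∀ y, χ y ≠ 0 → 1 ≤ y ∧ y ≤ 4) :
    ∃ C : ℝ, 0 ≤ C ∧ ∀ κ ε δ s : ℝ, ∀ ℓ : E3 →L[ℝ] ℝ, 0 < κ → κ ≤ 1 / 8 → 0 < ε → ε ≤ 1 →
      0 < δ → δ ≤ 1 → 0 < s →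
      ‖kernelInt φ χ κ s ℓ ε δ‖ ≤
        C * (ε ^ 2 * δ * (s * (κ ^ 2 * ε ^ 2 * δ)) ^ (-(3 / 2) : ℝ)) := by
  obtain ⟨C, hC, h⟩ := exists_diag_decay hφ hχd hχ (isCompact_paramBox (1 / 8) 0 1)
    (F := fun z => -((z.2 0 ^ 2 + z.2 1 ^ 2) * z.2 2 * (1 + 2 /
      (√((z.1.1 * (z.1.2.1 * z.2 0)) ^ 2 + (z.1.1 * (z.1.2.1 * z.2 1)) ^ 2 +
          (1 - z.1.1 * (z.1.2.2 * z.2 2)) ^ 2) +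
       √((z.1.1 * (z.1.2.1 * z.2 0)) ^ 2 + (z.1.1 * (z.1.2.1 * z.2 1)) ^ 2 +
          (1 + z.1.1 * (z.1.2.2 * z.2 2)) ^ 2))) /
      ((1 - z.1.1 * (z.1.2.2 * z.2 2) +
        √((z.1.1 * (z.1.2.1 * z.2 0)) ^ 2 + (z.1.1 * (z.1.2.1 * z.2 1)) ^ 2 +
          (1 - z.1.1 * (z.1.2.2 * z.2 2)) ^ 2)) *
       (1 + z.1.1 * (z.1.2.2 * z.2 2) +
        √((z.1.1 * (z.1.2.1 * z.2 0)) ^ 2 + (z.1.1 * (z.1.2.1 * z.2 1)) ^ 2 +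
          (1 + z.1.1 * (z.1.2.2 * z.2 2)) ^ 2)))))
    (by
      rintro ⟨⟨κ, ε, δ⟩, y⟩ ⟨⟨⟨hκ0, hκ⟩, -, hδ0, hδ⟩, -, ⟨h3, h4⟩, -⟩
      simp only at h3 h4 hκ hκ0 hδ hδ0
      have hz0 : 0 ≤ κ * (δ * y 2) := by positivity
      have hz : κ * (δ * y 2) ≤ 1 / 8 * (1 * 4) := by gcongr
      have hp1 : 0 < (κ * (ε * y 0)) ^ 2 + (κ * (ε * y 1)) ^ 2 + (1 - κ * (δ * y 2)) ^ 2 := by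
        have : 0 < 1 - κ * (δ * y 2) := by linarith
        positivity
      have hp2 : 0 < (κ * (ε * y 0)) ^ 2 + (κ * (ε * y 1)) ^ 2 + (1 + κ * (δ * y 2)) ^ 2 := by
        have : 0 < 1 + κ * (δ * y 2) := by linarith
        positivity
      have hs1 : ContDiffAt ℝ 6 (fun z : (ℝ × ℝ × ℝ) × E3 =>
          √((z.1.1 * (z.1.2.1 * z.2 0)) ^ 2 + (z.1.1 * (z.1.2.1 * z.2 1)) ^ 2 +
          (1 - z.1.1 * (z.1.2.2 * z.2 2)) ^ 2))
          ((κ, ε, δ), y) := ContDiffAt.sqrt (by fun_prop) hp1.ne'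
      have hs2 : ContDiffAt ℝ 6 (fun z : (ℝ × ℝ × ℝ) × E3 =>
          √((z.1.1 * (z.1.2.1 * z.2 0)) ^ 2 + (z.1.1 * (z.1.2.1 * z.2 1)) ^ 2 +
          (1 + z.1.1 * (z.1.2.2 * z.2 2)) ^ 2))
          ((κ, ε, δ), y) := ContDiffAt.sqrt (by fun_prop) hp2.ne'
      have hq1 := Real.sqrt_pos.mpr hp1
      have hq2 := Real.sqrt_pos.mpr hp2
      refine (ContDiffAt.div (ContDiffAt.mul (by fun_prop) (contDiffAt_const.add
        (ContDiffAt.div (by fun_prop) (hs1.add hs2) ?_))) (ContDiffAt.mul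
        (ContDiffAt.add (by fun_prop) hs1) (ContDiffAt.add (by fun_prop) hs2)) ?_).neg
      · exact (add_pos hq1 hq2).ne'
      · exact (mul_pos (add_pos (by simp only; linarith) hq1)
          (add_pos (by simp only; linarith) hq2)).ne')
    (fun μ => μ.1) (fun μ => μ.1 ^ 2 * μ.2.1 ^ 2 * μ.2.2) (fun μ => 2 / μ.1)
    (S := {μ | μ ∈ paramBox (1 / 8) 0 1 ∧ 0 < μ.1 ∧ 0 < μ.2.1 ∧ 0 < μ.2.2}) (fun μ h => h.1)
    (by
      rintro ⟨κ, ε, δ⟩ ⟨-, hκ, hε, hδ⟩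
      simp only at hε hκ hδ ⊢
      exact ⟨hε, hδ, hκ, by positivity⟩)
    (by
      rintro ⟨κ, ε, δ⟩ ⟨-, hκ, hε, hδ⟩
      refine ⟨δ • EuclideanSpace.proj 2, 0, fun y hy => ?_⟩
      simp only at hy hκ hε hδ ⊢
      have h1 := mul_pos hκ (d1_pos hy κ)
      have h2 := mul_pos hκ (d2_pos hy κ)
      have e1 : (κ * d1 κ !₂[ε * y 0, ε * y 1, δ * y 2]) ^ 2 =
          κ ^ 2 * ((ε * y 0) ^ 2 + (ε * y 1) ^ 2) + (1 - κ * (δ * y 2)) ^ 2 := by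
        rw [mul_pow, d1_sq]
        simp
        field_simp
        ring
      have e2 : (κ * d2 κ !₂[ε * y 0, ε * y 1, δ * y 2]) ^ 2 =
          κ ^ 2 * ((ε * y 0) ^ 2 + (ε * y 1) ^ 2) + (1 + κ * (δ * y 2)) ^ 2 := by
        rw [mul_pow, d2_sq]
        simp
        field_simp
        ring
      have hn : 0 < κ ^ 2 * nrmh !₂[ε * y 0, ε * y 1, δ * y 2] ^ 2 := by positivity
      rw [nrmh_sq] at hn
      simp only [Matrix.cons_val_zero, Matrix.cons_val_one] at hn
      have k1 : √((κ * (ε * y 0)) ^ 2 + (κ * (ε * y 1)) ^ 2 + (1 - κ * (δ * y 2)) ^ 2) =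
          κ * d1 κ !₂[ε * y 0, ε * y 1, δ * y 2] := by
        rw [← Real.sqrt_sq h1.le, e1]
        ring_nf
      have k2 : √((κ * (ε * y 0)) ^ 2 + (κ * (ε * y 1)) ^ 2 + (1 + κ * (δ * y 2)) ^ 2) =
          κ * d2 κ !₂[ε * y 0, ε * y 1, δ * y 2] := by
        rw [← Real.sqrt_sq h2.le, e2]
        ring_nf
      rw [k1, k2]
      have hkey := half_sub_eq_of_sq (z := 1) (c := κ * (δ * y 2)) hn h1 h2 e1 e2
      have hOm : Om κ !₂[ε * y 0, ε * y 1, δ * y 2] =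
          κ⁻¹ * ((κ * d2 κ !₂[ε * y 0, ε * y 1, δ * y 2] -
            κ * d1 κ !₂[ε * y 0, ε * y 1, δ * y 2]) / 2) := by
        rw [Om]; field_simp
      rw [hOm, hkey]
      simp only [smul_apply, PiLp.proj_apply, smul_eq_mul]
      field_simp
      ring)
    (d := (1 / 2) ^ 9) (by positivity)
    (by
      rintro ⟨κ, ε, δ⟩ ⟨⟨⟨-, hκ8⟩, -⟩, hκ, hε, hδ⟩ y -
      simp only at hκ8 hκ hε hδ ⊢
      constructor
      · rw [← one_div, le_div_iff₀ hκ, add_mul, one_div_mul_cancel hκ.ne']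
        linarith
      · exact le_of_eq (by field_simp))
  exact ⟨C, hC, fun κ ε δ s ℓ hκ hκ8 hε hε1 hδ hδ1 hs => h (κ, ε, δ)
    ⟨⟨⟨hκ.le, hκ8⟩, ⟨hε.le, hε1⟩, hδ.le, hδ1⟩, hκ, hε, hδ⟩ s ℓ hs⟩

end DiagonalFamilies

section Tubes

theorem norm_sq_eq_dot3 (x : E3) : ‖x‖ ^ 2 = dot3 x x := by
  rw [EuclideanSpace.norm_sq_eq, Fin.sum_univ_three, dot3]
  simp [sq]

theorem dot3_sq_le (x y : E3) : dot3 x y ^ 2 ≤ ‖x‖ ^ 2 * ‖y‖ ^ 2 := by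
  rw [norm_sq_eq_dot3, norm_sq_eq_dot3, dot3, dot3, dot3]
  nlinarith [sq_nonneg (x 0 * y 1 - x 1 * y 0), sq_nonneg (x 0 * y 2 - x 2 * y 0),
    sq_nonneg (x 1 * y 2 - x 2 * y 1)]

/-- The columns of the map scaling by `σ²` along the unit vector `u` and by `ε σ` orthogonally
to it. -/
def tubeCols (ε σ : ℝ) (u : E3) : Fin 3 → E3 :=
  fun j => EuclideanSpace.single j (ε * σ) + ((σ ^ 2 - ε * σ) * u j) • u

theorem colMap_tubeCols (ε σ : ℝ) (u x : E3) (k : Fin 3) :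
    colMap (tubeCols ε σ u) x k = ε * σ * x k + (σ ^ 2 - ε * σ) * dot3 u x * u k := by
  rw [colMap_apply, dot3]
  fin_cases k <;> simp [tubeCols] <;> ring

theorem det_tubeCols (ε σ : ℝ) {u : E3} (hu : ‖u‖ = 1) :
    (Matrix.of fun k i => tubeCols ε σ u i k).det = ε ^ 2 * σ ^ 4 := by
  have h : u 0 * u 0 + u 1 * u 1 + u 2 * u 2 = 1 := by
    rw [← dot3, ← norm_sq_eq_dot3, hu, one_pow]
  rw [Matrix.det_fin_three]
  simp [tubeCols]
  linear_combination (ε * σ) ^ 2 * (σ ^ 2 - ε * σ) * h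

theorem dot3_colMap_tubeCols (ε σ : ℝ) {u : E3} (hu : ‖u‖ = 1) (x : E3) :
    dot3 u (colMap (tubeCols ε σ u) x) = σ ^ 2 * dot3 u x := by
  have h : u 0 * u 0 + u 1 * u 1 + u 2 * u 2 = 1 := by
    rw [← dot3, ← norm_sq_eq_dot3, hu, one_pow]
  rw [dot3, colMap_tubeCols, colMap_tubeCols, colMap_tubeCols]
  have : dot3 u x = u 0 * x 0 + u 1 * x 1 + u 2 * x 2 := rfl
  linear_combination (σ ^ 2 - ε * σ) * dot3 u x * h - ε * σ * this

theorem norm_sq_colMap_tubeCols (ε σ : ℝ) {u : E3} (hu : ‖u‖ = 1) (x : E3) :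
    ‖colMap (tubeCols ε σ u) x‖ ^ 2 =
      σ ^ 4 * dot3 u x ^ 2 + ε ^ 2 * σ ^ 2 * (‖x‖ ^ 2 - dot3 u x ^ 2) := by
  have h : u 0 * u 0 + u 1 * u 1 + u 2 * u 2 = 1 := by
    rw [← dot3, ← norm_sq_eq_dot3, hu, one_pow]
  have this : dot3 u x = u 0 * x 0 + u 1 * x 1 + u 2 * x 2 := rfl
  have hx : dot3 x x = x 0 * x 0 + x 1 * x 1 + x 2 * x 2 := rfl
  rw [norm_sq_eq_dot3 (colMap _ _), norm_sq_eq_dot3 x, hx, dot3, colMap_tubeCols, colMap_tubeCols,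
    colMap_tubeCols]
  generalize dot3 u x = a at this ⊢
  linear_combination (σ ^ 2 - ε * σ) ^ 2 * a ^ 2 * h -
    2 * ε * σ * (σ ^ 2 - ε * σ) * a * this

/-- The square of the distance from `ζ` to `ω`, measured in units of `‖ζ‖` along `ζ` and of
`ε ‖ζ‖ ^ (1 / 2)` orthogonally to `ζ`. -/
def tubeDistSq (ε : ℝ) (ζ ω : E3) : ℝ :=
  dot3 ζ (ω - ζ) ^ 2 / ‖ζ‖ ^ 4 +
    (‖ζ‖ ^ 2 * ‖ω - ζ‖ ^ 2 - dot3 ζ (ω - ζ) ^ 2) / (ε ^ 2 * ‖ζ‖ ^ 3)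

/-- A smooth cutoff supported in `q ≤ 1 / 100`. -/
def tubeCutoff (q : ℝ) : ℝ := Real.smoothTransition (1 - 100 * q)

theorem contDiff_tubeCutoff {n : ℕ∞} : ContDiff ℝ n tubeCutoff :=
  Real.smoothTransition.contDiff.comp (by fun_prop)

theorem tubeCutoff_nonneg (q : ℝ) : 0 ≤ tubeCutoff q := Real.smoothTransition.nonneg _

theorem tubeCutoff_le_one (q : ℝ) : tubeCutoff q ≤ 1 := Real.smoothTransition.le_one _

theorem lt_of_tubeCutoff_ne_zero {q : ℝ} (h : tubeCutoff q ≠ 0) : q < 1 / 100 := by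
  by_contra! hq
  exact h (Real.smoothTransition.zero_of_nonpos (by linarith))

theorem integral_tubeCutoff_pos : 0 < ∫ y : E3, tubeCutoff (‖y‖ ^ 2) := by
  have hc : Continuous fun y : E3 => tubeCutoff (‖y‖ ^ 2) :=
    (contDiff_tubeCutoff (n := 0)).continuous.comp (by fun_prop)
  refine hc.integral_pos_of_hasCompactSupport_nonneg_nonzero ?_ (fun y => tubeCutoff_nonneg _)
    (x := 0) ?_
  · refine HasCompactSupport.intro (isCompact_closedBall (0 : E3) 1) fun y hy => ?_
    by_contra h
    have := lt_of_tubeCutoff_ne_zero h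
    rw [mem_closedBall_zero_iff, not_le] at hy
    nlinarith
  · simp [tubeCutoff]

theorem tubeDistSq_add_colMap {ε : ℝ} (hε : 0 < ε) {ζ : E3} (hζ : ζ ≠ 0) (y : E3) :
    tubeDistSq ε ζ (ζ + colMap (tubeCols ε (√‖ζ‖) (‖ζ‖⁻¹ • ζ)) y) = ‖y‖ ^ 2 := by
  have hn : 0 < ‖ζ‖ := norm_pos_iff.mpr hζ
  have hu : ‖‖ζ‖⁻¹ • ζ‖ = 1 := by
    rw [norm_smul, norm_inv, norm_norm, inv_mul_cancel₀ hn.ne']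
  have hσ : √‖ζ‖ ^ 2 = ‖ζ‖ := Real.sq_sqrt hn.le
  have hσ4 : √‖ζ‖ ^ 4 = ‖ζ‖ ^ 2 := by rw [show 4 = 2 * 2 from rfl, pow_mul, hσ]
  have h1 := dot3_colMap_tubeCols ε (√‖ζ‖) hu y
  have h2 := norm_sq_colMap_tubeCols ε (√‖ζ‖) hu y
  set v := colMap (tubeCols ε (√‖ζ‖) (‖ζ‖⁻¹ • ζ)) y
  set a := dot3 (‖ζ‖⁻¹ • ζ) y
  have h3 : dot3 ζ v = ‖ζ‖ * dot3 (‖ζ‖⁻¹ • ζ) v := by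
    simp only [dot3, PiLp.smul_apply, smul_eq_mul]
    field_simp
  rw [tubeDistSq, add_sub_cancel_left, h3, h1, h2, hσ, hσ4]
  field_simp
  ring

theorem integral_tubeCutoff_tubeDistSq {ε : ℝ} (hε : 0 < ε) {ζ : E3} (hζ : ζ ≠ 0) :
    ∫ ω, (tubeCutoff (tubeDistSq ε ζ ω) : ℂ) =
      ((ε ^ 2 * ‖ζ‖ ^ 2 * ∫ y : E3, tubeCutoff (‖y‖ ^ 2) : ℝ) : ℂ) := by
  have hn : 0 < ‖ζ‖ := norm_pos_iff.mpr hζ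
  have hu : ‖‖ζ‖⁻¹ • ζ‖ = 1 := by
    rw [norm_smul, norm_inv, norm_norm, inv_mul_cancel₀ hn.ne']
  have hσ4 : √‖ζ‖ ^ 4 = ‖ζ‖ ^ 2 := by
    rw [show 4 = 2 * 2 from rfl, pow_mul, Real.sq_sqrt hn.le]
  have hdet := det_tubeCols ε (√‖ζ‖) hu
  rw [hσ4] at hdet
  rw [integral_eq_abs_det_mul_integral_colMap (tubeCols ε (√‖ζ‖) (‖ζ‖⁻¹ • ζ))
    (by rw [hdet]; positivity) ζ, hdet, abs_of_pos (by positivity)]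
  simp_rw [tubeDistSq_add_colMap hε hζ]
  rw [integral_complex_ofReal]
  push_cast
  ring

/-- If `ζ` is not too close to the axis and `ω` lies in the tube around `ζ`, then `ω` is
comparable to `ζ`. -/
theorem comparable_of_tubeDistSq_lt {ε : ℝ} (hε : 0 < ε) {ζ ω : E3} (hζ : ε ^ 2 ≤ ‖ζ‖)
    (hq : tubeDistSq ε ζ ω < 1 / 100) :
    17 / 20 * ‖ζ‖ ≤ ‖ω‖ ∧ ‖ω‖ ≤ 23 / 20 * ‖ζ‖ ∧
      ∀ i, |ω i| ≤ 11 / 10 * |ζ i| + ε * √‖ζ‖ / 10 := by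
  have hn : 0 < ‖ζ‖ := lt_of_lt_of_le (by positivity) hζ
  set v := ω - ζ with hv
  set b := dot3 ζ v with hb
  have hcs := dot3_sq_le ζ v
  rw [tubeDistSq, ← hv, ← hb] at hq
  have q1 : b ^ 2 / ‖ζ‖ ^ 4 < 1 / 100 :=
    lt_of_le_of_lt (le_add_of_nonneg_right (div_nonneg (by linarith) (by positivity))) hq
  have q2 : (‖ζ‖ ^ 2 * ‖v‖ ^ 2 - b ^ 2) / (ε ^ 2 * ‖ζ‖ ^ 3) < 1 / 100 :=
    lt_of_le_of_lt (le_add_of_nonneg_left (by positivity)) hq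
  rw [div_lt_iff₀ (by positivity)] at q1 q2
  have hvn : ‖v‖ ≤ 3 / 20 * ‖ζ‖ := by
    refine abs_le_of_sq_le_sq' ?_ (by positivity) |>.2
    have h1 : ε ^ 2 * ‖ζ‖ ^ 3 ≤ ‖ζ‖ * ‖ζ‖ ^ 3 := by gcongr
    have h2 : ‖ζ‖ ^ 2 * ‖v‖ ^ 2 ≤ ‖ζ‖ ^ 2 * (3 / 20 * ‖ζ‖) ^ 2 := by
      nlinarith [pow_pos hn 4]
    exact le_of_mul_le_mul_left h2 (by positivity)
  have hω : ω = ζ + v := by rw [hv]; abel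
  refine ⟨?_, ?_, fun i => ?_⟩
  · have : ‖ζ‖ ≤ ‖ω‖ + ‖v‖ := by
      rw [hv, ← norm_neg (ω - ζ)]
      refine le_trans (le_of_eq ?_) (norm_add_le _ _)
      congr 1
      abel
    linarith
  · rw [hω]
    exact (norm_add_le _ _).trans (by linarith)
  · set m := b / ‖ζ‖ ^ 2
    have hm : |m| ≤ 1 / 10 := by
      refine abs_le_of_sq_le_sq ?_ (by norm_num)
      rw [div_pow, div_le_iff₀ (by positivity)]
      linarith
    have hw2 : ‖v - m • ζ‖ ^ 2 = ‖v‖ ^ 2 - b ^ 2 / ‖ζ‖ ^ 2 := by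
      have e1 : ‖v - m • ζ‖ ^ 2 = ‖v‖ ^ 2 - 2 * m * b + m ^ 2 * ‖ζ‖ ^ 2 := by
        rw [norm_sq_eq_dot3, norm_sq_eq_dot3, norm_sq_eq_dot3, hb]
        simp only [dot3, PiLp.sub_apply, PiLp.smul_apply, smul_eq_mul]
        ring
      rw [e1]
      simp only [m]
      field_simp
      ring
    have hw : ‖v - m • ζ‖ ≤ ε * √‖ζ‖ / 10 := by
      refine abs_le_of_sq_le_sq' ?_ (by positivity) |>.2
      rw [hw2, div_pow, mul_pow, Real.sq_sqrt hn.le]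
      refine le_of_mul_le_mul_left (a := ‖ζ‖ ^ 2) ?_ (by positivity)
      rw [mul_sub, mul_div_cancel₀ _ (by positivity)]
      linarith
    have hi : ω i = (1 + m) * ζ i + (v - m • ζ) i := by
      rw [hω]
      simp only [PiLp.add_apply, PiLp.sub_apply, PiLp.smul_apply, smul_eq_mul]
      ring
    have hcoord : |(v - m • ζ) i| ≤ ‖v - m • ζ‖ := PiLp.norm_apply_le (v - m • ζ) i
    rw [hi]
    have h1m : |1 + m| ≤ 11 / 10 := by
      have := abs_le.mp hm
      exact abs_le.mpr ⟨by linarith, by linarith⟩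
    calc |(1 + m) * ζ i + (v - m • ζ) i| ≤ |1 + m| * |ζ i| + |(v - m • ζ) i| := by
          rw [← abs_mul]; exact abs_add_le _ _
      _ ≤ 11 / 10 * |ζ i| + ε * √‖ζ‖ / 10 := by
          gcongr
          exact hcoord.trans hw

end Tubes

section TubeCoordinates

/-- Parameters of a tube: the numbers `(c, ε, σ, γ, δ⁻¹, w₀, w₁)` and the unit vector `u` pointing
from the focus to the centre of the tube. -/
abbrev TubeParam : Type := (Fin 7 → ℝ) × E3

/-- A compact set of tube parameters. -/
def tubeBox : Set TubeParam :=
  Set.Icc ![1 / 8, 0, 0, 0, 1, -6, -6] ![8, 1 / 8, 4, 1, 8, 6, 6] ×ˢ Metric.sphere 0 1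

theorem isCompact_tubeBox : IsCompact tubeBox := isCompact_Icc.prod (isCompact_sphere _ _)

/-- The longitudinal coordinate. -/
def tubeLong (z : TubeParam × E3) : ℝ := 1 + dot3 z.1.2 z.2

/-- The square of the transversal coordinate. -/
def tubeTrans (z : TubeParam × E3) : ℝ := dot3 z.2 z.2 - dot3 z.1.2 z.2 ^ 2

/-- The square of the distance to the focus, relative to the centre of the tube. -/
def tubeRadSq (z : TubeParam × E3) : ℝ := tubeLong z ^ 2 + z.1.1 3 * tubeTrans z

/-- The height above the opposite focus. -/
def tubeHeight (z : TubeParam × E3) : ℝ :=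
  2 * z.1.1 0 + z.1.1 2 ^ 2 * tubeLong z * z.1.2 2 +
    z.1.1 1 * z.1.1 2 * (z.2 2 - dot3 z.1.2 z.2 * z.1.2 2)

/-- The square of the distance to the axis, in units of `ε`. -/
def tubeHorSq (z : TubeParam × E3) : ℝ :=
  (tubeLong z * z.1.1 5 + z.1.1 2 * (z.2 0 - dot3 z.1.2 z.2 * z.1.2 0)) ^ 2 +
    (tubeLong z * z.1.1 6 + z.1.1 2 * (z.2 1 - dot3 z.1.2 z.2 * z.1.2 1)) ^ 2

/-- The squared norm. -/
def tubeNormSq (z : TubeParam × E3) : ℝ :=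
  z.1.1 1 ^ 2 * tubeHorSq z + (tubeHeight z - z.1.1 0) ^ 2

/-- The rescaled phase, up to an affine function. -/
def tubePhase (z : TubeParam × E3) : ℝ :=
  (tubeHorSq z / (tubeHeight z + √(tubeHeight z ^ 2 + z.1.1 1 ^ 2 * tubeHorSq z)) -
    tubeTrans z / (tubeLong z + √(tubeRadSq z))) / 2

/-- The rescaled amplitude. -/
def tubeAmp (φ χ : ℝ → ℝ) (z : TubeParam × E3) : ℝ :=
  φ (√(tubeNormSq z)) * φ (√(tubeHorSq z)) * χ (z.1.1 4 * (tubeHeight z - z.1.1 0)) *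
    ((tubeRadSq z)⁻¹ * tubeCutoff
      ((dot3 z.1.2 z.2 * tubeLong z + z.1.1 3 * tubeTrans z) ^ 2 / tubeRadSq z ^ 2 +
        tubeTrans z / (tubeRadSq z * √(tubeRadSq z))))

/-- A set containing the support of `tubeAmp`. -/
def tubeSet : Set (TubeParam × E3) :=
  {z | z.1 ∈ tubeBox ∧ ‖z.2‖ ≤ 1 ∧ 1 / 2 ≤ tubeLong z ∧ 1 ≤ tubeHorSq z ∧ tubeNormSq z ≤ 16 ∧
    1 / 16 ≤ tubeHeight z - z.1.1 0}

theorem contDiff_dot3_snd {n : WithTop ℕ∞} :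
    ContDiff ℝ n fun z : TubeParam × E3 => dot3 z.1.2 z.2 := by
  unfold dot3; fun_prop

theorem contDiff_tubeLong {n : WithTop ℕ∞} : ContDiff ℝ n tubeLong :=
  contDiff_const.add contDiff_dot3_snd

theorem contDiff_tubeTrans {n : WithTop ℕ∞} : ContDiff ℝ n tubeTrans := by
  refine ContDiff.sub ?_ (contDiff_dot3_snd.pow 2)
  unfold dot3; fun_prop

theorem contDiff_tubeRadSq {n : WithTop ℕ∞} : ContDiff ℝ n tubeRadSq :=
  (contDiff_tubeLong.pow 2).add (ContDiff.mul (by fun_prop) contDiff_tubeTrans)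

theorem contDiff_tubeHeight {n : WithTop ℕ∞} : ContDiff ℝ n tubeHeight := by
  have h1 := contDiff_tubeLong (n := n)
  have h2 := contDiff_dot3_snd (n := n)
  unfold tubeHeight; fun_prop

theorem contDiff_tubeHorSq {n : WithTop ℕ∞} : ContDiff ℝ n tubeHorSq := by
  have h1 := contDiff_tubeLong (n := n)
  have h2 := contDiff_dot3_snd (n := n)
  unfold tubeHorSq; fun_prop

theorem contDiff_tubeNormSq {n : WithTop ℕ∞} : ContDiff ℝ n tubeNormSq := by
  have h1 := contDiff_tubeHorSq (n := n)
  have h2 := contDiff_tubeHeight (n := n)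
  unfold tubeNormSq; fun_prop

theorem isCompact_tubeSet : IsCompact tubeSet := by
  refine (isCompact_tubeBox.prod (isCompact_closedBall (0 : E3) 1)).of_isClosed_subset ?_
    fun z hz => ⟨hz.1, mem_closedBall_zero_iff.mpr hz.2.1⟩
  have hB : IsClosed {z : TubeParam × E3 | z.1 ∈ tubeBox} :=
    isCompact_tubeBox.isClosed.preimage continuous_fst
  have h1 := (contDiff_tubeLong (n := 0)).continuous
  have h2 := (contDiff_tubeHorSq (n := 0)).continuous
  have h3 := (contDiff_tubeNormSq (n := 0)).continuous
  have h4 := (contDiff_tubeHeight (n := 0)).continuous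
  simp only [tubeSet, Set.ofPred_and]
  refine hB.inter (IsClosed.inter ?_ (IsClosed.inter ?_ (IsClosed.inter ?_
    (IsClosed.inter ?_ ?_)))) <;> refine isClosed_le ?_ ?_ <;> fun_prop

theorem tubeTrans_nonneg {z : TubeParam × E3} (hz : z.1 ∈ tubeBox) : 0 ≤ tubeTrans z := by
  have hu : ‖z.1.2‖ = 1 := mem_sphere_zero_iff_norm.mp hz.2
  have := dot3_sq_le z.1.2 z.2
  rw [hu, norm_sq_eq_dot3 z.2] at this
  rw [tubeTrans]
  linarith

theorem mem_tubeBox_iff {p : TubeParam} : p ∈ tubeBox ↔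
    (((1 / 8 ≤ p.1 0 ∧ p.1 0 ≤ 8) ∧ (0 ≤ p.1 1 ∧ p.1 1 ≤ 1 / 8) ∧ (0 ≤ p.1 2 ∧ p.1 2 ≤ 4) ∧
      (0 ≤ p.1 3 ∧ p.1 3 ≤ 1) ∧ (1 ≤ p.1 4 ∧ p.1 4 ≤ 8) ∧ (-6 ≤ p.1 5 ∧ p.1 5 ≤ 6) ∧
      (-6 ≤ p.1 6 ∧ p.1 6 ≤ 6)) ∧ ‖p.2‖ = 1) := by
  simp only [tubeBox, Set.mem_prod, Set.mem_Icc, Pi.le_def, Fin.forall_fin_succ,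
    mem_sphere_zero_iff_norm]
  simp
  tauto

theorem tubeRadSq_pos {z : TubeParam × E3} (hz : z.1 ∈ tubeBox) (h : 0 < tubeLong z) :
    0 < tubeRadSq z := by
  have := tubeTrans_nonneg hz
  have := (mem_tubeBox_iff.mp hz).1.2.2.2.1.1
  rw [tubeRadSq]
  positivity

theorem contDiffAt_tubePhase {z : TubeParam × E3} (hz : z ∈ tubeSet) {n : WithTop ℕ∞} :
    ContDiffAt ℝ n tubePhase z := by
  obtain ⟨h1, -, h2, h3, -, h4⟩ := hz
  have hL : 0 < tubeLong z := by linarith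
  have hR := tubeRadSq_pos h1 hL
  have hZ : 0 < tubeHeight z := by linarith [(mem_tubeBox_iff.mp h1).1.1.1]
  have hD : 0 < tubeHeight z ^ 2 + z.1.1 1 ^ 2 * tubeHorSq z := by positivity
  have c1 := (contDiff_tubeLong (n := n)).contDiffAt (x := z)
  have c2 := (contDiff_tubeTrans (n := n)).contDiffAt (x := z)
  have c3 := (contDiff_tubeRadSq (n := n)).contDiffAt (x := z)
  have c4 := (contDiff_tubeHeight (n := n)).contDiffAt (x := z)
  have c5 := (contDiff_tubeHorSq (n := n)).contDiffAt (x := z)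
  refine ContDiffAt.div_const (ContDiffAt.sub (c5.div (c4.add (ContDiffAt.sqrt ?_ hD.ne')) ?_)
    (c2.div (c1.add (c3.sqrt hR.ne')) ?_)) 2
  · exact (c4.pow 2).add (ContDiffAt.mul (by fun_prop) c5)
  · positivity
  · positivity

theorem contDiffAt_tubeAmp {φ χ : ℝ → ℝ} (hφ : IsBump φ) (hχ : ContDiff ℝ 4 χ)
    {z : TubeParam × E3} (hz : z ∈ tubeSet) : ContDiffAt ℝ 4 (tubeAmp φ χ) z := by
  obtain ⟨h1, -, h2, h3, -, h4⟩ := hz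
  have hL : 0 < tubeLong z := by linarith
  have hR := tubeRadSq_pos h1 hL
  have hN : 0 < tubeNormSq z := by
    rw [tubeNormSq]
    have : 0 < tubeHeight z - z.1.1 0 := by linarith
    positivity
  have c1 := (contDiff_tubeLong (n := 4)).contDiffAt (x := z)
  have c2 := (contDiff_tubeTrans (n := 4)).contDiffAt (x := z)
  have c3 := (contDiff_tubeRadSq (n := 4)).contDiffAt (x := z)
  have c4 := (contDiff_tubeHeight (n := 4)).contDiffAt (x := z)
  have c5 := (contDiff_tubeHorSq (n := 4)).contDiffAt (x := z)
  have c6 := (contDiff_tubeNormSq (n := 4)).contDiffAt (x := z)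
  have c7 := (contDiff_dot3_snd (n := 4)).contDiffAt (x := z)
  refine ContDiffAt.mul (ContDiffAt.mul (ContDiffAt.mul ?_ ?_) ?_) (ContDiffAt.mul ?_ ?_)
  · exact hφ.contDiff.contDiffAt.comp z (c6.sqrt hN.ne')
  · exact hφ.contDiff.contDiffAt.comp z (c5.sqrt (by linarith))
  · exact hχ.contDiffAt.comp z (ContDiffAt.mul (by fun_prop) (c4.sub (by fun_prop)))
  · exact c3.inv hR.ne'
  · refine (contDiff_tubeCutoff (n := 4)).contDiffAt.comp z (ContDiffAt.add (ContDiffAt.div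
      (((c7.mul c1).add (ContDiffAt.mul (by fun_prop) c2)).pow 2) (c3.pow 2) (by positivity))
      (c2.div (c3.mul (c3.sqrt hR.ne')) (by positivity)))

theorem tube_bounds {L T R γ : ℝ} (hγ : 0 ≤ γ) (hγ1 : γ ≤ 1) (hT : 0 ≤ T)
    (hR : R = L ^ 2 + γ * T) (hR0 : 0 < R)
    (hq : ((L - 1) * L + γ * T) ^ 2 / R ^ 2 + T / (R * √R) < 1 / 100) :
    1 / 2 ≤ L ∧ T + (L - 1) ^ 2 ≤ 1 := by
  have hs : 0 < √R := Real.sqrt_pos.mpr hR0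
  have hs2 : √R ^ 2 = R := Real.sq_sqrt hR0.le
  set X := ((L - 1) * L + γ * T) / R with hX
  have q1 : X ^ 2 < 1 / 100 := by
    rw [hX, div_pow]
    exact lt_of_le_of_lt (le_add_of_nonneg_right (by positivity)) hq
  have q2 : T / (R * √R) < 1 / 100 := lt_of_le_of_lt (le_add_of_nonneg_left (by positivity)) hq
  rw [div_lt_iff₀ (by positivity)] at q2
  have hXb := abs_lt.mp (abs_lt_of_sq_lt_sq (by linarith : X ^ 2 < (1 / 10) ^ 2) (by norm_num))
  have hL : L = R * (1 - X) := by
    rw [hX]; field_simp; rw [hR]; ring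
  have hL0 : 0 < L := by rw [hL]; exact mul_pos hR0 (by linarith)
  have hRle : R ≤ 100 / 81 := by
    have : R * (81 / 100) ≤ 1 := by
      have h1 : R ^ 2 * (81 / 100) ≤ R := by
        calc R ^ 2 * (81 / 100) ≤ R ^ 2 * (1 - X) ^ 2 := by gcongr; nlinarith
          _ = L ^ 2 := by rw [← mul_pow, ← hL]
          _ ≤ R := by rw [hR]; nlinarith [mul_nonneg hγ hT]
      nlinarith
    linarith
  have hsle : √R ≤ 10 / 9 := by
    rw [Real.sqrt_le_left (by norm_num)]
    linarith
  have hTle : T ≤ R * (1 / 50) := by nlinarith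
  have hRge : 4 / 5 ≤ R := by
    have h1 : R ≤ R ^ 2 * (121 / 100) + R * (1 / 50) := by
      have : L ^ 2 ≤ R ^ 2 * (121 / 100) := by
        rw [hL, mul_pow]
        gcongr
        nlinarith
      have : γ * T ≤ 1 * (R * (1 / 50)) := by gcongr
      linarith
    nlinarith
  have l1 : L ≤ R * (11 / 10) := by rw [hL]; gcongr; linarith
  have l2 : R * (9 / 10) ≤ L := by rw [hL]; gcongr; linarith
  exact ⟨by linarith, by nlinarith⟩

theorem mem_tubeSet_of_tubeAmp_ne_zero {φ χ : ℝ → ℝ} (hφ : IsBump φ)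
    (hχ : ∀ y, χ y ≠ 0 → 1 ≤ y ∧ y ≤ 4) {z : TubeParam × E3} (hz : z.1 ∈ tubeBox)
    (h : tubeAmp φ χ z ≠ 0) : z ∈ tubeSet := by
  simp only [tubeAmp, ne_eq, mul_eq_zero, not_or, inv_eq_zero] at h
  obtain ⟨⟨⟨hN, hH⟩, hh⟩, hR, hq⟩ := h
  obtain ⟨⟨-, -, -, ⟨hγ0, hγ1⟩, ⟨he1, he8⟩, -, -⟩, hu⟩ := mem_tubeBox_iff.mp hz
  have hT := tubeTrans_nonneg hz
  have hR0 : 0 < tubeRadSq z := lt_of_le_of_ne (by rw [tubeRadSq]; positivity) (Ne.symm hR)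
  have hL : dot3 z.1.2 z.2 = tubeLong z - 1 := by rw [tubeLong]; ring
  have hq' := lt_of_tubeCutoff_ne_zero hq
  rw [hL] at hq'
  obtain ⟨b1, b2⟩ := tube_bounds hγ0 hγ1 hT rfl hR0 hq'
  obtain ⟨n1, n2⟩ := (one_le_sqrt_and_le_four _).mp (hφ.supp _ hN)
  obtain ⟨m1, m2⟩ := (one_le_sqrt_and_le_four _).mp (hφ.supp _ hH)
  obtain ⟨k1, -⟩ := hχ _ hh
  refine ⟨hz, ?_, b1, m1, n2, ?_⟩
  · refine abs_le_of_sq_le_sq' ?_ zero_le_one |>.2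
    rw [norm_sq_eq_dot3]
    rw [tubeTrans, hL] at b2
    linarith
  · by_contra! hlt
    nlinarith

end TubeCoordinates

section TubeDecay

/-- The parameters of a tube are in the compact range and satisfy the compatibility relations. -/
structure IsTube (p : TubeParam) : Prop where
  mem : p ∈ tubeBox
  eps_pos : 0 < p.1 1
  sigma_pos : 0 < p.1 2
  gamma_eq : p.1 3 * p.1 2 ^ 2 = p.1 1 ^ 2
  hor_zero : p.1 1 * p.1 5 = p.1 2 ^ 2 * p.2 0
  hor_one : p.1 1 * p.1 6 = p.1 2 ^ 2 * p.2 1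

/-- The parametrization of a tube, relative to the focus. -/
def tubePoint (p : TubeParam) (x : E3) : E3 :=
  p.1 2 ^ 2 • p.2 + colMap (tubeCols (p.1 1) (p.1 2) p.2) x

variable {p : TubeParam}

theorem tubePoint_apply (p : TubeParam) (x : E3) (i : Fin 3) :
    tubePoint p x i = p.1 2 ^ 2 * tubeLong (p, x) * p.2 i +
      p.1 1 * p.1 2 * (x i - dot3 p.2 x * p.2 i) := by
  rw [tubePoint, PiLp.add_apply, colMap_tubeCols, PiLp.smul_apply, smul_eq_mul, tubeLong]
  ring

namespace IsTube

theorem norm_eq_one (h : IsTube p) : ‖p.2‖ = 1 := (mem_tubeBox_iff.mp h.mem).2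

theorem focus_pos (h : IsTube p) : 0 < p.1 0 :=
  lt_of_lt_of_le (by norm_num) (mem_tubeBox_iff.mp h.mem).1.1.1

theorem nrmh_sq (h : IsTube p) (x : E3) :
    nrmh (focus (p.1 0) + tubePoint p x) ^ 2 = p.1 1 ^ 2 * tubeHorSq (p, x) := by
  have h0 := h.hor_zero
  have h1 := h.hor_one
  have e0 : (focus (p.1 0) + tubePoint p x) 0 = p.1 1 * (tubeLong (p, x) * p.1 5 +
      p.1 2 * (x 0 - dot3 p.2 x * p.2 0)) := by
    rw [PiLp.add_apply, tubePoint_apply]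
    simp only [focus, Matrix.cons_val_zero]
    linear_combination -tubeLong (p, x) * h0
  have e1 : (focus (p.1 0) + tubePoint p x) 1 = p.1 1 * (tubeLong (p, x) * p.1 6 +
      p.1 2 * (x 1 - dot3 p.2 x * p.2 1)) := by
    rw [PiLp.add_apply, tubePoint_apply]
    simp only [focus, Matrix.cons_val_one, Matrix.cons_val_zero]
    linear_combination -tubeLong (p, x) * h1
  rw [_root_.nrmh_sq, e0, e1, tubeHorSq]
  ring

theorem apply_two (p : TubeParam) (x : E3) :
    (focus (p.1 0) + tubePoint p x) 2 = tubeHeight (p, x) - p.1 0 := by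
  rw [PiLp.add_apply, tubePoint_apply, tubeHeight]
  simp [focus]
  ring

theorem norm_sq (h : IsTube p) (x : E3) :
    ‖focus (p.1 0) + tubePoint p x‖ ^ 2 = tubeNormSq (p, x) := by
  rw [tubeNormSq, ← h.nrmh_sq, _root_.nrmh_sq, ← apply_two, norm_sq_eq_dot3, dot3]
  ring

theorem norm_sq_tubePoint (h : IsTube p) (x : E3) :
    ‖tubePoint p x‖ ^ 2 = p.1 2 ^ 4 * tubeRadSq (p, x) := by
  have h1 := dot3_colMap_tubeCols (p.1 1) (p.1 2) h.norm_eq_one x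
  have h2 := norm_sq_colMap_tubeCols (p.1 1) (p.1 2) h.norm_eq_one x
  have h3 : ‖tubePoint p x‖ ^ 2 = p.1 2 ^ 4 * ‖p.2‖ ^ 2 + 2 * p.1 2 ^ 2 *
      dot3 p.2 (colMap (tubeCols (p.1 1) (p.1 2) p.2) x) +
      ‖colMap (tubeCols (p.1 1) (p.1 2) p.2) x‖ ^ 2 := by
    rw [tubePoint, norm_sq_eq_dot3, norm_sq_eq_dot3, norm_sq_eq_dot3]
    simp only [dot3, PiLp.add_apply, PiLp.smul_apply, smul_eq_mul]
    ring
  rw [h3, h1, h2, h.norm_eq_one, tubeRadSq, tubeLong, tubeTrans, norm_sq_eq_dot3]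
  linear_combination -p.1 2 ^ 2 * (dot3 x x - dot3 p.2 x ^ 2) * h.gamma_eq

theorem norm_tubePoint (h : IsTube p) (x : E3) :
    ‖tubePoint p x‖ = p.1 2 ^ 2 * √(tubeRadSq (p, x)) := by
  rw [← Real.sqrt_sq (norm_nonneg _), h.norm_sq_tubePoint, Real.sqrt_mul (by positivity),
    show 4 = 2 * 2 from rfl, pow_mul, Real.sqrt_sq (by positivity)]

theorem d1_eq (h : IsTube p) (x : E3) :
    d1 (p.1 0)⁻¹ (focus (p.1 0) + tubePoint p x) = p.1 2 ^ 2 * √(tubeRadSq (p, x)) := by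
  rw [d1_eq_norm, inv_inv, add_sub_cancel_left, h.norm_tubePoint]

theorem d2_eq (h : IsTube p) (x : E3) :
    d2 (p.1 0)⁻¹ (focus (p.1 0) + tubePoint p x) =
      √(tubeHeight (p, x) ^ 2 + p.1 1 ^ 2 * tubeHorSq (p, x)) := by
  rw [← Real.sqrt_sq (d2_nonneg _ _), d2_sq, ← _root_.nrmh_sq, h.nrmh_sq, apply_two, inv_inv]
  congr 1
  ring

end IsTube

theorem sqrt_sq_add_eq {a t : ℝ} (ha : 0 < a) (ht : 0 ≤ t) :
    √(a ^ 2 + t) = a + t / (a + √(a ^ 2 + t)) := by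
  have h := Real.sq_sqrt (by positivity : 0 ≤ a ^ 2 + t)
  have : 0 < a + √(a ^ 2 + t) := by positivity
  field_simp
  linarith

theorem IsTube.Om_eq (h : IsTube p) {x : E3} (hL : 0 < tubeLong (p, x))
    (hZ : 0 < tubeHeight (p, x)) :
    Om (p.1 0)⁻¹ (focus (p.1 0) + tubePoint p x) = p.1 1 ^ 2 * tubePhase (p, x) +
      (tubeHeight (p, x) - p.1 2 ^ 2 * tubeLong (p, x)) / 2 := by
  have hT := tubeTrans_nonneg (z := (p, x)) h.mem
  have hγ := (mem_tubeBox_iff.mp h.mem).1.2.2.2.1.1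
  have hH : 0 ≤ tubeHorSq (p, x) := by rw [tubeHorSq]; positivity
  have e1 : √(tubeRadSq (p, x)) = tubeLong (p, x) + p.1 3 * tubeTrans (p, x) /
      (tubeLong (p, x) + √(tubeRadSq (p, x))) := sqrt_sq_add_eq hL (mul_nonneg hγ hT)
  have e2 := sqrt_sq_add_eq hZ (mul_nonneg (sq_nonneg (p.1 1)) hH)
  rw [Om, h.d1_eq, h.d2_eq, tubePhase]
  simp only
  generalize √(tubeRadSq (p, x)) = a at e1 ⊢
  generalize √(tubeHeight (p, x) ^ 2 + p.1 1 ^ 2 * tubeHorSq (p, x)) = b at e2 ⊢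
  have hg := h.gamma_eq
  calc (b - p.1 2 ^ 2 * a) / 2 = (tubeHeight (p, x) + p.1 1 ^ 2 * tubeHorSq (p, x) /
        (tubeHeight (p, x) + b) - p.1 2 ^ 2 * (tubeLong (p, x) + p.1 3 * tubeTrans (p, x) /
        (tubeLong (p, x) + a))) / 2 := by rw [← e1, ← e2]
    _ = _ := by
        linear_combination -(tubeTrans (p, x) / (tubeLong (p, x) + a)) / 2 * hg

theorem IsTube.det_lower_bound (h : IsTube p) {x : E3} (hx : (p, x) ∈ tubeSet) :
    0 < nrmh (focus (p.1 0) + tubePoint p x) ∧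
    (1 / 8) ^ 2 * (2 * (1 / 8) * (1 / 16) / 32) / (25 * 12 ^ 4) ≤
      (p.1 1 ^ 2)⁻¹ ^ 3 * (p.1 1 ^ 2 * p.1 2 ^ 4) ^ 2 *
        ((p.1 0)⁻¹⁻¹ ^ 2 * nrmh (focus (p.1 0) + tubePoint p x) ^ 2 *
          Om (p.1 0)⁻¹ (focus (p.1 0) + tubePoint p x) /
          (d1 (p.1 0)⁻¹ (focus (p.1 0) + tubePoint p x) *
            d2 (p.1 0)⁻¹ (focus (p.1 0) + tubePoint p x)) ^ 4) := by
  obtain ⟨-, hx1, hL, hH, hN, hz⟩ := hx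
  simp only at hx1 hz
  have hε := h.eps_pos
  have hσ := h.sigma_pos
  obtain ⟨⟨⟨hc, hc8⟩, -, ⟨-, hσ4⟩, ⟨hγ0, hγ1⟩, -⟩, hu⟩ := mem_tubeBox_iff.mp h.mem
  set η := focus (p.1 0) + tubePoint p x with hη
  have hn2 : nrmh η ^ 2 = p.1 1 ^ 2 * tubeHorSq (p, x) := h.nrmh_sq x
  have hn : 0 < nrmh η := by
    have : 0 < nrmh η ^ 2 := by rw [hn2]; positivity
    exact (nrmh_nonneg η).lt_of_ne' fun h => by simp [h] at this
  refine ⟨hn, ?_⟩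
  have hd1 := d1_pos hn (p.1 0)⁻¹
  have hd2 := d2_pos hn (p.1 0)⁻¹
  have hηn : ‖η‖ ≤ 4 := by
    refine abs_le_of_sq_le_sq' ?_ (by norm_num) |>.2
    rw [h.norm_sq]; linarith
  have hci : |(p.1 0)⁻¹⁻¹| = p.1 0 := by rw [inv_inv, abs_of_pos h.focus_pos]
  have b1 : d1 (p.1 0)⁻¹ η ≤ 12 := (d1_le _ η).trans (by rw [hci]; linarith)
  have b2 : d2 (p.1 0)⁻¹ η ≤ 12 := (d2_le _ η).trans (by rw [hci]; linarith)
  have hR : 0 < tubeRadSq (p, x) := tubeRadSq_pos h.mem (by linarith)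
  have hR5 : tubeRadSq (p, x) ≤ 5 := by
    have hT := tubeTrans_nonneg (z := (p, x)) h.mem
    have hxx : dot3 x x ≤ 1 := by
      rw [← norm_sq_eq_dot3]; exact pow_le_one₀ (norm_nonneg _) hx1
    have ha : dot3 p.2 x ^ 2 ≤ 1 := by
      have := dot3_sq_le p.2 x
      rw [hu, norm_sq_eq_dot3 x] at this
      linarith
    have hT1 : tubeTrans (p, x) ≤ 1 := by rw [tubeTrans]; simp only; nlinarith
    have hg : p.1 3 * tubeTrans (p, x) ≤ 1 * 1 := by gcongr
    have ha1 := abs_le.mp ((sq_le_one_iff_abs_le_one _).mp ha)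
    rw [tubeRadSq, tubeLong]
    simp only
    nlinarith
  have hd14 : d1 (p.1 0)⁻¹ η ^ 4 ≤ p.1 2 ^ 8 * 25 := by
    rw [h.d1_eq, mul_pow, show √(tubeRadSq (p, x)) ^ 4 = (√(tubeRadSq (p, x)) ^ 2) ^ 2 by ring,
      Real.sq_sqrt hR.le]
    calc _ ≤ (p.1 2 ^ 2) ^ 4 * 5 ^ 2 := by gcongr
      _ = _ := by ring
  have hOm : 2 * (1 / 8) * (1 / 16) / 32 ≤ Om (p.1 0)⁻¹ η := by
    have := Om_mul_add (p.1 0)⁻¹ η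
    rw [inv_inv] at this
    rw [eq_div_of_mul_eq (by positivity) this]
    rw [hη, IsTube.apply_two, ← hη]
    gcongr
    linarith
  have hc2 : (1 / 8 : ℝ) ^ 2 ≤ p.1 0 ^ 2 := by gcongr
  rw [inv_inv, hn2]
  calc _ = p.1 2 ^ 8 * ((1 / 8) ^ 2 * 1 * (2 * (1 / 8) * (1 / 16) / 32) /
        (p.1 2 ^ 8 * 25 * 12 ^ 4)) := by field_simp
    _ ≤ p.1 2 ^ 8 * (p.1 0 ^ 2 * tubeHorSq (p, x) * Om (p.1 0)⁻¹ η /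
        (d1 (p.1 0)⁻¹ η ^ 4 * d2 (p.1 0)⁻¹ η ^ 4)) := by
        have : 0 ≤ Om (p.1 0)⁻¹ η := le_trans (by norm_num) hOm
        gcongr
    _ = _ := by field_simp

theorem exists_tube_decay {φ χ : ℝ → ℝ} (hφ : IsBump φ) (hχd : ContDiff ℝ 4 χ)
    (hχ : ∀ y, χ y ≠ 0 → 1 ≤ y ∧ y ≤ 4) :
    ∃ C : ℝ, 0 ≤ C ∧ ∀ p : TubeParam, IsTube p → ∀ (s : ℝ) (ℓ : E3 →L[ℝ] ℝ) (a : E3 → ℝ), 0 < s →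
      (∀ x, a (focus (p.1 0) + tubePoint p x) = tubeAmp φ χ (p, x)) →
      ‖∫ x, osc (s * Om (p.1 0)⁻¹ x + ℓ x) * (a x : ℂ)‖ ≤
        C * (p.1 1 ^ 2 * p.1 2 ^ 4 * (s * p.1 1 ^ 2) ^ (-(3 / 2) : ℝ)) := by
  have hpt : ∀ (p : TubeParam) (x : E3), focus (p.1 0) + p.1 2 ^ 2 • p.2 +
      colMap (tubeCols (p.1 1) (p.1 2) p.2) x = focus (p.1 0) + tubePoint p x := fun p x => by
    rw [tubePoint, add_assoc]
  obtain ⟨C, hC, hCb⟩ := exists_box_decay isCompact_tubeSet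
    (fun z hz => contDiffAt_tubePhase hz) (fun z hz => contDiffAt_tubeAmp hφ hχd hz)
    (fun p κ τ w u => IsTube p ∧ κ = (p.1 0)⁻¹ ∧ τ = p.1 1 ^ 2 ∧
      w = focus (p.1 0) + p.1 2 ^ 2 • p.2 ∧ u = tubeCols (p.1 1) (p.1 2) p.2)
    (d := (1 / 8) ^ 2 * (2 * (1 / 8) * (1 / 16) / 32) / (25 * 12 ^ 4)) (by norm_num) (by
      rintro p κ τ w u ⟨h, rfl, rfl, rfl, rfl⟩
      have hε := h.eps_pos
      have hσ := h.sigma_pos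
      rw [det_tubeCols _ _ h.norm_eq_one]
      refine ⟨by positivity, by positivity,
        fun x hx => mem_tubeSet_of_tubeAmp_ne_zero hφ hχ h.mem hx, fun x hx => ?_⟩
      rw [hpt]
      exact h.det_lower_bound hx)
    (by
      rintro p κ τ w u ⟨h, rfl, rfl, rfl, rfl⟩
      refine ⟨((p.1 2 ^ 2 * p.2 2 - p.1 2 ^ 2 - p.1 1 * p.1 2 * p.2 2) / 2) •
        (p.2 0 • EuclideanSpace.proj 0 + p.2 1 • EuclideanSpace.proj 1 +
          p.2 2 • EuclideanSpace.proj 2) + (p.1 1 * p.1 2 / 2) • EuclideanSpace.proj 2,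
        (2 * p.1 0 + p.1 2 ^ 2 * p.2 2 - p.1 2 ^ 2) / 2, fun x hx => ?_⟩
      have hL : 0 < tubeLong (p, x) := lt_of_lt_of_le (by norm_num) hx.2.2.1
      have hZ : 0 < tubeHeight (p, x) := by
        have h1 := hx.2.2.2.2.2
        have h2 := h.focus_pos
        simp only at h1
        linarith
      have c1 : Continuous fun y : E3 => tubeLong (p, y) :=
        (contDiff_tubeLong (n := 0)).continuous.comp (by fun_prop)
      have c2 : Continuous fun y : E3 => tubeHeight (p, y) :=
        (contDiff_tubeHeight (n := 0)).continuous.comp (by fun_prop)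
      filter_upwards [c1.continuousAt.eventually (lt_mem_nhds hL),
        c2.continuousAt.eventually (lt_mem_nhds hZ)] with y hy1 hy2
      rw [hpt, h.Om_eq hy1 hy2, tubeHeight, tubeLong]
      simp only [add_apply, smul_apply, PiLp.proj_apply, smul_eq_mul, dot3]
      ring)
  refine ⟨C, hC, fun p h s ℓ a hs ha => ?_⟩
  have := hCb p _ _ _ _ ⟨h, rfl, rfl, rfl, rfl⟩ s ℓ a hs (fun x => by rw [hpt, ha])
  have hε := h.eps_pos
  have hσ := h.sigma_pos
  rwa [det_tubeCols _ _ h.norm_eq_one, abs_of_pos (by positivity)] at this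

end TubeDecay

section NearFocus

variable {φ χ : ℝ → ℝ}

/-- The amplitude of `kernelInt`. -/
def kernelAmp (φ χ : ℝ → ℝ) (ε δ : ℝ) (x : E3) : ℝ :=
  φ ‖x‖ * φ (ε⁻¹ * nrmh x) * χ (δ⁻¹ * x 2)

/-- The part of the amplitude of `kernelInt` in the tube around `ω`. -/
def tubePart (φ χ : ℝ → ℝ) (c ε δ : ℝ) (x ω : E3) : ℝ :=
  kernelAmp φ χ ε δ x *
    ((‖x - focus c‖ ^ 2)⁻¹ * tubeCutoff (tubeDistSq ε (x - focus c) ω))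

theorem nrmh_sub_focus (x : E3) (c : ℝ) : nrmh (x - focus c) = nrmh x := by
  simp [nrmh, focus]

theorem nrmh_le_norm (x : E3) : nrmh x ≤ ‖x‖ := by
  refine abs_le_of_sq_le_sq' ?_ (norm_nonneg _) |>.2
  rw [nrmh_sq, norm_sq_eq_dot3, dot3]
  nlinarith [sq_nonneg (x 2)]

theorem abs_apply_zero_le_nrmh (x : E3) : |x 0| ≤ nrmh x := by
  refine abs_le_of_sq_le_sq ?_ (nrmh_nonneg _)
  rw [nrmh_sq]
  nlinarith [sq_nonneg (x 1)]

theorem abs_apply_one_le_nrmh (x : E3) : |x 1| ≤ nrmh x := by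
  refine abs_le_of_sq_le_sq ?_ (nrmh_nonneg _)
  rw [nrmh_sq]
  nlinarith [sq_nonneg (x 0)]

theorem kernelAmp_support (hφ : IsBump φ) (hχ : ∀ y, χ y ≠ 0 → 1 ≤ y ∧ y ≤ 4) {ε δ : ℝ}
    (hε : 0 < ε) (hε8 : ε ≤ 1 / 8) (hδ : 0 < δ) {x : E3} (hx : kernelAmp φ χ ε δ x ≠ 0) :
    ‖x‖ ≤ 4 ∧ ε ≤ nrmh x ∧ nrmh x ≤ 4 * ε ∧ 1 / 8 ≤ δ := by
  simp only [kernelAmp, ne_eq, mul_eq_zero, not_or] at hx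
  obtain ⟨⟨h1, h2⟩, h3⟩ := hx
  obtain ⟨a1, a2⟩ := hφ.supp _ h1
  obtain ⟨b1, b2⟩ := hφ.supp _ h2
  obtain ⟨c1, c2⟩ := hχ _ h3
  have hn := nrmh_nonneg x
  rw [abs_of_nonneg (norm_nonneg x)] at a1 a2
  rw [abs_of_nonneg (by positivity), inv_mul_eq_div] at b1 b2
  rw [inv_mul_eq_div] at c1 c2
  rw [le_div_iff₀ hε] at b1
  rw [div_le_iff₀ hε] at b2
  rw [le_div_iff₀ hδ] at c1
  rw [div_le_iff₀ hδ] at c2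
  refine ⟨a2, by linarith, b2, ?_⟩
  have h4 : ‖x‖ ^ 2 = nrmh x ^ 2 + x 2 ^ 2 := by
    rw [norm_sq_eq_dot3, nrmh_sq, dot3]; ring
  by_contra! hlt
  nlinarith

theorem exists_isTube_of_tubePart_ne_zero (hφ : IsBump φ)
    (hχ : ∀ y, χ y ≠ 0 → 1 ≤ y ∧ y ≤ 4) {c ε δ : ℝ} (hc : 1 / 8 ≤ c) (hc8 : c ≤ 8)
    (hε : 0 < ε) (hε8 : ε ≤ 1 / 8) (hδ : 0 < δ) (hδ1 : δ ≤ 1) {x ω : E3}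
    (h : tubePart φ χ c ε δ x ω ≠ 0) :
    (|ω 0| ≤ 6 * ε ∧ |ω 1| ≤ 6 * ε ∧ ‖ω‖ ≤ 14) ∧
    ∃ p : TubeParam, IsTube p ∧ p.1 0 = c ∧ p.1 1 = ε ∧ p.1 4 = δ⁻¹ ∧ p.1 2 ^ 2 • p.2 = ω := by
  simp only [tubePart, ne_eq, mul_eq_zero, not_or] at h
  obtain ⟨h1, -, h2⟩ := h
  obtain ⟨a1, a2, a3, a4⟩ := kernelAmp_support hφ hχ hε hε8 hδ h1
  have hq := lt_of_tubeCutoff_ne_zero h2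
  have hnz : nrmh (x - focus c) ≤ ‖x - focus c‖ := nrmh_le_norm _
  rw [nrmh_sub_focus] at hnz
  have hζ : ε ≤ ‖x - focus c‖ := a2.trans hnz
  obtain ⟨b1, b2, b3⟩ := comparable_of_tubeDistSq_lt hε (by nlinarith) hq
  have hζ12 : ‖x - focus c‖ ≤ 12 := by
    have h1 := d1_le c⁻¹ x
    rw [d1_eq_norm, inv_inv, abs_of_pos (by linarith)] at h1
    linarith
  have hsq : √‖x - focus c‖ ≤ 4 := by
    rw [Real.sqrt_le_left (by norm_num)]
    linarith
  have hse : ε * √‖x - focus c‖ / 10 ≤ ε * 4 / 10 := by gcongr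
  have hx0 := abs_apply_zero_le_nrmh (x - focus c)
  have hx1 := abs_apply_one_le_nrmh (x - focus c)
  rw [nrmh_sub_focus] at hx0 hx1
  have hω0 : |ω 0| ≤ 6 * ε := (b3 0).trans (by linarith)
  have hω1 : |ω 1| ≤ 6 * ε := (b3 1).trans (by linarith)
  have hωn : 17 / 20 * ε ≤ ‖ω‖ := le_trans (by linarith) b1
  have hωp : 0 < ‖ω‖ := lt_of_lt_of_le (by positivity) hωn
  refine ⟨⟨hω0, hω1, by linarith⟩, (![c, ε, √‖ω‖, ε ^ 2 / ‖ω‖, δ⁻¹, ε⁻¹ * ω 0, ε⁻¹ * ω 1],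
    ‖ω‖⁻¹ • ω), ?_, rfl, rfl, rfl, ?_⟩
  · have k0 := abs_le.mp hω0
    have k1 := abs_le.mp hω1
    have hu : ‖‖ω‖⁻¹ • ω‖ = 1 := by
      rw [norm_smul, norm_inv, norm_norm, inv_mul_cancel₀ hωp.ne']
    refine ⟨mem_tubeBox_iff.mpr ⟨⟨⟨hc, hc8⟩, ⟨hε.le, hε8⟩, ⟨Real.sqrt_nonneg _, ?_⟩,
      ⟨by simp only [Matrix.cons_val]; positivity, ?_⟩, ⟨?_, ?_⟩, ⟨?_, ?_⟩, ?_, ?_⟩, hu⟩, hε, Real.sqrt_pos.mpr hωp, ?_, ?_, ?_⟩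
    all_goals simp only [Matrix.cons_val, PiLp.smul_apply, smul_eq_mul, Real.sq_sqrt hωp.le,
      inv_mul_eq_div]
    · rw [Real.sqrt_le_left (by norm_num)]
      linarith
    · rw [div_le_one hωp]
      nlinarith
    · exact (one_le_inv₀ hδ).mpr hδ1
    · rw [inv_le_comm₀ hδ (by norm_num)]
      linarith
    · rw [le_div_iff₀ hε]; linarith
    · rw [div_le_iff₀ hε]; linarith
    · rw [le_div_iff₀ hε]; linarith
    · rw [div_le_iff₀ hε]; linarith
    all_goals field_simp
  · simp only [Matrix.cons_val]
    rw [Real.sq_sqrt hωp.le, smul_inv_smul₀ hωp.ne']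

theorem tubePart_add_tubePoint {p : TubeParam} (hp : IsTube p) {δ : ℝ} (hδ : p.1 4 = δ⁻¹) (x : E3) :
    p.1 2 ^ 4 * tubePart φ χ (p.1 0) (p.1 1) δ (focus (p.1 0) + tubePoint p x)
      (p.1 2 ^ 2 • p.2) = tubeAmp φ χ (p, x) := by
  have hε := hp.eps_pos
  have hσ := hp.sigma_pos
  have e1 : ‖focus (p.1 0) + tubePoint p x‖ = √(tubeNormSq (p, x)) := by
    rw [← hp.norm_sq, Real.sqrt_sq (norm_nonneg _)]
  have e2 : (p.1 1)⁻¹ * nrmh (focus (p.1 0) + tubePoint p x) = √(tubeHorSq (p, x)) := by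
    rw [← Real.sqrt_sq (nrmh_nonneg _), hp.nrmh_sq, Real.sqrt_mul (by positivity),
      Real.sqrt_sq hε.le, inv_mul_cancel_left₀ hε.ne']
  have e3 : tubeDistSq (p.1 1) (tubePoint p x) (p.1 2 ^ 2 • p.2) =
      (dot3 p.2 x * tubeLong (p, x) + p.1 3 * tubeTrans (p, x)) ^ 2 / tubeRadSq (p, x) ^ 2 +
        tubeTrans (p, x) / (tubeRadSq (p, x) * √(tubeRadSq (p, x))) := by
    have h1 := dot3_colMap_tubeCols (p.1 1) (p.1 2) hp.norm_eq_one x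
    have h2 := norm_sq_colMap_tubeCols (p.1 1) (p.1 2) hp.norm_eq_one x
    have hg := hp.gamma_eq
    have n2 := hp.norm_sq_tubePoint x
    have n4 : ‖tubePoint p x‖ ^ 4 = p.1 2 ^ 8 * tubeRadSq (p, x) ^ 2 := by
      rw [show 4 = 2 * 2 from rfl, pow_mul, n2]; ring
    have n3 : ‖tubePoint p x‖ ^ 3 = p.1 2 ^ 6 * (tubeRadSq (p, x) * √(tubeRadSq (p, x))) := by
      rw [pow_succ, n2, hp.norm_tubePoint]; ring
    have hv : p.1 2 ^ 2 • p.2 - tubePoint p x = -colMap (tubeCols (p.1 1) (p.1 2) p.2) x := by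
      rw [tubePoint]; abel
    have hd : dot3 (tubePoint p x) (-colMap (tubeCols (p.1 1) (p.1 2) p.2) x) =
        -(p.1 2 ^ 4 * (dot3 p.2 x * tubeLong (p, x) + p.1 3 * tubeTrans (p, x))) := by
      have : dot3 (tubePoint p x) (-colMap (tubeCols (p.1 1) (p.1 2) p.2) x) =
          -(p.1 2 ^ 2 * dot3 p.2 (colMap (tubeCols (p.1 1) (p.1 2) p.2) x) +
            ‖colMap (tubeCols (p.1 1) (p.1 2) p.2) x‖ ^ 2) := by
        rw [norm_sq_eq_dot3, tubePoint]
        simp only [dot3, PiLp.add_apply, PiLp.smul_apply, PiLp.neg_apply, smul_eq_mul]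
        ring
      rw [this, h1, h2, tubeLong, tubeTrans, norm_sq_eq_dot3]
      linear_combination p.1 2 ^ 2 * (dot3 x x - dot3 p.2 x ^ 2) * hg
    rw [tubeDistSq, hv, hd, norm_neg, n4, n3]
    congr 1
    · rw [neg_sq, mul_pow, ← pow_mul, mul_div_mul_left _ _ (by positivity)]
    · have : ‖tubePoint p x‖ ^ 2 * ‖colMap (tubeCols (p.1 1) (p.1 2) p.2) x‖ ^ 2 -
          (-(p.1 2 ^ 4 * (dot3 p.2 x * tubeLong (p, x) + p.1 3 * tubeTrans (p, x)))) ^ 2 =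
          p.1 1 ^ 2 * p.1 2 ^ 6 * tubeTrans (p, x) := by
        rw [n2, h2, tubeRadSq, tubeTrans, norm_sq_eq_dot3]
        simp only [tubeLong]
        generalize dot3 p.2 x = a
        generalize dot3 x x = b
        rw [← hg]
        ring
      rw [this, ← mul_assoc (p.1 1 ^ 2), mul_div_mul_left _ _ (by positivity)]
  have e4 : p.1 2 ^ 4 * (‖tubePoint p x‖ ^ 2)⁻¹ = (tubeRadSq (p, x))⁻¹ := by
    rw [hp.norm_sq_tubePoint, mul_inv, mul_inv_cancel_left₀ (by positivity)]
  rw [tubePart, kernelAmp, add_sub_cancel_left, e1, e2, e3, IsTube.apply_two, ← hδ, tubeAmp, ← e4]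
  ring

end NearFocus

section NearFocusDecay

variable {φ χ : ℝ → ℝ}

theorem exists_abs_le_of_support {f : ℝ → ℝ} (hf : Continuous f) {r : ℝ}
    (h : ∀ y, f y ≠ 0 → |y| ≤ r) : ∃ M, 0 ≤ M ∧ ∀ y, |f y| ≤ M := by
  have hs : HasCompactSupport f := HasCompactSupport.of_support_subset_isCompact
    (isCompact_closedBall (0 : ℝ) r) fun y hy => by
      rw [mem_closedBall_zero_iff]; exact h y hy
  obtain ⟨M, hM⟩ := hs.exists_bound_of_continuous hf
  exact ⟨M, (norm_nonneg _).trans (hM 0), hM⟩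

theorem exists_abs_kernelAmp_le (hφ : IsBump φ) (hχd : ContDiff ℝ 4 χ)
    (hχ : ∀ y, χ y ≠ 0 → 1 ≤ y ∧ y ≤ 4) :
    ∃ M, 0 ≤ M ∧ ∀ ε δ x, |kernelAmp φ χ ε δ x| ≤ M := by
  obtain ⟨M, hM0, hM⟩ := exists_abs_le_of_support hφ.contDiff.continuous fun y hy => (hφ.supp y hy).2
  obtain ⟨N, hN0, hN⟩ := exists_abs_le_of_support (r := 4) hχd.continuous fun y hy => by
    have := hχ y hy
    rw [abs_of_nonneg] <;> linarith
  refine ⟨M * M * N, by positivity, fun ε δ x => ?_⟩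
  rw [kernelAmp, abs_mul, abs_mul]
  gcongr
  · exact hM _
  · exact hM _
  · exact hN _

theorem continuous_Om (κ : ℝ) : Continuous (Om κ) := by
  rw [Om_eq_norm]; fun_prop

theorem continuous_nrmh : Continuous nrmh := by
  unfold nrmh; fun_prop

theorem continuous_kernelAmp (hφ : IsBump φ) (hχd : ContDiff ℝ 4 χ) (ε δ : ℝ) :
    Continuous (kernelAmp φ χ ε δ) := by
  have h1 := hφ.contDiff.continuous
  have h2 := hχd.continuous
  have h3 := continuous_nrmh
  unfold kernelAmp
  fun_prop

theorem measurable_tubePart (hφ : IsBump φ) (hχd : ContDiff ℝ 4 χ) (c ε δ : ℝ) :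
    Measurable fun z : E3 × E3 => tubePart φ χ c ε δ z.1 z.2 := by
  have h1 := (continuous_kernelAmp hφ hχd ε δ).measurable
  have h2 : Measurable tubeCutoff := (contDiff_tubeCutoff (n := 0)).continuous.measurable
  have h3 : Measurable fun z : E3 × E3 => tubeDistSq ε (z.1 - focus c) z.2 := by
    have hd : Continuous fun z : E3 × E3 => dot3 (z.1 - focus c) (z.2 - (z.1 - focus c)) := by
      unfold dot3; fun_prop
    have hd' := hd.measurable
    unfold tubeDistSq
    fun_prop
  unfold tubePart
  fun_prop

theorem abs_tubePart_le (hφ : IsBump φ)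
    (hχ : ∀ y, χ y ≠ 0 → 1 ≤ y ∧ y ≤ 4) {M : ℝ} (hM : ∀ ε δ x, |kernelAmp φ χ ε δ x| ≤ M)
    {c ε δ : ℝ} (hc : 1 / 8 ≤ c) (hc8 : c ≤ 8) (hε : 0 < ε) (hε8 : ε ≤ 1 / 8) (hδ : 0 < δ)
    (hδ1 : δ ≤ 1) (z : E3 × E3) :
    |tubePart φ χ c ε δ z.1 z.2| ≤ (Metric.closedBall (0 : E3) 4 ×ˢ
      Metric.closedBall (0 : E3) 14).indicator (fun _ => M * (ε ^ 2)⁻¹) z := by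
  have hM0 : 0 ≤ M := (abs_nonneg _).trans (hM 0 0 0)
  by_cases h : tubePart φ χ c ε δ z.1 z.2 = 0
  · rw [h, abs_zero]
    exact Set.indicator_nonneg (fun _ _ => by positivity) _
  have h1 := (exists_isTube_of_tubePart_ne_zero hφ hχ hc hc8 hε hε8 hδ hδ1 h).1.2.2
  have h2 : kernelAmp φ χ ε δ z.1 ≠ 0 := left_ne_zero_of_mul h
  obtain ⟨a1, a2, -, -⟩ := kernelAmp_support hφ hχ hε hε8 hδ h2
  have hz : ε ≤ ‖z.1 - focus c‖ := a2.trans (by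
    rw [← nrmh_sub_focus z.1 c]; exact nrmh_le_norm _)
  rw [Set.indicator_of_mem (Set.mk_mem_prod (by simpa using a1) (by simpa using h1)), tubePart,
    abs_mul, abs_mul, abs_of_nonneg (tubeCutoff_nonneg _), abs_inv, abs_sq]
  calc |kernelAmp φ χ ε δ z.1| *
        ((‖z.1 - focus c‖ ^ 2)⁻¹ * tubeCutoff (tubeDistSq ε (z.1 - focus c) z.2))
      ≤ M * ((ε ^ 2)⁻¹ * 1) := by
        have h3 := tubeCutoff_nonneg (tubeDistSq ε (z.1 - focus c) z.2)
        have h4 := tubeCutoff_le_one (tubeDistSq ε (z.1 - focus c) z.2)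
        gcongr
        exact hM _ _ _
    _ = M * (ε ^ 2)⁻¹ := by rw [mul_one]

theorem integral_tubePart (hφ : IsBump φ)
    (hχ : ∀ y, χ y ≠ 0 → 1 ≤ y ∧ y ≤ 4) {c ε δ : ℝ} (hε : 0 < ε) (hε8 : ε ≤ 1 / 8) (hδ : 0 < δ)
    (x : E3) :
    ∫ ω, (tubePart φ χ c ε δ x ω : ℂ) =
      ((ε ^ 2 * ∫ y : E3, tubeCutoff (‖y‖ ^ 2) : ℝ) : ℂ) * (kernelAmp φ χ ε δ x : ℂ) := by
  by_cases h : kernelAmp φ χ ε δ x = 0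
  · simp [tubePart, h]
  have hz : ε ≤ ‖x - focus c‖ := (kernelAmp_support hφ hχ hε hε8 hδ h).2.1.trans (by
    rw [← nrmh_sub_focus x c]; exact nrmh_le_norm _)
  have hn : 0 < ‖x - focus c‖ := hε.trans_le hz
  have hn' : ((‖x - focus c‖ : ℝ) : ℂ) ≠ 0 := Complex.ofReal_ne_zero.mpr hn.ne'
  simp only [tubePart, Complex.ofReal_mul]
  rw [integral_const_mul, integral_const_mul,
    integral_tubeCutoff_tubeDistSq hε (norm_pos_iff.mp hn)]
  push_cast
  field_simp

theorem exists_decay_near_focus (hφ : IsBump φ) (hχd : ContDiff ℝ 4 χ)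
    (hχ : ∀ y, χ y ≠ 0 → 1 ≤ y ∧ y ≤ 4) :
    ∃ C : ℝ, 0 ≤ C ∧ ∀ (c ε δ s : ℝ) (ℓ : E3 →L[ℝ] ℝ), 1 / 8 ≤ c → c ≤ 8 → 0 < ε → ε ≤ 1 / 8 →
      0 < δ → δ ≤ 1 → 0 < s →
      ‖kernelInt φ χ c⁻¹ s ℓ ε δ‖ ≤ C * (ε ^ 2 * (s * ε ^ 2) ^ (-(3 / 2) : ℝ)) := by
  obtain ⟨C, hC, hCb⟩ := exists_tube_decay hφ hχd hχ
  obtain ⟨M, hM0, hM⟩ := exists_abs_kernelAmp_le hφ hχd hχ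
  set J : ℝ := ∫ y : E3, tubeCutoff (‖y‖ ^ 2) with hJ
  have hJ0 : 0 < J := integral_tubeCutoff_pos
  set W : ℝ := (volume (Metric.closedBall (0 : E3) 17)).toReal with hW
  refine ⟨J⁻¹ * (C * W), by positivity, fun c ε δ s ℓ hc hc8 hε hε8 hδ hδ1 hs => ?_⟩
  set B : ℝ := C * (ε ^ 2 * (s * ε ^ 2) ^ (-(3 / 2) : ℝ)) with hB
  have hB0 : 0 ≤ B := by positivity
  set G : E3 → E3 → ℂ := fun x ω => osc (s * Om c⁻¹ x + ℓ x) * (tubePart φ χ c ε δ x ω : ℂ) with hG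
  have hinner : ∀ ω, ‖∫ x, G x ω‖ ≤
      {ω : E3 | |ω 0| ≤ 6 * ε ∧ |ω 1| ≤ 6 * ε ∧ ‖ω‖ ≤ 14}.indicator (fun _ => B) ω := by
    intro ω
    by_cases h : ∃ x, tubePart φ χ c ε δ x ω ≠ 0
    · obtain ⟨x, hx⟩ := h
      obtain ⟨hω, p, hp, h0, h1, h4, hpω⟩ :=
        exists_isTube_of_tubePart_ne_zero hφ hχ hc hc8 hε hε8 hδ hδ1 hx
      rw [Set.indicator_of_mem (by exact hω)]
      have hσ := hp.sigma_pos
      have h := hCb p hp s ℓ (fun x => p.1 2 ^ 4 * tubePart φ χ c ε δ x ω) hs fun x => by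
        have := tubePart_add_tubePoint (φ := φ) (χ := χ) hp h4 x
        rw [h1, hpω, h0] at this
        rwa [h0]
      have e : ∀ x, osc (s * Om (p.1 0)⁻¹ x + ℓ x) *
          ((p.1 2 ^ 4 * tubePart φ χ c ε δ x ω : ℝ) : ℂ) = ((p.1 2 ^ 4 : ℝ) : ℂ) * G x ω := by
        intro x
        rw [hG, h0]
        push_cast
        ring
      simp only [e] at h
      rw [integral_const_mul, norm_mul, Complex.norm_real, Real.norm_of_nonneg (by positivity),
        h1] at h
      refine le_of_mul_le_mul_left (h.trans (le_of_eq ?_)) (pow_pos hσ 4)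
      rw [hB]; ring
    · push Not at h
      simp only [hG, h]
      simp only [Complex.ofReal_zero, mul_zero, integral_zero, norm_zero]
      exact Set.indicator_nonneg (fun _ _ => hB0) _
  have hG_int : Integrable (Function.uncurry G) (volume.prod volume) := by
    have hK : IsCompact (Metric.closedBall (0 : E3) 4 ×ˢ Metric.closedBall (0 : E3) 14) :=
      (isCompact_closedBall _ _).prod (isCompact_closedBall _ _)
    refine Integrable.mono' (g := (Metric.closedBall (0 : E3) 4 ×ˢ
      Metric.closedBall (0 : E3) 14).indicator (fun _ => M * (ε ^ 2)⁻¹)) ?_ ?_ ?_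
    · rw [integrable_indicator_iff hK.measurableSet]
      exact integrableOn_const hK.measure_lt_top.ne
    · have h1 := measurable_tubePart hφ hχd c ε δ
      have h2 : Continuous fun x : E3 => osc (s * Om c⁻¹ x + ℓ x) :=
        continuous_osc.comp (by have := continuous_Om c⁻¹; fun_prop)
      exact ((h2.measurable.comp measurable_fst).mul
        (Complex.measurable_ofReal.comp h1)).aestronglyMeasurable
    · refine Filter.Eventually.of_forall fun z => ?_
      simp only [Function.uncurry, hG]
      rw [norm_mul, norm_osc, one_mul, Complex.norm_real]
      exact abs_tubePart_le hφ hχ hM hc hc8 hε hε8 hδ hδ1 z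
  have hswap := integral_integral_swap hG_int
  have hleft : ∫ x, ∫ ω, G x ω = ((ε ^ 2 * J : ℝ) : ℂ) * kernelInt φ χ c⁻¹ s ℓ ε δ := by
    rw [kernelInt, ← integral_const_mul]
    refine integral_congr_ae (Filter.Eventually.of_forall fun x => ?_)
    simp only [hG]
    rw [integral_const_mul, integral_tubePart hφ hχ hε hε8 hδ, ← hJ, kernelAmp]
    ring
  have hright : ‖∫ ω, ∫ x, G x ω‖ ≤ ε ^ 2 * (B * W) := by
    have hdet := det_diagCols ε 1
    rw [mul_one] at hdet
    rw [integral_eq_abs_det_mul_integral_colMap (diagCols ε 1) (by rw [hdet]; positivity) 0, hdet,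
      norm_mul, Complex.norm_real, Real.norm_eq_abs, abs_abs, abs_of_nonneg (by positivity)]
    gcongr
    have hWB : B * W = ∫ x : E3, (Metric.closedBall (0 : E3) 17).indicator (fun _ => B) x := by
      rw [integral_indicator measurableSet_closedBall, setIntegral_const, smul_eq_mul, mul_comm]
      rfl
    rw [hWB]
    refine norm_integral_le_of_norm_le ?_ (Filter.Eventually.of_forall fun x => ?_)
    · rw [integrable_indicator_iff measurableSet_closedBall]
      exact integrableOn_const (isCompact_closedBall _ _).measure_lt_top.ne
    refine (hinner _).trans ?_
    by_cases hx : 0 + colMap (diagCols ε 1) x ∈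
        {ω : E3 | |ω 0| ≤ 6 * ε ∧ |ω 1| ≤ 6 * ε ∧ ‖ω‖ ≤ 14}
    · rw [Set.indicator_of_mem hx, Set.indicator_of_mem]
      rw [zero_add, colMap_diagCols] at hx
      obtain ⟨h0, h1, h2⟩ := hx
      simp only [Matrix.cons_val, abs_mul, abs_of_pos hε, mul_comm 6 ε] at h0 h1
      have h3 := (PiLp.norm_apply_le _ 2).trans h2
      simp only [Matrix.cons_val, one_mul, Real.norm_eq_abs] at h3
      have k0 := sq_le_sq' (abs_le.mp (le_of_mul_le_mul_left h0 hε)).1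
        (abs_le.mp (le_of_mul_le_mul_left h0 hε)).2
      have k1 := sq_le_sq' (abs_le.mp (le_of_mul_le_mul_left h1 hε)).1
        (abs_le.mp (le_of_mul_le_mul_left h1 hε)).2
      have k2 := sq_le_sq' (abs_le.mp h3).1 (abs_le.mp h3).2
      rw [mem_closedBall_zero_iff]
      refine abs_le_of_sq_le_sq' ?_ (by norm_num) |>.2
      rw [norm_sq_eq_dot3, dot3]
      nlinarith
    · rw [Set.indicator_of_notMem hx]
      exact Set.indicator_nonneg (fun _ _ => hB0) _
  have := hswap ▸ hleft
  rw [this, norm_mul, Complex.norm_real, Real.norm_of_nonneg (by positivity)] at hright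
  rw [← mul_le_mul_iff_right₀ (show 0 < ε ^ 2 * J by positivity)]
  refine hright.trans (le_of_eq ?_)
  rw [hB]
  field_simp

end NearFocusDecay

section Assembly

variable {φ χ : ℝ → ℝ}

/-- The dependence on `κ` of the decay rate at frequency scale one. -/
def IsRate (κ m : ℝ) : Prop :=
  8 ≤ κ ∧ m = κ ^ (3 / 2 : ℝ) ∨ 1 / 8 ≤ κ ∧ κ ≤ 8 ∧ m = 1 ∨ κ ≤ 1 / 8 ∧ m = κ ^ (-3 : ℝ)

theorem sq_rpow_neg_three_halves {a : ℝ} (ha : 0 < a) :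
    (a ^ 2) ^ (-(3 / 2) : ℝ) = a⁻¹ ^ 3 := by
  rw [← Real.rpow_natCast a 2, ← Real.rpow_mul ha.le, inv_pow, ← Real.rpow_natCast a 3,
    ← Real.rpow_neg ha.le]
  norm_num

theorem mul_rpow_neg_three_halves {a : ℝ} (ha : 0 < a) :
    a * a ^ (-(3 / 2) : ℝ) = a ^ (-(1 / 2) : ℝ) := by
  nth_rewrite 1 [← Real.rpow_one a]
  rw [← Real.rpow_add ha]
  norm_num

theorem exists_kernelInt_decay_of_pos (hφ : IsBump φ) (hχd : ContDiff ℝ 4 χ)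
    (hχ : ∀ y, χ y ≠ 0 → 1 ≤ y ∧ y ≤ 4) :
    ∃ C : ℝ, 0 ≤ C ∧ ∀ (κ m ε δ s : ℝ) (ℓ : E3 →L[ℝ] ℝ), 0 < κ → IsRate κ m → 0 < ε → ε ≤ 1 →
      0 < δ → δ ≤ 1 → 0 < s →
      ‖kernelInt φ χ κ s ℓ ε δ‖ ≤
        C * (s ^ (-(3 / 2) : ℝ) * m * (ε⁻¹ * δ ^ (-(1 / 2) : ℝ))) := by
  obtain ⟨C₁, h₁, hC₁⟩ := exists_decay_of_le_width hφ hχd hχ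
  obtain ⟨C₂, h₂, hC₂⟩ := exists_decay_of_width_le_of_focus_le hφ hχd hχ
  obtain ⟨C₃, h₃, hC₃⟩ := exists_decay_near_focus hφ hχd hχ
  obtain ⟨C₄, h₄, hC₄⟩ := exists_decay_of_focus_ge hφ hχd hχ
  set N : ℝ := 8 ^ (3 / 2 : ℝ) with hN
  have hN1 : 1 ≤ N := Real.one_le_rpow (by norm_num) (by norm_num)
  refine ⟨N * (C₁ + C₂ + C₃ + C₄), by positivity,
    fun κ m ε δ s ℓ hκ hm hε hε1 hδ hδ1 hs => ?_⟩
  have hδh : 1 ≤ δ ^ (-(1 / 2) : ℝ) :=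
    Real.one_le_rpow_of_pos_of_le_one_of_nonpos hδ hδ1 (by norm_num)
  have hεi : 1 ≤ ε⁻¹ := (one_le_inv₀ hε).mpr hε1
  have hm0 : 0 ≤ m := by
    obtain ⟨-, rfl⟩ | ⟨-, -, rfl⟩ | ⟨-, rfl⟩ := hm <;> positivity
  have hle : ∀ {X D A : ℝ}, 0 ≤ D → 0 ≤ A → D ≤ C₁ + C₂ + C₃ + C₄ → X ≤ D * A →
      A ≤ N * (s ^ (-(3 / 2) : ℝ) * m * (ε⁻¹ * δ ^ (-(1 / 2) : ℝ))) →
      X ≤ N * (C₁ + C₂ + C₃ + C₄) * (s ^ (-(3 / 2) : ℝ) * m * (ε⁻¹ * δ ^ (-(1 / 2) : ℝ))) := by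
    intro X D A hD hA0 hDC hX hA
    exact hX.trans ((mul_le_mul hDC hA hA0 (by positivity)).trans (le_of_eq (by ring)))
  have hmN : 1 / 8 ≤ κ → κ⁻¹ ^ (-(3 / 2) : ℝ) ≤ N * m := by
    intro h
    rw [Real.inv_rpow hκ.le, ← Real.rpow_neg hκ.le, neg_neg]
    obtain ⟨-, rfl⟩ | ⟨-, h8, rfl⟩ | ⟨h8, rfl⟩ := hm
    · exact le_mul_of_one_le_left (by positivity) hN1
    · rw [mul_one]; exact Real.rpow_le_rpow hκ.le h8 (by norm_num)
    · obtain rfl : κ = 1 / 8 := le_antisymm h8 h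
      refine (Real.rpow_le_one (by norm_num) (by norm_num) (by norm_num)).trans ?_
      exact one_le_mul_of_one_le_of_one_le hN1
        (Real.one_le_rpow_of_pos_of_le_one_of_nonpos (by norm_num) (by norm_num) (by norm_num))
  have hκi : 1 / 8 ≤ κ → κ⁻¹ ≤ 8 := fun h => by
    rw [inv_le_comm₀ hκ (by norm_num)]; linarith
  by_cases hκ8 : 1 / 8 ≤ κ
  · by_cases hε8 : 1 / 8 ≤ ε
    · have h := hC₁ κ⁻¹ ε δ s ℓ (inv_pos.mpr hκ) (hκi hκ8) hε8 hε1 hδ hδ1 hs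
      rw [inv_inv] at h
      refine hle h₁ (by positivity) (by linarith) h ?_
      rw [Real.mul_rpow hs.le (by positivity), Real.mul_rpow (by positivity) hδ.le]
      calc ε ^ 2 * δ * (s ^ (-(3 / 2) : ℝ) * (κ⁻¹ ^ (-(3 / 2) : ℝ) * δ ^ (-(3 / 2) : ℝ)))
          = ε ^ 2 * (s ^ (-(3 / 2) : ℝ) * (κ⁻¹ ^ (-(3 / 2) : ℝ) *
              (δ * δ ^ (-(3 / 2) : ℝ)))) := by ring
        _ ≤ ε⁻¹ * (s ^ (-(3 / 2) : ℝ) * (N * m * δ ^ (-(1 / 2) : ℝ))) := by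
            rw [mul_rpow_neg_three_halves hδ]
            have : ε ^ 2 ≤ ε⁻¹ := (pow_le_one₀ hε.le hε1).trans hεi
            gcongr
            exact hmN hκ8
        _ = _ := by ring
    · by_cases hκ' : 8 ≤ κ
      · have h := hC₂ κ⁻¹ ε δ s ℓ (inv_pos.mpr hκ) (by
          rw [inv_le_comm₀ hκ (by norm_num)]; linarith) hε (by linarith) hδ hδ1 hs
        rw [inv_inv] at h
        refine hle h₂ (by positivity) (by linarith) h ?_
        rw [Real.mul_rpow hs.le (by positivity), Real.mul_rpow (by positivity) (by positivity),
          sq_rpow_neg_three_halves hε]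
        calc ε ^ 2 * δ * (s ^ (-(3 / 2) : ℝ) * (κ⁻¹ ^ (-(3 / 2) : ℝ) * ε⁻¹ ^ 3))
            = s ^ (-(3 / 2) : ℝ) * κ⁻¹ ^ (-(3 / 2) : ℝ) * (ε⁻¹ * δ) := by field_simp
          _ ≤ s ^ (-(3 / 2) : ℝ) * (N * m) * (ε⁻¹ * δ ^ (-(1 / 2) : ℝ)) := by
              gcongr
              · exact hmN hκ8
              · exact hδ1.trans hδh
          _ = _ := by ring
      · have h := hC₃ κ⁻¹ ε δ s ℓ (by
          rw [le_inv_comm₀ (by norm_num) hκ]; linarith) (hκi hκ8) hε (by linarith) hδ hδ1 hs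
        rw [inv_inv] at h
        refine hle h₃ (by positivity) (by linarith) h ?_
        have h1m : 1 ≤ N * m := by
          obtain ⟨h, -⟩ | ⟨-, -, rfl⟩ | ⟨h, rfl⟩ := hm
          · exact absurd h hκ'
          · rwa [mul_one]
          · exact one_le_mul_of_one_le_of_one_le hN1
              (Real.one_le_rpow_of_pos_of_le_one_of_nonpos hκ (by linarith) (by norm_num))
        rw [Real.mul_rpow hs.le (by positivity), sq_rpow_neg_three_halves hε]
        calc ε ^ 2 * (s ^ (-(3 / 2) : ℝ) * ε⁻¹ ^ 3)
            = s ^ (-(3 / 2) : ℝ) * 1 * (ε⁻¹ * 1) := by field_simp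
          _ ≤ s ^ (-(3 / 2) : ℝ) * (N * m) * (ε⁻¹ * δ ^ (-(1 / 2) : ℝ)) := by gcongr
          _ = _ := by ring
  · obtain ⟨h, -⟩ | ⟨h, -, -⟩ | ⟨hκ1, rfl⟩ := hm
    · exact absurd (by linarith) hκ8
    · exact absurd h hκ8
    have h := hC₄ κ ε δ s ℓ hκ hκ1 hε hε1 hδ hδ1 hs
    refine hle h₄ (by positivity) (by linarith) h ?_
    rw [Real.mul_rpow hs.le (by positivity), Real.mul_rpow (by positivity) hδ.le, ← mul_pow,
      sq_rpow_neg_three_halves (by positivity), Real.rpow_neg hκ.le]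
    calc ε ^ 2 * δ * (s ^ (-(3 / 2) : ℝ) * ((κ * ε)⁻¹ ^ 3 * δ ^ (-(3 / 2) : ℝ)))
        = 1 * (s ^ (-(3 / 2) : ℝ) * (κ ^ 3)⁻¹ * (ε⁻¹ * (δ * δ ^ (-(3 / 2) : ℝ)))) := by
          field_simp
      _ ≤ N * (s ^ (-(3 / 2) : ℝ) * (κ ^ (3 : ℝ))⁻¹ * (ε⁻¹ * δ ^ (-(1 / 2) : ℝ))) := by
          rw [mul_rpow_neg_three_halves hδ, show (3 : ℝ) = (3 : ℕ) by norm_num, Real.rpow_natCast]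
          gcongr

theorem norm_kernelInt_comp_neg (φ χ : ℝ → ℝ) (κ s : ℝ) (ℓ : E3 →L[ℝ] ℝ) (ε δ : ℝ) :
    ‖kernelInt φ (fun y => χ (-y)) κ s ℓ ε δ‖ = ‖kernelInt φ χ κ s ℓ ε δ‖ := by
  rw [← RCLike.norm_conj (kernelInt φ χ κ s ℓ ε δ), kernelInt, kernelInt, ← integral_conj,
    ← integral_neg_eq_self]
  congr 1
  refine integral_congr_ae (Filter.Eventually.of_forall fun x => ?_)
  have h1 : Om κ (-x) = -Om κ x := by
    simp only [Om, d1, d2, PiLp.neg_apply]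
    rw [neg_sq, neg_sq, show (-x 2 - κ⁻¹) ^ 2 = (x 2 + κ⁻¹) ^ 2 by ring,
      show (-x 2 + κ⁻¹) ^ 2 = (x 2 - κ⁻¹) ^ 2 by ring]
    ring
  have h2 : nrmh (-x) = nrmh x := by simp [nrmh]
  simp only [map_mul, conj_osc, Complex.conj_ofReal, h1, h2, norm_neg, map_neg, PiLp.neg_apply,
    mul_neg, neg_neg, neg_add]

theorem integrable_kernelInt (hφ : IsBump φ) (hχ : ContDiff ℝ 4 χ) (κ s : ℝ) (ℓ : E3 →L[ℝ] ℝ)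
    (ε δ : ℝ) : Integrable fun x => osc (s * Om κ x + ℓ x) *
      ((φ ‖x‖ * φ (ε⁻¹ * nrmh x) * χ (δ⁻¹ * x 2) : ℝ) : ℂ) := by
  refine Continuous.integrable_of_hasCompactSupport ?_ ?_
  · refine (continuous_osc.comp (by have := continuous_Om κ; fun_prop)).mul ?_
    exact Complex.continuous_ofReal.comp (continuous_kernelAmp hφ hχ ε δ)
  · refine HasCompactSupport.of_support_subset_isCompact (isCompact_closedBall (0 : E3) 4)
      fun x hx => ?_
    have h : φ ‖x‖ ≠ 0 := fun h => hx (by simp [h])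
    have := (hφ.supp _ h).2
    rwa [abs_norm, ← mem_closedBall_zero_iff] at this

theorem kernelInt_add {χ₁ χ₂ : ℝ → ℝ} (hφ : IsBump φ) (h₁ : ContDiff ℝ 4 χ₁) (h₂ : ContDiff ℝ 4 χ₂)
    (κ s : ℝ) (ℓ : E3 →L[ℝ] ℝ) (ε δ : ℝ) :
    kernelInt φ (fun y => χ₁ y + χ₂ y) κ s ℓ ε δ =
      kernelInt φ χ₁ κ s ℓ ε δ + kernelInt φ χ₂ κ s ℓ ε δ := by
  rw [kernelInt, kernelInt, kernelInt,
    ← integral_add (integrable_kernelInt hφ h₁ κ s ℓ ε δ) (integrable_kernelInt hφ h₂ κ s ℓ ε δ)]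
  refine integral_congr_ae (Filter.Eventually.of_forall fun x => ?_)
  push_cast
  ring

theorem contDiff_indicator_Ioi (hφ : IsBump φ) : ContDiff ℝ 4 ((Set.Ioi 0).indicator φ) := by
  rw [contDiff_iff_contDiffAt]
  intro y
  by_cases hy : 0 < y
  · refine hφ.contDiff.contDiffAt.congr_of_eventuallyEq ?_
    filter_upwards [Ioi_mem_nhds hy] with z hz
    exact Set.indicator_of_mem hz _
  · refine (contDiffAt_const (c := (0 : ℝ))).congr_of_eventuallyEq ?_
    filter_upwards [Iio_mem_nhds (show y < 1 by linarith)] with z hz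
    refine Set.indicator_apply_eq_zero.mpr fun hz0 => ?_
    by_contra h
    have := (hφ.supp z h).1
    rw [abs_of_pos hz0] at this
    exact absurd hz (not_lt.mpr this)

theorem exists_kernelInt_decay (hφ : IsBump φ) :
    ∃ C : ℝ, 0 ≤ C ∧ ∀ (κ m ε δ s : ℝ) (ℓ : E3 →L[ℝ] ℝ), 0 < κ → IsRate κ m → 0 < ε → ε ≤ 1 →
      0 < δ → δ ≤ 1 → 0 < s →
      ‖kernelInt φ φ κ s ℓ ε δ‖ ≤
        C * (s ^ (-(3 / 2) : ℝ) * m * (ε⁻¹ * δ ^ (-(1 / 2) : ℝ))) := by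
  set χ₁ := (Set.Ioi 0).indicator φ with hχ₁
  set χ₂ : ℝ → ℝ := fun y => (Set.Iic 0).indicator φ (-y) with hχ₂
  have hd₁ : ContDiff ℝ 4 χ₁ := contDiff_indicator_Ioi hφ
  have e₂ : (Set.Iic 0).indicator φ = fun y => φ y - χ₁ y := by
    funext y
    by_cases hy : 0 < y
    · simp [hχ₁, hy]
    · simp [hχ₁, hy, not_lt.mp hy]
  have hd : ContDiff ℝ 4 ((Set.Iic 0).indicator φ) := by
    rw [e₂]; exact hφ.contDiff.sub hd₁
  have hd₂ : ContDiff ℝ 4 χ₂ := hd.comp contDiff_neg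
  obtain ⟨C₁, h₁, hC₁⟩ := exists_kernelInt_decay_of_pos hφ hd₁ fun y hy => by
    have := hφ.supp y fun h => hy (Set.indicator_apply_eq_zero.mpr fun _ => h)
    rwa [abs_of_pos (Set.mem_of_indicator_ne_zero hy)] at this
  obtain ⟨C₂, h₂, hC₂⟩ := exists_kernelInt_decay_of_pos hφ hd₂ fun y hy => by
    have := hφ.supp (-y) fun h => hy (Set.indicator_apply_eq_zero.mpr fun _ => h)
    have hy0 : -y ∈ Set.Iic (0 : ℝ) := Set.mem_of_indicator_ne_zero (f := φ) hy
    rwa [abs_of_nonpos (Set.mem_Iic.mp hy0), neg_neg] at this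
  refine ⟨C₁ + C₂, by positivity, fun κ m ε δ s ℓ hκ hm hε hε1 hδ hδ1 hs => ?_⟩
  have hsum : kernelInt φ φ κ s ℓ ε δ =
      kernelInt φ χ₁ κ s ℓ ε δ + kernelInt φ ((Set.Iic 0).indicator φ) κ s ℓ ε δ := by
    rw [← kernelInt_add hφ hd₁ hd]
    simp [e₂]
  rw [hsum, add_mul]
  refine (norm_add_le _ _).trans (add_le_add (hC₁ κ m ε δ s ℓ hκ hm hε hε1 hδ hδ1 hs) ?_)
  rw [← norm_kernelInt_comp_neg]
  exact hC₂ κ m ε δ s ℓ hκ hm hε hε1 hδ hδ1 hs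

theorem isBump_lpBump {ψ : ℝ → ℝ} (hψ : IsCutoff ψ) : IsBump (lpBump ψ) := by
  obtain ⟨h1, -, h3, h4⟩ := hψ
  refine ⟨?_, fun y hy => ?_⟩
  · have h : ContDiff ℝ 4 ψ := mod_cast contDiff_infty.mp h1 4
    unfold lpBump
    fun_prop
  · by_contra! hcon
    refine hy ?_
    rw [lpBump]
    rcases lt_or_ge |y| 1 with hlt | hge
    · rw [h4 y hlt.le, h4 (y / 2) (by rw [abs_div, abs_two]; linarith), sub_self]
    · have := hcon hge
      rw [h3 y (by linarith), h3 (y / 2) (by rw [abs_div, abs_two]; linarith), sub_self]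

theorem Om_smul (κ : ℝ) {r : ℝ} (hr : 0 < r) (x : E3) : Om κ (r • x) = r * Om (κ * r) x := by
  have h : ∀ a : ℝ, √((r • x) 0 ^ 2 + (r • x) 1 ^ 2 + ((r • x) 2 + a * κ⁻¹) ^ 2) =
      r * √(x 0 ^ 2 + x 1 ^ 2 + (x 2 + a * (κ * r)⁻¹) ^ 2) := fun a => by
    rw [← Real.sqrt_sq hr.le, ← Real.sqrt_mul (sq_nonneg r), Real.sqrt_sq hr.le]
    congr 1
    simp only [PiLp.smul_apply, smul_eq_mul]
    field_simp
  have h1 := h 1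
  have h2 := h (-1)
  simp only [one_mul, neg_mul, ← sub_eq_add_neg] at h1 h2
  rw [Om, d1, d2, h1, h2, Om, d1, d2]
  ring

theorem nrmh_smul {r : ℝ} (hr : 0 ≤ r) (x : E3) : nrmh (r • x) = r * nrmh x := by
  rw [nrmh, nrmh, ← Real.sqrt_sq hr, ← Real.sqrt_mul (sq_nonneg r), Real.sqrt_sq hr]
  congr 1
  simp only [PiLp.smul_apply, smul_eq_mul]
  ring

theorem exists_clm_eq_dot3 (x : E3) : ∃ ℓ : E3 →L[ℝ] ℝ, ∀ ξ, ℓ ξ = dot3 x ξ := by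
  refine ⟨innerSL ℝ x, fun ξ => ?_⟩
  rw [innerSL_apply_apply, PiLp.inner_apply, Fin.sum_univ_three, dot3]
  simp [mul_comm]

theorem exists_integral_eq_kernelInt (φ : ℝ → ℝ) (κ t : ℝ) (x : E3) (k p q : ℤ) :
    ∃ ℓ : E3 →L[ℝ] ℝ,
      ∫ ξ : E3, Complex.exp (Complex.I * ((t * Om κ ξ + dot3 x ξ : ℝ) : ℂ)) *
        ((φ ((2 : ℝ) ^ (-k) * ‖ξ‖) * φ ((2 : ℝ) ^ (-(k + p)) * nrmh ξ)
          * φ ((2 : ℝ) ^ (-(k + q)) * ξ 2) : ℝ) : ℂ) =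
      ((((2 : ℝ) ^ k) ^ 3 : ℝ) : ℂ) *
        kernelInt φ φ (κ * 2 ^ k) (t * 2 ^ k) ℓ ((2 : ℝ) ^ p) ((2 : ℝ) ^ q) := by
  obtain ⟨ℓ, hℓ⟩ := exists_clm_eq_dot3 x
  set r : ℝ := 2 ^ k with hr
  have hr0 : 0 < r := by positivity
  refine ⟨r • ℓ, ?_⟩
  have h := Measure.integral_comp_smul (volume : Measure E3) (fun ξ : E3 =>
    Complex.exp (Complex.I * ((t * Om κ ξ + dot3 x ξ : ℝ) : ℂ)) *
        ((φ ((2 : ℝ) ^ (-k) * ‖ξ‖) * φ ((2 : ℝ) ^ (-(k + p)) * nrmh ξ)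
          * φ ((2 : ℝ) ^ (-(k + q)) * ξ 2) : ℝ) : ℂ)) r
  rw [finrank_euclideanSpace_fin, abs_of_pos (by positivity), eq_comm,
    inv_smul_eq_iff₀ (by positivity), Complex.real_smul] at h
  rw [h, kernelInt]
  congr 1
  refine integral_congr_ae (Filter.Eventually.of_forall fun y => ?_)
  have e1 : (2 : ℝ) ^ (-k) * (r * ‖y‖) = ‖y‖ := by
    rw [zpow_neg, ← hr, inv_mul_cancel_left₀ hr0.ne']
  have e2 : ∀ (j : ℤ) (a : ℝ), (2 : ℝ) ^ (-(k + j)) * (r * a) = ((2 : ℝ) ^ j)⁻¹ * a := by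
    intro j a
    rw [zpow_neg, zpow_add₀ two_ne_zero, ← hr]
    field_simp
  have e3 : t * Om κ (r • y) + dot3 x (r • y) = t * r * Om (κ * r) y + (r • ℓ) y := by
    rw [Om_smul κ hr0, ← hℓ, map_smul]
    simp only [smul_apply, smul_eq_mul]
    ring
  simp only [e3, norm_smul, Real.norm_of_nonneg hr0.le, e1, nrmh_smul hr0.le, e2, PiLp.smul_apply,
    smul_eq_mul, osc]

end Assembly

/-- Convolution-kernel form of the `t^{-3/2}` dispersive decay estimate for
the `Ω` half-wave `e^{itΩ_κ}P_{k,p,q}`, in the three regimes `κ2ᵏ ≫ 1`, `κ2ᵏ ∼ 1`, `κ2ᵏ ≪ 1`. -/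
theorem Omega_kernel_decay (ψ : ℝ → ℝ) (hψ : IsCutoff ψ) :
    ∃ C > 0, ∃ K : ℝ, 2 ≤ K ∧
      ∀ (κ t : ℝ) (x : E3) (k p q : ℤ), 0 < κ → 0 < t → p ≤ 0 → q ≤ 0 →
        (K ≤ κ * 2 ^ k →
          ‖∫ ξ : E3, Complex.exp (Complex.I * ((t * Om κ ξ + dot3 x ξ : ℝ) : ℂ)) *
              ((lpBump ψ ((2 : ℝ) ^ (-k) * ‖ξ‖) * lpBump ψ ((2 : ℝ) ^ (-(k + p)) * nrmh ξ)
                * lpBump ψ ((2 : ℝ) ^ (-(k + q)) * ξ 2) : ℝ) : ℂ)‖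
            ≤ C * t ^ (-(3 / 2) : ℝ) * κ ^ ((3 / 2) : ℝ)
              * (2 : ℝ) ^ (3 * (k : ℝ) - (p : ℝ) - (q : ℝ) / 2)) ∧
        (K⁻¹ ≤ κ * 2 ^ k → κ * 2 ^ k ≤ K →
          ‖∫ ξ : E3, Complex.exp (Complex.I * ((t * Om κ ξ + dot3 x ξ : ℝ) : ℂ)) *
              ((lpBump ψ ((2 : ℝ) ^ (-k) * ‖ξ‖) * lpBump ψ ((2 : ℝ) ^ (-(k + p)) * nrmh ξ)
                * lpBump ψ ((2 : ℝ) ^ (-(k + q)) * ξ 2) : ℝ) : ℂ)‖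
            ≤ C * t ^ (-(3 / 2) : ℝ)
              * (2 : ℝ) ^ ((3 / 2) * (k : ℝ) - (p : ℝ) - (q : ℝ) / 2)) ∧
        (κ * 2 ^ k ≤ K⁻¹ →
          ‖∫ ξ : E3, Complex.exp (Complex.I * ((t * Om κ ξ + dot3 x ξ : ℝ) : ℂ)) *
              ((lpBump ψ ((2 : ℝ) ^ (-k) * ‖ξ‖) * lpBump ψ ((2 : ℝ) ^ (-(k + p)) * nrmh ξ)
                * lpBump ψ ((2 : ℝ) ^ (-(k + q)) * ξ 2) : ℝ) : ℂ)‖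
            ≤ C * t ^ (-(3 / 2) : ℝ) * κ ^ (-(3 : ℝ))
              * (2 : ℝ) ^ (-(3 / 2) * (k : ℝ) - (p : ℝ) - (q : ℝ) / 2)) := by
  obtain ⟨C, hC, hCb⟩ := exists_kernelInt_decay (isBump_lpBump hψ)
  refine ⟨C + 1, by positivity, 8, by norm_num, fun κ t x k p q hκ ht hp hq => ?_⟩
  obtain ⟨ℓ, hℓ⟩ := exists_integral_eq_kernelInt (lpBump ψ) κ t x k p q
  have hz : ∀ j : ℤ, (2 : ℝ) ^ j = (2 : ℝ) ^ (j : ℝ) := fun j => (Real.rpow_intCast 2 j).symm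
  have hle1 : ∀ j : ℤ, j ≤ 0 → (2 : ℝ) ^ j ≤ 1 := fun j hj =>
    zpow_le_one_of_nonpos₀ one_le_two hj
  have key : ∀ m b, IsRate (κ * 2 ^ k) m → 0 ≤ b →
      m * (2 : ℝ) ^ ((3 / 2) * (k : ℝ) - (p : ℝ) - (q : ℝ) / 2) = b →
      ‖((((2 : ℝ) ^ k) ^ 3 : ℝ) : ℂ) * kernelInt (lpBump ψ) (lpBump ψ) (κ * 2 ^ k) (t * 2 ^ k) ℓ
        ((2 : ℝ) ^ p) ((2 : ℝ) ^ q)‖ ≤ (C + 1) * t ^ (-(3 / 2) : ℝ) * b := by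
    intro m b hm hb hmb
    have h := hCb (κ * 2 ^ k) m (2 ^ p) (2 ^ q) (t * 2 ^ k) ℓ (by positivity) hm (by positivity)
      (hle1 p hp) (by positivity) (hle1 q hq) (by positivity)
    rw [norm_mul, Complex.norm_real, Real.norm_of_nonneg (by positivity)]
    refine (mul_le_mul_of_nonneg_left h (by positivity)).trans ?_
    have e : ((2 : ℝ) ^ k) ^ 3 * (C * ((t * 2 ^ k) ^ (-(3 / 2) : ℝ) * m *
        (((2 : ℝ) ^ p)⁻¹ * ((2 : ℝ) ^ q) ^ (-(1 / 2) : ℝ)))) = C * t ^ (-(3 / 2) : ℝ) * b := by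
      have e2 : (2 : ℝ) ^ ((3 / 2) * (k : ℝ) - (p : ℝ) - (q : ℝ) / 2) =
          ((2 : ℝ) ^ k) ^ 3 * ((2 : ℝ) ^ k) ^ (-(3 / 2) : ℝ) *
            (((2 : ℝ) ^ p)⁻¹ * ((2 : ℝ) ^ q) ^ (-(1 / 2) : ℝ)) := by
        simp only [hz, ← Real.rpow_neg zero_le_two, ← Real.rpow_mul zero_le_two,
          ← Real.rpow_natCast, ← Real.rpow_add zero_lt_two]
        congr 1
        push_cast
        ring
      rw [← hmb, e2, Real.mul_rpow ht.le (by positivity)]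
      ring
    rw [e]
    gcongr
    linarith
  rw [hℓ]
  refine ⟨fun h => ?_, fun h h' => ?_, fun h => ?_⟩
  · rw [mul_assoc]
    refine key _ _ (Or.inl ⟨h, rfl⟩) (by positivity) ?_
    rw [Real.mul_rpow hκ.le (by positivity), mul_assoc, hz, ← Real.rpow_mul zero_le_two,
      ← Real.rpow_add zero_lt_two]
    congr 2
    ring
  · exact key _ _ (Or.inr (Or.inl ⟨by linarith, h', rfl⟩)) (by positivity) (one_mul _)
  · rw [mul_assoc]
    refine key _ _ (Or.inr (Or.inr ⟨by linarith, rfl⟩)) (by positivity) ?_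
    rw [Real.mul_rpow hκ.le (by positivity), mul_assoc, hz, ← Real.rpow_mul zero_le_two,
      ← Real.rpow_add zero_lt_two]
    congr 2
    ring
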